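/- There exists an absolute constant C' > 0 with the following property. Let N ≥ 2 be a square-free integer and let u, v be integers with gcd(u, v, N) = 1. Let v_P be a vector of minimal Euclidean norm ‖v_P‖ among the nonzero vectors of Λ_{(u:v)}. Then there exist integers c, d with gcd(c, d) = 1, (c, d) ∈ Λ_{(u:v)}, and max(|c|, |d|) ≤ N/‖v_P‖ + C'·(log N)²·‖v_P‖. -/

import Mathlib

/-- The lattice of integer representatives of the point `(u : v)` of `ℙ¹(ℤ/Nℤ)`. -/
def repLattice (N : ℕ) (u v : ℤ) : Set (ℤ × ℤ) := {p | (N : ℤ) ∣ p.1 * v - p.2 * u}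

section
def JacProp : Prop := ∃ C : ℝ, 0 < C ∧ ∀ h : ℕ, 1 ≤ h → ∀ Y : ℝ, Real.log h ≤ Y → Real.log 2 ≤ Y →
  ∀ a : ℕ → ℤ, ∀ T : ℝ, ∃ k : ℤ, T < k ∧ (k : ℝ) ≤ T + C * Y ^ 2 ∧
    ∀ p : ℕ, p.Prime → p ∣ h → ¬ (p : ℤ) ∣ k - a p

lemma lattice_core (N : ℕ) (hN : 2 ≤ N) (hsq : Squarefree N) (u v : ℤ) (a b : ℤ)
    (hmem : (N : ℤ) ∣ a * v - b * u) (hne : a ≠ 0 ∨ b ≠ 0)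
    (hmin : ∀ c d : ℤ, (N : ℤ) ∣ c * v - d * u → (c ≠ 0 ∨ d ≠ 0) → a ^ 2 + b ^ 2 ≤ c ^ 2 + d ^ 2) :
    ∃ (h : ℕ) (r : ℕ → ℤ) (c0 d0 : ℤ), 1 ≤ h ∧ h ∣ N ∧ a * d0 - b * c0 = N ∧
      ∀ k : ℤ, (∀ p : ℕ, p.Prime → p ∣ h → ¬ (p : ℤ) ∣ k - r p) →
        IsCoprime (c0 + k * a) (d0 + k * b) ∧ (N : ℤ) ∣ (c0 + k * a) * v - (d0 + k * b) * u := by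
  have hgpos : 0 < Int.gcd a b := by
    rcases hne with h | h
    · exact Int.gcd_pos_of_ne_zero_left _ h
    · exact Int.gcd_pos_of_ne_zero_right _ h
  obtain ⟨g, hg⟩ : ∃ g : ℕ, g = Int.gcd a b := ⟨_, rfl⟩
  rw [← hg] at hgpos
  obtain ⟨a', ha'⟩ : (g : ℤ) ∣ a := hg ▸ Int.gcd_dvd_left ..
  obtain ⟨b', hb'⟩ : (g : ℤ) ∣ b := hg ▸ Int.gcd_dvd_right ..
  have hgz : (g : ℤ) ≠ 0 := by exact_mod_cast hgpos.ne'
  obtain ⟨x, y, hxy⟩ : ∃ x y : ℤ, a' * x + b' * y = 1 := by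
    refine ⟨Int.gcdA a b, Int.gcdB a b, ?_⟩
    have := Int.gcd_eq_gcd_ab a b
    rw [← hg] at this
    have h2 : (g : ℤ) * (a' * Int.gcdA a b + b' * Int.gcdB a b) = g * 1 := by
      calc (g : ℤ) * (a' * Int.gcdA a b + b' * Int.gcdB a b)
          = (g * a') * Int.gcdA a b + (g * b') * Int.gcdB a b := by ring
        _ = a * Int.gcdA a b + b * Int.gcdB a b := by rw [← ha', ← hb']
        _ = g * 1 := by rw [← this]; ring
    exact mul_left_cancel₀ hgz h2
  obtain ⟨α, hα⟩ : ∃ α : ℤ, α = a' * v - b' * u := ⟨_, rfl⟩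
  obtain ⟨β, hβ⟩ : ∃ β : ℤ, β = -y * v - x * u := ⟨_, rfl⟩
  have hNg : (N : ℤ) ∣ g * α := by
    have : (g : ℤ) * α = a * v - b * u := by rw [hα, ha', hb']; ring
    rw [this]; exact hmem
  have hle : ∀ i : ℕ, 0 < i → (N : ℤ) ∣ i * α → g ≤ i := by
    intro i hi hd
    have hiz : (i : ℤ) ≠ 0 := by exact_mod_cast hi.ne'
    have h1 := hmin (i * a') (i * b') (by
      have : (i : ℤ) * a' * v - i * b' * u = i * α := by rw [hα]; ring
      rw [this]; exact hd) (by
      by_contra hcon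
      push Not at hcon
      have e1 : a' = 0 := (mul_eq_zero.1 hcon.1).resolve_left hiz
      have e2 : b' = 0 := (mul_eq_zero.1 hcon.2).resolve_left hiz
      rw [e1, e2] at hxy; simp at hxy)
    have hpos : 0 < a' ^ 2 + b' ^ 2 := by
      by_contra hcon
      have e1 : a' = 0 := by nlinarith [sq_nonneg a', sq_nonneg b']
      have e2 : b' = 0 := by nlinarith [sq_nonneg a', sq_nonneg b']
      rw [e1, e2] at hxy; simp at hxy
    have h2 : (g : ℤ) ^ 2 * (a' ^ 2 + b' ^ 2) ≤ (i : ℤ) ^ 2 * (a' ^ 2 + b' ^ 2) := by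
      rw [ha', hb'] at h1; nlinarith
    have h3 := le_of_mul_le_mul_right h2 hpos
    have h4 : g ^ 2 ≤ i ^ 2 := by exact_mod_cast h3
    exact (Nat.pow_le_pow_iff_left (by norm_num)).1 h4
  have hNz : (N : ℤ) ≠ 0 := by exact_mod_cast (by omega : N ≠ 0)
  obtain ⟨h, hh⟩ : ∃ h : ℕ, h = Int.gcd α N := ⟨_, rfl⟩
  have hhpos : 0 < h := hh ▸ Int.gcd_pos_of_ne_zero_right _ hNz
  have hhz : (h : ℤ) ≠ 0 := by exact_mod_cast hhpos.ne'
  obtain ⟨α', hα'⟩ : (h : ℤ) ∣ α := hh ▸ Int.gcd_dvd_left ..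
  have hhN : h ∣ N := by
    have : (h : ℤ) ∣ N := hh ▸ Int.gcd_dvd_right ..
    exact_mod_cast this
  obtain ⟨m, hm⟩ := hhN
  have hmpos : 0 < m := by
    rcases Nat.eq_zero_or_pos m with h0 | h0
    · subst h0; simp at hm; omega
    · exact h0
  have hcop : IsCoprime α' (m : ℤ) := by
    have := Int.gcd_eq_gcd_ab α N
    rw [← hh] at this
    refine ⟨Int.gcdA α N, Int.gcdB α N, ?_⟩
    apply mul_left_cancel₀ hhz
    have e : (N : ℤ) = h * m := by exact_mod_cast hm
    calc (h : ℤ) * (Int.gcdA α N * α' + Int.gcdB α N * m)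
        = (h * α') * Int.gcdA α N + (h * m) * Int.gcdB α N := by ring
      _ = α * Int.gcdA α N + N * Int.gcdB α N := by rw [← hα', ← e]
      _ = h * 1 := by rw [← this]; ring
  have hNm : (N : ℤ) = h * m := by exact_mod_cast hm
  have hgm : g = m := by
    apply le_antisymm
    · apply hle m hmpos
      rw [hNm, hα']; exact ⟨α', by ring⟩
    · apply Nat.le_of_dvd hgpos
      have : (h : ℤ) * m ∣ h * (α' * g) := by
        have e : (h : ℤ) * (α' * g) = g * α := by rw [hα']; ring
        rw [e, ← hNm]; exact hNg
      have := (mul_dvd_mul_iff_left hhz).1 this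
      exact_mod_cast hcop.symm.dvd_of_dvd_mul_left this
  subst hgm
  have hgh : Nat.Coprime h g := by
    rw [hm] at hsq
    exact (Nat.squarefree_mul_iff.1 hsq).1
  obtain ⟨i, hi⟩ : ∃ i : ℤ, (g : ℤ) ∣ i * α' + β := by
    obtain ⟨s, t, hst⟩ := hcop
    exact ⟨-β * s, ⟨β * t, by linear_combination (-β) * hst⟩⟩
  have hr : ∀ p : ℕ, ∃ r : ℤ, p.Prime → p ∣ h → (p : ℤ) ∣ i + r * g := by
    intro p
    by_cases hp : p.Prime ∧ p ∣ h
    · have hc : Nat.Coprime p g := hgh.coprime_dvd_left hp.2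
      obtain ⟨s, t, hst⟩ := Nat.isCoprime_iff_coprime.2 hc
      exact ⟨-i * t, fun _ _ => ⟨i * s, by linear_combination (-i) * hst⟩⟩
    · exact ⟨0, fun h1 h2 => absurd ⟨h1, h2⟩ hp⟩
  choose r hr using hr
  refine ⟨h, r, i * a' - h * y, i * b' + h * x, hhpos, ⟨g, hm⟩, ?_, ?_⟩
  · rw [hNm, ha', hb']; linear_combination (g * h : ℤ) * hxy
  · intro k hk
    have hcop2 : IsCoprime (i + k * g) (h : ℤ) := by
      rw [Int.isCoprime_iff_gcd_eq_one]
      by_contra hcon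
      obtain ⟨p, hp, hpd⟩ := Nat.exists_prime_and_dvd hcon
      have h1 : (p : ℤ) ∣ i + k * g := (Int.natCast_dvd_natCast.2 hpd).trans (Int.gcd_dvd_left ..)
      have h2 : p ∣ h := by
        exact_mod_cast (Int.natCast_dvd_natCast.2 hpd).trans (Int.gcd_dvd_right (i + k * g) (h : ℤ))
      apply hk p hp h2
      have h3 := hr p hp h2
      have h4 : (p : ℤ) ∣ (k - r p) * g := by
        have := dvd_sub h1 h3
        have e : i + k * g - (i + r p * g) = (k - r p) * g := by ring
        rwa [e] at this
      have hc : Nat.Coprime p g := hgh.coprime_dvd_left h2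
      exact (Nat.isCoprime_iff_coprime.2 hc).dvd_of_dvd_mul_right h4
    constructor
    · obtain ⟨s, t, hst⟩ := hcop2
      refine ⟨s * x - t * b', s * y + t * a', ?_⟩
      rw [ha', hb']
      linear_combination hst + (s * (i + k * g) + t * h) * hxy
    · obtain ⟨q, hq⟩ := hi
      refine ⟨q + k * α', ?_⟩
      rw [hNm, ha', hb']
      have e1 : α' * (h : ℤ) = a' * v - b' * u := by rw [← hα, hα']; ring
      have hq' : i * α' + (-y * v - x * u) = g * q := by rw [← hβ]; exact hq
      linear_combination (h : ℤ) * hq' - (i + k * g) * e1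

lemma norm_bound (a b c d L t n k : ℝ) (hL : L = Real.sqrt (a ^ 2 + b ^ 2)) (hLpos : 0 < L) (hn : 0 < n)
    (hdet : a * d - b * c = n) (ht : t * L ^ 2 = a * c + b * d) (ht0 : 0 ≤ t) (htk : t ≤ k) :
    max |c| |d| ≤ n / L + k * L := by
  have hL2 : L ^ 2 = a ^ 2 + b ^ 2 := by rw [hL, Real.sq_sqrt (by positivity)]
  have haL : |a| ≤ L := by rw [← sq_le_sq₀ (abs_nonneg _) hLpos.le, sq_abs]; nlinarith [sq_nonneg b]
  have hbL : |b| ≤ L := by rw [← sq_le_sq₀ (abs_nonneg _) hLpos.le, sq_abs]; nlinarith [sq_nonneg a]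
  have hc : c * L ^ 2 = a * t * L ^ 2 - b * n := by rw [← hdet, mul_assoc, ht, hL2]; ring
  have hd : d * L ^ 2 = b * t * L ^ 2 + a * n := by rw [← hdet, mul_assoc, ht, hL2]; ring
  have key : n / L + k * L = (n * L + k * L * L ^ 2) / L ^ 2 := by field_simp
  have hL2pos : 0 < L ^ 2 := by positivity
  have htL : t * L ≤ k * L := mul_le_mul_of_nonneg_right htk hLpos.le
  have aux : ∀ e f : ℝ, |e| ≤ L → |f| ≤ L → |e * t * L ^ 2 + f * n| ≤ n * L + k * L * L ^ 2 := by
    intro e f he hf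
    calc |e * t * L ^ 2 + f * n| ≤ |e * t * L ^ 2| + |f * n| := abs_add_le _ _
      _ = |e| * t * L ^ 2 + |f| * n := by
        rw [abs_mul, abs_mul, abs_mul, abs_of_nonneg ht0, abs_of_pos hL2pos, abs_of_pos hn]
      _ ≤ L * t * L ^ 2 + L * n := by gcongr
      _ ≤ _ := by nlinarith
  rw [key]
  apply max_le
  · rw [le_div_iff₀ hL2pos]
    rw [← abs_of_pos hL2pos, ← abs_mul, hc, abs_of_pos hL2pos]
    have := aux a (-b) haL (by rwa [abs_neg])
    rwa [neg_mul, ← sub_eq_add_neg] at this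
  · rw [le_div_iff₀ hL2pos]
    rw [← abs_of_pos hL2pos, ← abs_mul, hd, abs_of_pos hL2pos]
    exact aux b a hbL haL

theorem final_of_jac (hJ : JacProp) :
    ∃ C' : ℝ, 0 < C' ∧ ∀ N : ℕ, 2 ≤ N → Squarefree N →
    ∀ u v : ℤ, Int.gcd u (Int.gcd v (N : ℤ)) = 1 →
    ∀ vP ∈ repLattice N u v, vP ≠ (0, 0) →
      (∀ w ∈ repLattice N u v, w ≠ (0, 0) →
        vP.1 ^ 2 + vP.2 ^ 2 ≤ w.1 ^ 2 + w.2 ^ 2) →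
    ∃ c d : ℤ, IsCoprime c d ∧ (c, d) ∈ repLattice N u v ∧
      ((max |c| |d| : ℤ) : ℝ) ≤
        (N : ℝ) / Real.sqrt ((vP.1 : ℝ) ^ 2 + (vP.2 : ℝ) ^ 2) +
          C' * Real.log N ^ 2 * Real.sqrt ((vP.1 : ℝ) ^ 2 + (vP.2 : ℝ) ^ 2) := by
  obtain ⟨C, hC, hJ⟩ := hJ
  refine ⟨C, hC, ?_⟩
  rintro N hN hsq u v - ⟨a, b⟩ hmem hne hmin
  have hne' : a ≠ 0 ∨ b ≠ 0 := by
    by_contra hcon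
    push Not at hcon
    exact hne (by rw [hcon.1, hcon.2])
  obtain ⟨h, r, c0, d0, h1, hhN, hdet, hk⟩ := lattice_core N hN hsq u v a b hmem hne' (by
    intro c d hcd hcd0
    refine hmin (c, d) hcd ?_
    intro he
    simp only [Prod.mk.injEq] at he
    rcases hcd0 with h | h
    · exact h he.1
    · exact h he.2)
  have hNpos : (0 : ℝ) < N := by exact_mod_cast (by omega : 0 < N)
  have hLpos : 0 < (a : ℝ) ^ 2 + (b : ℝ) ^ 2 := by
    rcases hne' with h | h
    · have : (a : ℝ) ≠ 0 := by exact_mod_cast h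
      positivity
    · have : (b : ℝ) ≠ 0 := by exact_mod_cast h
      positivity
  obtain ⟨k, hk1, hk2, hk3⟩ := hJ h h1 (Real.log N) (by
      apply Real.log_le_log (by exact_mod_cast h1)
      exact_mod_cast Nat.le_of_dvd (by omega) hhN)
    (Real.log_le_log (by norm_num) (by exact_mod_cast hN)) r
    (-((a * c0 + b * d0 : ℝ) / ((a : ℝ) ^ 2 + (b : ℝ) ^ 2)))
  obtain ⟨hc, hd⟩ := hk k hk3
  refine ⟨_, _, hc, hd, ?_⟩
  have := norm_bound (a : ℝ) b (c0 + k * a) (d0 + k * b) _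
    (k + (a * c0 + b * d0 : ℝ) / ((a : ℝ) ^ 2 + (b : ℝ) ^ 2)) N (C * Real.log N ^ 2) rfl
    (Real.sqrt_pos.2 hLpos) hNpos (by
      have : (a * d0 - b * c0 : ℝ) = N := by exact_mod_cast hdet
      linear_combination this) (by
      rw [Real.sq_sqrt hLpos.le]; field_simp; ring) (by linarith) (by linarith)
  push_cast
  exact this
end

section
noncomputable def sieveS (a : ℕ → ℤ) (T X : ℝ) (z : ℕ) : ℕ :=
  by classical exact ((Finset.Ioc ⌊T⌋ ⌊T + X⌋).filter (fun k => ∀ p : ℕ, p.Prime → p < z → ¬ (p : ℤ) ∣ k - a p)).card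

noncomputable def VV (z : ℕ) : ℝ := ∏ p ∈ (Finset.range z).filter Nat.Prime, (1 - 1 / (p : ℝ))

lemma VV_succ_prime {p : ℕ} (hp : p.Prime) : VV (p + 1) = VV p * (1 - 1 / (p : ℝ)) := by
  unfold VV
  rw [Finset.range_add_one, Finset.filter_insert, if_pos hp, Finset.prod_insert (by simp), mul_comm]

lemma VV_succ_nonprime {p : ℕ} (hp : ¬ p.Prime) : VV (p + 1) = VV p := by
  unfold VV
  rw [Finset.range_add_one, Finset.filter_insert, if_neg hp]

lemma VV_pos (z : ℕ) : 0 < VV z := by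
  unfold VV
  apply Finset.prod_pos
  intro p hp
  have := (Finset.mem_filter.1 hp).2.two_le
  have h2 : (2 : ℝ) ≤ p := by exact_mod_cast this
  have : 1 / (p : ℝ) ≤ 1 / 2 := by gcongr
  linarith

lemma sieveS_anti (a : ℕ → ℤ) (T X : ℝ) {z w : ℕ} (h : z ≤ w) : sieveS a T X w ≤ sieveS a T X z := by
  classical
  unfold sieveS
  apply Finset.card_le_card
  intro k hk
  simp only [Finset.mem_filter] at hk ⊢
  exact ⟨hk.1, fun p hp hz => hk.2 p hp (by omega)⟩

lemma sieveS_mono (a : ℕ → ℤ) (T : ℝ) {X X' : ℝ} (z : ℕ) (h : X ≤ X') :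
    sieveS a T X z ≤ sieveS a T X' z := by
  classical
  unfold sieveS
  apply Finset.card_le_card
  apply Finset.filter_subset_filter
  apply Finset.Ioc_subset_Ioc le_rfl
  apply Int.floor_le_floor
  linarith

lemma sieveS_zero (a : ℕ → ℤ) (T X : ℝ) (hX : 0 ≤ X) : |(sieveS a T X 0 : ℝ) - X| ≤ 1 := by
  classical
  have : sieveS a T X 0 = (⌊T + X⌋ - ⌊T⌋).toNat := by
    unfold sieveS
    rw [Finset.filter_true_of_mem (by simp), Int.card_Ioc]
  rw [this]
  have h0 : 0 ≤ ⌊T + X⌋ - ⌊T⌋ := by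
    have := Int.floor_le_floor (show T ≤ T + X by linarith)
    linarith
  have h1 : (((⌊T + X⌋ - ⌊T⌋).toNat : ℕ) : ℝ) = (⌊T + X⌋ : ℝ) - ⌊T⌋ := by
    have : (((⌊T + X⌋ - ⌊T⌋).toNat : ℕ) : ℤ) = ⌊T + X⌋ - ⌊T⌋ := Int.toNat_of_nonneg h0
    exact_mod_cast this
  rw [h1, abs_le]
  have := Int.floor_le (T + X)
  have := Int.lt_floor_add_one (T + X)
  have := Int.floor_le T
  have := Int.lt_floor_add_one T
  constructor <;> linarith

lemma sieveS_le (a : ℕ → ℤ) (T X : ℝ) (hX : 0 ≤ X) (z : ℕ) : (sieveS a T X z : ℝ) ≤ X + 1 := by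
  have h1 : (sieveS a T X z : ℝ) ≤ sieveS a T X 0 := by exact_mod_cast sieveS_anti a T X (Nat.zero_le z)
  have := (abs_le.1 (sieveS_zero a T X hX)).2
  linarith

lemma sieveS_child_exists (a : ℕ → ℤ) (T : ℝ) (p : ℕ) :
    ∃ (a' : ℕ → ℤ) (T' : ℝ), p.Prime → ∀ (X : ℝ) (z : ℕ), z ≤ p →
      (by classical exact ((Finset.Ioc ⌊T⌋ ⌊T + X⌋).filter (fun k => (∀ q : ℕ, q.Prime → q < z → ¬ (q : ℤ) ∣ k - a q) ∧
        (p : ℤ) ∣ k - a p)).card) = sieveS a' T' (X / p) z := by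
  classical
  by_cases hp : p.Prime
  swap
  · exact ⟨a, T, fun h => absurd h hp⟩
  have hr : ∀ q : ℕ, ∃ r : ℤ, q.Prime → q < p → ∀ j : ℤ, ((q : ℤ) ∣ a p + p * j - a q ↔ (q : ℤ) ∣ j - r) := by
    intro q
    by_cases hq : q.Prime ∧ q < p
    · have hc : IsCoprime (q : ℤ) (p : ℤ) :=
        Nat.isCoprime_iff_coprime.2 ((Nat.coprime_primes hq.1 hp).2 hq.2.ne)
      obtain ⟨s, t, hst⟩ := hc
      refine ⟨t * (a q - a p), fun _ _ j => ?_⟩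
      constructor
      · rintro ⟨m, hm⟩
        exact ⟨t * m + s * j, by linear_combination t * hm - j * hst⟩
      · rintro ⟨m, hm⟩
        exact ⟨p * m - s * (a q - a p), by linear_combination p * hm + (a q - a p) * hst⟩
    · exact ⟨0, fun h1 h2 => absurd ⟨h1, h2⟩ hq⟩
  choose r hr using hr
  refine ⟨r, (T - a p) / p, fun _ X z hz => ?_⟩
  unfold sieveS
  have hp0 : (0 : ℝ) < p := by exact_mod_cast hp.pos
  have hpz : (p : ℤ) ≠ 0 := by exact_mod_cast hp.ne_zero
  symm
  apply Finset.card_bij (fun j _ => a p + p * j)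
  · intro j hj
    simp only [Finset.mem_filter, Finset.mem_Ioc, Int.floor_lt, Int.le_floor] at hj ⊢
    obtain ⟨⟨h1, h2⟩, h3⟩ := hj
    refine ⟨⟨?_, ?_⟩, ?_, ⟨j, by ring⟩⟩
    · push_cast
      rw [div_lt_iff₀ hp0] at h1
      linarith
    · push_cast
      rw [← add_div, le_div_iff₀ hp0] at h2
      linarith
    · intro q hq hqz hd
      exact h3 q hq hqz ((hr q hq (by omega) j).1 hd)
  · intro j _ j' _ h
    have : (p : ℤ) * j = p * j' := by linarith
    exact mul_left_cancel₀ hpz this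
  · intro k hk
    simp only [Finset.mem_filter, Finset.mem_Ioc, Int.floor_lt, Int.le_floor] at hk ⊢
    obtain ⟨⟨h1, h2⟩, h3, ⟨j, hj⟩⟩ := hk
    have hk : k = a p + p * j := by linarith
    subst hk
    push_cast at h1 h2
    refine ⟨j, ⟨⟨?_, ?_⟩, ?_⟩, rfl⟩
    · rw [div_lt_iff₀ hp0]; linarith
    · rw [← add_div, le_div_iff₀ hp0]; linarith
    · intro q hq hqz hd
      exact h3 q hq hqz ((hr q hq (by omega) j).2 hd)

lemma sieveS_buchstab (a : ℕ → ℤ) (T : ℝ) :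
    ∃ (a' : ℕ → ℕ → ℤ) (T' : ℕ → ℝ), ∀ p : ℕ, p.Prime →
      (∀ (X : ℝ) (z : ℕ), z ≤ p →
      (by classical exact ((Finset.Ioc ⌊T⌋ ⌊T + X⌋).filter (fun k => (∀ q : ℕ, q.Prime → q < z → ¬ (q : ℤ) ∣ k - a q) ∧
        (p : ℤ) ∣ k - a p)).card) = sieveS (a' p) (T' p) (X / p) z) ∧
      ∀ X : ℝ, sieveS a T X p = sieveS a T X (p + 1) + sieveS (a' p) (T' p) (X / p) p := by
  classical
  choose a' T' h using sieveS_child_exists a T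
  refine ⟨a', T', fun p hp => ⟨h p hp, fun X => ?_⟩⟩
  rw [← h p hp X p le_rfl]
  unfold sieveS
  rw [Nat.add_comm (Finset.card _), ← Finset.card_filter_add_card_filter_not (s := (Finset.Ioc ⌊T⌋ ⌊T + X⌋).filter
    (fun k => ∀ q : ℕ, q.Prime → q < p → ¬ (q : ℤ) ∣ k - a q)) (fun k => (p : ℤ) ∣ k - a p)]
  rw [Finset.filter_filter, Finset.filter_filter]
  congr 2
  apply Finset.filter_congr
  intro k _
  constructor
  · rintro ⟨h1, h2⟩ q hq hqp
    rcases Nat.lt_succ_iff_lt_or_eq.1 hqp with h | h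
    · exact h1 q hq h
    · rw [h]; exact h2
  · intro h
    exact ⟨fun q hq hqp => h q hq (by omega), h p hp (by omega)⟩

lemma sieveS_succ_nonprime (a : ℕ → ℤ) (T X : ℝ) {n : ℕ} (hn : ¬ n.Prime) :
    sieveS a T X (n + 1) = sieveS a T X n := by
  classical
  unfold sieveS
  congr 1
  apply Finset.filter_congr
  intro k _
  constructor
  · intro h q hq hqn
    exact h q hq (by omega)
  · intro h q hq hqn
    rcases Nat.lt_succ_iff_lt_or_eq.1 hqn with h' | h'
    · exact h q hq h'
    · rw [h'] at hq; exact absurd hq hn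

lemma sieveS_sum (a : ℕ → ℤ) (T : ℝ) (a' : ℕ → ℕ → ℤ) (T' : ℕ → ℝ) (X : ℝ)
    (h : ∀ p : ℕ, p.Prime → sieveS a T X p = sieveS a T X (p + 1) + sieveS (a' p) (T' p) (X / p) p)
    (z0 z : ℕ) (hz : z0 ≤ z) :
    (sieveS a T X z : ℝ) = sieveS a T X z0 -
      ∑ p ∈ (Finset.Ico z0 z).filter Nat.Prime, (sieveS (a' p) (T' p) (X / p) p : ℝ) := by
  induction z, hz using Nat.le_induction with
  | base => simp
  | succ n hn ih =>
    rw [← Finset.insert_Ico_right_eq_Ico_add_one hn, Finset.filter_insert]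
    by_cases hp : n.Prime
    · rw [if_pos hp, Finset.sum_insert (by simp)]
      have := h n hp
      have h2 : (sieveS a T X n : ℝ) = sieveS a T X (n + 1) + sieveS (a' n) (T' n) (X / n) n := by
        exact_mod_cast this
      linarith
    · rw [if_neg hp, sieveS_succ_nonprime _ _ _ hp, ih]

lemma sieveS_base (z : ℕ) : ∀ (a : ℕ → ℤ) (T X : ℝ), 0 ≤ X → |(sieveS a T X z : ℝ) - X * VV z| ≤ 2 ^ z := by
  induction z with
  | zero =>
    intro a T X hX
    simpa [VV] using sieveS_zero a T X hX
  | succ n ih =>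
    intro a T X hX
    by_cases hp : n.Prime
    · obtain ⟨a', T', h⟩ := sieveS_buchstab a T
      have h1 := (h n hp).2 X
      have h2 : (sieveS a T X n : ℝ) = sieveS a T X (n + 1) + sieveS (a' n) (T' n) (X / n) n := by
        exact_mod_cast h1
      have h3 := abs_le.1 (ih a T X hX)
      have h4 := abs_le.1 (ih (a' n) (T' n) (X / n) (by positivity))
      rw [VV_succ_prime hp, abs_le]
      have e : X * (VV n * (1 - 1 / (n : ℝ))) = X * VV n - X / n * VV n := by ring
      rw [e, pow_succ]
      constructor <;> linarith [h3.1, h3.2, h4.1, h4.2]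
    · rw [sieveS_succ_nonprime _ _ _ hp, VV_succ_nonprime hp]
      refine (ih a T X hX).trans ?_
      gcongr <;> norm_num
end

section
open Real Set
open scoped ArithmeticFunction.Moebius ArithmeticFunction.zeta ArithmeticFunction.vonMangoldt

theorem fubini_div (F : ℕ → ℕ → ℝ) (N : ℕ) :
    ∑ n ∈ Finset.Ioc 0 N, ∑ x ∈ n.divisorsAntidiagonal, F x.1 x.2
      = ∑ k ∈ Finset.Ioc 0 N, ∑ d ∈ Finset.Ioc 0 (N / k), F k d := by
  rw [Finset.sum_sigma', Finset.sum_sigma']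
  refine Finset.sum_bij' (fun x _ => ⟨x.2.1, x.2.2⟩) (fun x _ => ⟨x.1 * x.2, (x.1, x.2)⟩) ?_ ?_ ?_ ?_ ?_
  · rintro ⟨n, k, d⟩ h
    simp only [Finset.mem_sigma, Finset.mem_Ioc, Nat.mem_divisorsAntidiagonal] at h ⊢
    obtain ⟨⟨h1, h2⟩, rfl, h3⟩ := h
    have hk : 0 < k := Nat.pos_of_ne_zero (by rintro rfl; simp at h3)
    have hd : 0 < d := Nat.pos_of_ne_zero (by rintro rfl; simp at h3)
    refine ⟨⟨hk, by nlinarith⟩, hd, ?_⟩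
    rw [Nat.le_div_iff_mul_le hk]; linarith [mul_comm k d]
  · rintro ⟨k, d⟩ h
    simp only [Finset.mem_sigma, Finset.mem_Ioc, Nat.mem_divisorsAntidiagonal] at h ⊢
    obtain ⟨⟨h1, h2⟩, h3, h4⟩ := h
    rw [Nat.le_div_iff_mul_le h1] at h4
    have := Nat.mul_pos h1 h3
    exact ⟨⟨this, by linarith [mul_comm k d]⟩, trivial, this.ne'⟩
  · rintro ⟨n, k, d⟩ h
    simp only [Finset.mem_sigma, Finset.mem_Ioc, Nat.mem_divisorsAntidiagonal] at h
    obtain ⟨⟨h1, h2⟩, rfl, h3⟩ := h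
    rfl
  · rintro ⟨k, d⟩ h
    rfl
  · rintro ⟨n, k, d⟩ h
    rfl

/-- Möbius: inversion of the constant kernel. -/
theorem moeb_one (N : ℕ) (hN : 1 ≤ N) (φ : ℕ → ℝ) :
    ∑ k ∈ Finset.Ioc 0 N, ∑ d ∈ Finset.Ioc 0 (N / k), (μ k : ℝ) * φ (k * d) = φ 1 := by
  rw [← fubini_div (fun k d => (μ k : ℝ) * φ (k * d))]
  have : ∀ n ∈ Finset.Ioc 0 N, ∑ x ∈ n.divisorsAntidiagonal, (μ x.1 : ℝ) * φ (x.1 * x.2)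
      = (if n = 1 then φ 1 else 0) := by
    intro n hn
    have h1 : ∑ x ∈ n.divisorsAntidiagonal, (μ x.1 : ℝ) * φ (x.1 * x.2)
      = (∑ x ∈ n.divisorsAntidiagonal, (μ x.1 : ℝ) * ((ζ x.2 : ℕ) : ℝ)) * φ n := by
      rw [Finset.sum_mul]
      refine Finset.sum_congr rfl fun x hx => ?_
      rw [Nat.mem_divisorsAntidiagonal] at hx
      rw [hx.1]
      have : x.2 ≠ 0 := by rintro h; rw [h] at hx; simp at hx; omega
      simp [ArithmeticFunction.zeta_apply, this]
    have h2 := congrArg (fun f => f n) (ArithmeticFunction.coe_moebius_mul_coe_zeta (R := ℝ))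
    simp only [ArithmeticFunction.mul_apply, ArithmeticFunction.intCoe_apply, ArithmeticFunction.natCoe_apply, ArithmeticFunction.one_apply] at h2
    rw [h1, h2]
    split_ifs with h <;> simp [h]
  rw [Finset.sum_congr rfl this]
  simp; omega

theorem moeb_log (N : ℕ) (φ : ℕ → ℝ) :
    ∑ k ∈ Finset.Ioc 0 N, ∑ d ∈ Finset.Ioc 0 (N / k), (μ k : ℝ) * (Real.log d * φ (k * d))
      = ∑ n ∈ Finset.Ioc 0 N, Λ n * φ n := by
  rw [← fubini_div (fun k d => (μ k : ℝ) * (Real.log d * φ (k * d)))]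
  refine Finset.sum_congr rfl fun n hn => ?_
  have h2 := congrArg (fun f => f n) (ArithmeticFunction.moebius_mul_log_eq_vonMangoldt)
  simp only [ArithmeticFunction.mul_apply, ArithmeticFunction.intCoe_apply, ArithmeticFunction.log_apply] at h2
  rw [← h2, Finset.sum_mul]
  refine Finset.sum_congr rfl fun x hx => ?_
  rw [Nat.mem_divisorsAntidiagonal] at hx
  rw [hx.1]; ring

theorem moeb_sum_bound (N : ℕ) : |∑ k ∈ Finset.Ioc 0 N, (μ k : ℝ) / k| ≤ 2 := by
  rcases Nat.eq_zero_or_pos N with rfl | hN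
  · simp
  have h := moeb_one N hN (fun _ => 1)
  simp only [mul_one, Finset.sum_const, Nat.card_Ioc, Nat.sub_zero, nsmul_eq_mul] at h
  have hN' : (0:ℝ) < N := by exact_mod_cast hN
  have h2 : |N * ∑ k ∈ Finset.Ioc 0 N, (μ k : ℝ) / k - 1| ≤ N := by
    rw [← h, Finset.mul_sum, ← Finset.sum_sub_distrib]
    refine (Finset.abs_sum_le_sum_abs _ _).trans ?_
    have : ∀ k ∈ Finset.Ioc 0 N, |(N:ℝ) * ((μ k : ℝ) / k) - (N / k : ℕ) * (μ k : ℝ)| ≤ 1 := by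
      intro k hk
      have e : (N:ℝ) * ((μ k : ℝ) / k) - (N / k : ℕ) * (μ k : ℝ) = ((N:ℝ) / k - (N / k : ℕ)) * μ k := by ring
      rw [e, abs_mul]
      have h1 : |((μ k : ℤ) : ℝ)| ≤ 1 := by exact_mod_cast ArithmeticFunction.abs_moebius_le_one
      have h3 : |((N:ℝ) / k - (N / k : ℕ))| ≤ 1 := by
        have h4 := Nat.floor_div_eq_div (K := ℝ) N k
        have h5 := Nat.floor_le (show (0:ℝ) ≤ (N:ℝ)/k by positivity)
        have h6 := Nat.lt_floor_add_one ((N:ℝ)/k)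
        rw [h4] at h5 h6
        rw [abs_le]; constructor <;> linarith
      calc _ ≤ (1:ℝ) * 1 := by gcongr
        _ = 1 := one_mul 1
    refine (Finset.sum_le_sum this).trans ?_
    simp
  have h3 : |N * ∑ k ∈ Finset.Ioc 0 N, (μ k : ℝ) / k| ≤ N * 2 := by
    have h1N : (1:ℝ) ≤ N := by exact_mod_cast hN
    rw [abs_le] at h2 ⊢; constructor <;> linarith
  rw [abs_mul, abs_of_pos hN'] at h3
  exact le_of_mul_le_mul_left h3 hN'
end

section
open Real Set
open scoped ArithmeticFunction.Moebius ArithmeticFunction.zeta ArithmeticFunction.vonMangoldt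

theorem rpow_step (n : ℕ) (hn : 1 ≤ n) :
    (3/4 : ℝ) * ((n:ℝ)+1) ^ (-(7/4) : ℝ) ≤ (n:ℝ) ^ (-(3/4) : ℝ) - ((n:ℝ)+1) ^ (-(3/4) : ℝ) := by
  have hn' : (1:ℝ) ≤ n := by exact_mod_cast hn
  obtain ⟨ξ, hξ, e⟩ := exists_hasDerivAt_eq_slope (fun t : ℝ => t ^ (-(3/4) : ℝ)) (fun t => (-(3/4) : ℝ) * t ^ (-(3/4) - 1 : ℝ))
    (show (n:ℝ) < n + 1 by linarith)
    (by
      intro t ht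
      exact (Real.continuousAt_rpow_const _ _ (Or.inl (by have := ht.1; linarith))).continuousWithinAt)
    (by
      intro t ht
      exact Real.hasDerivAt_rpow_const (Or.inl (by have := ht.1; linarith)))
  have h1 : ((n:ℝ)+1) ^ (-(7/4) : ℝ) ≤ ξ ^ (-(7/4) : ℝ) :=
    Real.rpow_le_rpow_of_nonpos (by linarith [hξ.1]) hξ.2.le (by norm_num)
  have e2 : (-(3/4) - 1 : ℝ) = -(7/4) := by norm_num
  rw [e2] at e
  simp only [add_sub_cancel_left, div_one] at e
  linarith

theorem asym (F f f' : ℝ → ℝ) (B : ℝ) (hB : 0 < B) (hF : ∀ t, 1 ≤ t → HasDerivAt F (f t) t)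
    (hf : ∀ t, 1 ≤ t → HasDerivAt f (f' t) t)
    (h0 : ∀ t, 1 ≤ t → |f t| ≤ B * t ^ (-(3/4) : ℝ)) (h1 : ∀ t, 1 ≤ t → |f' t| ≤ B * t ^ (-(7/4) : ℝ)) :
    ∃ C K, 0 < K ∧ ∀ y : ℝ, 1 ≤ y → |∑ m ∈ Finset.Ioc 0 ⌊y⌋₊, f m - F y - C| ≤ K * y ^ (-(3/4) : ℝ) := by
  have hmv : ∀ g g' : ℝ → ℝ, (∀ t, 1 ≤ t → HasDerivAt g (g' t) t) → ∀ a b : ℝ, 1 ≤ a → a ≤ b → ∃ ξ, a ≤ ξ ∧ ξ ≤ b ∧ g b - g a = g' ξ * (b - a) := by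
    intro g g' hg a b ha hab
    rcases hab.eq_or_lt with rfl | hab
    · exact ⟨a, le_rfl, le_rfl, by simp⟩
    obtain ⟨ξ, hξ, e⟩ := exists_hasDerivAt_eq_slope g g' hab
      (fun t ht => (hg t (by linarith [ht.1])).continuousAt.continuousWithinAt)
      (fun t ht => hg t (by linarith [ht.1]))
    refine ⟨ξ, hξ.1.le, hξ.2.le, ?_⟩
    rw [e]; field_simp [(sub_pos.2 hab).ne']
  set a : ℕ → ℝ := fun n => ∑ m ∈ Finset.Ioc 0 n, f m - F n with ha
  set r : ℕ → ℝ := fun n => 6 * B * (n:ℝ) ^ (-(3/4) : ℝ) with hr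
  have hpw : ∀ n : ℕ, 1 ≤ n → (n:ℝ) ^ (-(7/4) : ℝ) ≤ 4 * ((n:ℝ)+1) ^ (-(7/4) : ℝ) := by
    intro n hn
    have hn' : (1:ℝ) ≤ n := by exact_mod_cast hn
    have e1 : (2*(n:ℝ)) ^ (-(7/4) : ℝ) ≤ ((n:ℝ)+1) ^ (-(7/4) : ℝ) :=
      Real.rpow_le_rpow_of_nonpos (by linarith) (by linarith) (by norm_num)
    rw [Real.mul_rpow (by norm_num) (by linarith)] at e1
    have e2 : (1/4:ℝ) ≤ (2:ℝ) ^ (-(7/4) : ℝ) := by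
      have : (2:ℝ) ^ (-(2:ℝ)) ≤ (2:ℝ) ^ (-(7/4) : ℝ) := Real.rpow_le_rpow_of_exponent_le (by norm_num) (by norm_num)
      refine le_trans (le_of_eq ?_) this
      rw [Real.rpow_neg (by norm_num)]; norm_num
    have e3 : 0 ≤ (n:ℝ) ^ (-(7/4) : ℝ) := by positivity
    nlinarith [mul_le_mul_of_nonneg_right e2 e3]
  have hstep : ∀ n, 1 ≤ n → |a (n+1) - a n| ≤ r n - r (n+1) := by
    intro n hn
    have hn' : (1:ℝ) ≤ n := by exact_mod_cast hn
    obtain ⟨ξ, x1, x2, e⟩ := hmv F f hF n (n+1) hn' (by linarith)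
    obtain ⟨η, y1, y2, e'⟩ := hmv f f' hf ξ (n+1) (by linarith) x2
    have : a (n+1) - a n = f' η * (n + 1 - ξ) := by
      simp only [ha]
      rw [show n + 1 = Nat.succ n from rfl, Finset.sum_Ioc_succ_top (by omega : 0 ≤ n)]
      push_cast
      linarith [e, e']
    rw [this, abs_mul, abs_of_nonneg (by linarith : 0 ≤ (n:ℝ) + 1 - ξ)]
    have b1 := h1 η (by linarith)
    have b2 : η ^ (-(7/4) : ℝ) ≤ (n:ℝ) ^ (-(7/4) : ℝ) :=
      Real.rpow_le_rpow_of_nonpos (by linarith) (by linarith) (by norm_num)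
    have b3 := hpw n hn
    have b4 := rpow_step n hn
    have b5 : |f' η| * (n + 1 - ξ) ≤ |f' η| := by nlinarith [abs_nonneg (f' η)]
    have b6 : |f' η| ≤ B * (4 * ((n:ℝ)+1) ^ (-(7/4) : ℝ)) := b1.trans (by gcongr; exact b2.trans b3)
    simp only [hr]; push_cast
    have : B * (4 * ((n:ℝ)+1) ^ (-(7/4) : ℝ)) ≤ 6 * B * (n:ℝ) ^ (-(3/4) : ℝ) - 6 * B * ((n:ℝ)+1) ^ (-(3/4) : ℝ) := by
      have := mul_le_mul_of_nonneg_left b4 hB.le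
      have p : 0 ≤ B * ((n:ℝ)+1) ^ (-(7/4) : ℝ) := by positivity
      nlinarith
    linarith
  have hr0 : ∀ n, 0 ≤ r n := fun n => by simp only [hr]; positivity
  have hcmp : ∀ n m, 1 ≤ n → n ≤ m → |a m - a n| ≤ r n - r m := by
    intro n m hn hnm
    induction m, hnm using Nat.le_induction with
    | base => simp
    | succ m hm ih =>
      have := hstep m (by omega)
      have e := abs_add_le (a (m+1) - a m) (a m - a n)
      rw [sub_add_sub_cancel] at e
      linarith
  have hle : ∀ n m, a (m+1) - r (m+1) ≤ a (n+1) + r (n+1) := by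
    intro n m
    rcases le_total (n+1) (m+1) with h | h
    · have := abs_le.1 (hcmp _ _ (by omega) h); linarith [hr0 (n+1), hr0 (m+1)]
    · have := abs_le.1 (hcmp _ _ (by omega) h); linarith [hr0 (n+1), hr0 (m+1)]
  set C := ⨆ m : ℕ, (a (m+1) - r (m+1)) with hC
  have hbdd : BddAbove (Set.range fun m : ℕ => (a (m+1) - r (m+1))) :=
    ⟨a (0+1) + r (0+1), by rintro _ ⟨m, rfl⟩; exact hle 0 m⟩
  have hac : ∀ n, 1 ≤ n → |a n - C| ≤ r n := by
    intro n hn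
    obtain ⟨k, rfl⟩ : ∃ k, n = k + 1 := ⟨n - 1, by omega⟩
    have c1 : a (k+1) - r (k+1) ≤ C := le_ciSup hbdd k
    have c2 : C ≤ a (k+1) + r (k+1) := ciSup_le (hle k)
    rw [abs_le]; constructor <;> linarith
  refine ⟨C, 14 * B, by positivity, fun y hy => ?_⟩
  set n := ⌊y⌋₊ with hn
  have hn1 : 1 ≤ n := Nat.le_floor (by simpa using hy)
  have hn1' : (1:ℝ) ≤ n := by exact_mod_cast hn1
  have hny : (n:ℝ) ≤ y := Nat.floor_le (by linarith)
  have hyn : y < n + 1 := Nat.lt_floor_add_one y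
  obtain ⟨ξ, x1, x2, e⟩ := hmv F f hF n y hn1' hny
  have b1 := h0 ξ (by linarith)
  have b2 : ξ ^ (-(3/4) : ℝ) ≤ (n:ℝ) ^ (-(3/4) : ℝ) :=
      Real.rpow_le_rpow_of_nonpos (by linarith) (by linarith) (by norm_num)
  have b3 : (n:ℝ) ^ (-(3/4) : ℝ) ≤ 2 * y ^ (-(3/4) : ℝ) := by
    have e1 : (2*(n:ℝ)) ^ (-(3/4) : ℝ) ≤ y ^ (-(3/4) : ℝ) :=
      Real.rpow_le_rpow_of_nonpos (by linarith) (by linarith) (by norm_num)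
    rw [Real.mul_rpow (by norm_num) (by linarith)] at e1
    have e2 : (1/2:ℝ) ≤ (2:ℝ) ^ (-(3/4) : ℝ) := by
      have : (2:ℝ) ^ (-(1:ℝ)) ≤ (2:ℝ) ^ (-(3/4) : ℝ) := Real.rpow_le_rpow_of_exponent_le (by norm_num) (by norm_num)
      refine le_trans (le_of_eq ?_) this
      rw [Real.rpow_neg (by norm_num)]; norm_num
    have e3 : 0 ≤ (n:ℝ) ^ (-(3/4) : ℝ) := by positivity
    nlinarith [mul_le_mul_of_nonneg_right e2 e3]
  have b4 : |f ξ * (y - n)| ≤ B * (2 * y ^ (-(3/4) : ℝ)) := by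
    rw [abs_mul, abs_of_nonneg (by linarith : 0 ≤ y - n)]
    have : |f ξ| * (y - n) ≤ |f ξ| := by nlinarith [abs_nonneg (f ξ)]
    have : |f ξ| ≤ B * (2 * y ^ (-(3/4) : ℝ)) := b1.trans (by gcongr; exact b2.trans b3)
    linarith
  have b5 := hac n hn1
  have b6 : r n ≤ 6 * B * (2 * y ^ (-(3/4) : ℝ)) := by simp only [hr]; gcongr
  have e7 : ∑ m ∈ Finset.Ioc 0 n, f m - F y - C = (a n - C) - f ξ * (y - n) := by
    simp only [ha]; linarith
  rw [e7]
  have := abs_sub (a n - C) (f ξ * (y - n))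
  linarith

theorem log_pow_le (t : ℝ) (ht : 1 ≤ t) : log t ≤ 64 * t ^ (1/4:ℝ) ∧ (log t)^2 ≤ 64 * t ^ (1/4:ℝ) ∧ 1 ≤ t ^ (1/4:ℝ) := by
  have h1 := Real.log_le_rpow_div (x := t) (by linarith) (show (0:ℝ) < 1/8 by norm_num)
  have h2 : 1 ≤ t ^ (1/8:ℝ) := Real.one_le_rpow ht (by norm_num)
  have h3 : t ^ (1/4:ℝ) = t ^ (1/8:ℝ) * t ^ (1/8:ℝ) := by rw [← Real.rpow_add (by linarith)]; norm_num
  have h4 : 0 ≤ log t := log_nonneg ht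
  rw [h3]
  have h5 : log t ≤ 8 * t ^ (1/8:ℝ) := by linarith
  refine ⟨by nlinarith, by nlinarith, by nlinarith⟩

theorem sigma_asym (k : ℕ) (hk : k ≤ 2) : ∃ C K, 0 < K ∧ ∀ y : ℝ, 1 ≤ y →
    |∑ m ∈ Finset.Ioc 0 ⌊y⌋₊, (log m)^k / m - (log y)^(k+1)/(k+1) - C| ≤ K * y ^ (-(3/4) : ℝ) := by
  have hb : ∀ t : ℝ, 1 ≤ t → ∀ j ≤ 2, 0 ≤ (log t)^j ∧ (log t)^j ≤ 64 * t ^ (1/4:ℝ) := by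
    intro t ht j hj
    obtain ⟨h1, h2, h3⟩ := log_pow_le t ht
    have h4 : 0 ≤ log t := log_nonneg ht
    refine ⟨by positivity, ?_⟩
    interval_cases j
    · simp; linarith
    · simpa using h1
    · exact h2
  have := asym (fun t => (log t)^(k+1)/(k+1)) (fun t => (log t)^k / t)
    (fun t => (k * (log t)^(k-1) - (log t)^k) / t^2) 200 (by norm_num) ?_ ?_ ?_ ?_
  · exact this
  · intro t ht
    have h : t ≠ 0 := by positivity
    have := ((Real.hasDerivAt_log h).pow (k+1)).div_const ((k:ℝ)+1)
    refine this.congr_deriv ?_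
    push_cast
    field_simp
  · intro t ht
    have h : t ≠ 0 := by positivity
    have := ((Real.hasDerivAt_log h).pow k).div (hasDerivAt_id t) h
    refine this.congr_deriv ?_
    simp only [id]
    field_simp
    simp
  · intro t ht
    have ht0 : 0 < t := by linarith
    obtain ⟨h1, h2⟩ := hb t ht k hk
    rw [abs_of_nonneg (by positivity)]
    have e : t ^ (-(3/4) : ℝ) = t ^ (1/4:ℝ) / t := by
      rw [eq_div_iff ht0.ne', ← Real.rpow_add_one ht0.ne']; norm_num
    rw [e, ← mul_div_assoc]
    gcongr
    have : 0 ≤ t ^ (1/4:ℝ) := by positivity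
    linarith
  · intro t ht
    have ht0 : 0 < t := by linarith
    obtain ⟨h1, h2⟩ := hb t ht k hk
    obtain ⟨h3, h4⟩ := hb t ht (k-1) (by omega)
    have e : t ^ (-(7/4) : ℝ) = t ^ (1/4:ℝ) / t^2 := by
      rw [eq_div_iff (by positivity), ← Real.rpow_natCast t 2, ← Real.rpow_add ht0]; norm_num
    rw [e, ← mul_div_assoc, abs_div, abs_of_pos (show 0 < t^2 by positivity)]
    gcongr
    have h5 : (k:ℝ) ≤ 2 := by exact_mod_cast hk
    have h6 : (0:ℝ) ≤ k := by positivity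
    rw [abs_le]; constructor <;> nlinarith

theorem sum_inv_sqrt (N : ℕ) : ∑ k ∈ Finset.Ioc 0 N, 1 / √(k:ℝ) ≤ 2 * √N := by
  induction N with
  | zero => simp
  | succ n ih =>
    rw [Finset.sum_Ioc_succ_top (by omega : 0 ≤ n)]
    push_cast
    have h1 : 0 < √((n:ℝ)+1) := by positivity
    have h2 : 0 ≤ √(n:ℝ) := by positivity
    have e1 := Real.sq_sqrt (show (0:ℝ) ≤ n by positivity)
    have e2 := Real.sq_sqrt (show (0:ℝ) ≤ (n:ℝ) + 1 by positivity)
    have : 1 / √((n:ℝ)+1) ≤ 2 * (√((n:ℝ)+1) - √n) := by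
      rw [div_le_iff₀ h1]
      nlinarith [sq_nonneg (√((n:ℝ)+1) - √n)]
    linarith

theorem moeb_inv (G φ : ℝ → ℝ) (c K : ℝ)
    (h : ∀ y : ℝ, 1 ≤ y → |∑ d ∈ Finset.Ioc 0 ⌊y⌋₊, (log d * G (y/d) - φ (y/d)) / d - c| ≤ K / √y)
    (N : ℕ) (hN : 1 ≤ N) :
    |∑ n ∈ Finset.Ioc 0 N, Λ n / n * G (N/n) - φ N| ≤ 2 * |c| + 2 * K := by
  have h1 := moeb_one N hN (fun n => φ (N/n) / n)
  have h2 := moeb_log N (fun n => G (N/n) / n)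
  have hN' : (0:ℝ) < N := by exact_mod_cast hN
  have e : ∑ n ∈ Finset.Ioc 0 N, Λ n / n * G (N/n) - φ N = ∑ k ∈ Finset.Ioc 0 N, (μ k : ℝ) / k *
      (∑ d ∈ Finset.Ioc 0 ⌊(N:ℝ)/k⌋₊, (log d * G ((N:ℝ)/k/d) - φ ((N:ℝ)/k/d)) / d - c) + c * ∑ k ∈ Finset.Ioc 0 N, (μ k : ℝ) / k := by
    have : φ N = φ (N/(1:ℕ)) / (1:ℕ) := by simp
    rw [this, ← h1]
    have : ∑ n ∈ Finset.Ioc 0 N, Λ n / n * G (N/n) = ∑ n ∈ Finset.Ioc 0 N, Λ n * (G (N/n) / n) :=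
      Finset.sum_congr rfl fun n _ => by ring
    rw [this, ← h2, ← Finset.sum_sub_distrib, Finset.mul_sum, ← Finset.sum_add_distrib]
    refine Finset.sum_congr rfl fun k hk => ?_
    rw [Nat.floor_div_eq_div, ← Finset.sum_sub_distrib, mul_sub, Finset.mul_sum]
    have : c * ((μ k : ℝ) / k) = (μ k : ℝ) / k * c := by ring
    rw [this, sub_add_cancel]
    refine Finset.sum_congr rfl fun d hd => ?_
    push_cast
    rw [div_div]
    ring
  rw [e]
  refine (abs_add_le _ _).trans ?_
  have p1 : |c * ∑ k ∈ Finset.Ioc 0 N, (μ k : ℝ) / k| ≤ 2 * |c| := by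
    rw [abs_mul]; nlinarith [moeb_sum_bound N, abs_nonneg c]
  have hK : 0 ≤ K := by
    have := (abs_nonneg _).trans (h 1 le_rfl); simpa using this
  have p2 : ∀ k ∈ Finset.Ioc 0 N, |(μ k : ℝ) / k *
      (∑ d ∈ Finset.Ioc 0 ⌊(N:ℝ)/k⌋₊, (log d * G ((N:ℝ)/k/d) - φ ((N:ℝ)/k/d)) / d - c)| ≤ K / √N * (1 / √k) := by
    intro k hk
    rw [Finset.mem_Ioc] at hk
    have hk0 : (0:ℝ) < k := by exact_mod_cast hk.1
    have hkN : (k:ℝ) ≤ N := by exact_mod_cast hk.2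
    have b1 := h ((N:ℝ)/k) (by rw [le_div_iff₀ hk0]; linarith)
    have b2 : |((μ k : ℤ) : ℝ)| ≤ 1 := by exact_mod_cast ArithmeticFunction.abs_moebius_le_one
    rw [abs_mul, abs_div, abs_of_pos hk0]
    calc _ ≤ 1 / (k:ℝ) * (K / √((N:ℝ)/k)) := by gcongr
      _ = _ := by
        rw [Real.sqrt_div hN'.le]
        have s1 : 0 < √(k:ℝ) := by positivity
        have s2 : 0 < √(N:ℝ) := by positivity
        field_simp
        rw [Real.sq_sqrt hk0.le]; ring
  have p3 := (Finset.abs_sum_le_sum_abs _ _).trans (Finset.sum_le_sum p2)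
  rw [← Finset.mul_sum] at p3
  have p4 := sum_inv_sqrt N
  have s2 : 0 < √(N:ℝ) := by positivity
  have p5 : K / √N * ∑ k ∈ Finset.Ioc 0 N, 1 / √(k:ℝ) ≤ K / √N * (2 * √N) := by gcongr
  have p6 : K / √N * (2 * √N) = 2 * K := by field_simp
  linarith
end

section
open Real Set
open scoped ArithmeticFunction.Moebius ArithmeticFunction.zeta ArithmeticFunction.vonMangoldt

theorem bnd_aux {e Y k : ℝ} (h : |e| * Y ≤ k) (hY : 1 ≤ Y) : |e| ≤ k ∧ ∀ l, 0 ≤ l → l ≤ 64 * Y → |l * e| ≤ 64 * k := by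
  have := abs_nonneg e
  refine ⟨by nlinarith, fun l h1 h2 => ?_⟩
  rw [abs_mul, abs_of_nonneg h1]
  calc l * |e| ≤ 64 * Y * |e| := by gcongr
    _ = 64 * (|e| * Y) := by ring
    _ ≤ _ := by gcongr

set_option maxHeartbeats 1000000 in
theorem lam_asym : ∃ a0 a1 a2 K : ℝ, 0 < K ∧ ∀ N : ℕ, 1 ≤ N →
    |∑ n ∈ Finset.Ioc 0 N, Λ n / n - (log N - a0)| ≤ K ∧
    |∑ n ∈ Finset.Ioc 0 N, Λ n / n * (log N - log n) - ((log N)^2/2 - a1 * log N + a2)| ≤ K := by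
  obtain ⟨C0, K0, hK0, h0⟩ := sigma_asym 0 (by norm_num)
  obtain ⟨C1, K1, hK1, h1⟩ := sigma_asym 1 (by norm_num)
  obtain ⟨C2, K2, hK2, h2⟩ := sigma_asym 2 (by norm_num)
  set a := C0^2 + 2*C1 with ha
  have hy : ∀ y : ℝ, 1 ≤ y → ∃ s0 s1 s2 e0 e1 e2 : ℝ, ∑ m ∈ Finset.Ioc 0 ⌊y⌋₊, (1:ℝ)/m = s0 ∧
      ∑ m ∈ Finset.Ioc 0 ⌊y⌋₊, log m/m = s1 ∧ ∑ m ∈ Finset.Ioc 0 ⌊y⌋₊, (log m)^2/m = s2 ∧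
      s0 = log y + C0 + e0 ∧ s1 = (log y)^2/2 + C1 + e1 ∧ s2 = (log y)^3/3 + C2 + e2 ∧
      |e0| * y ^ (1/4:ℝ) ≤ K0 / √y ∧ |e1| * y ^ (1/4:ℝ) ≤ K1 / √y ∧ |e2| * y ^ (1/4:ℝ) ≤ K2 / √y := by
    intro y hy
    have hy0 : 0 < y := by linarith
    have e : ∀ K, K * y ^ (-(3/4) : ℝ) * y ^ (1/4:ℝ) = K / √y := by
      intro K
      have hs : 0 < √y := by positivity
      rw [eq_div_iff hs.ne', mul_assoc, mul_assoc, Real.sqrt_eq_rpow, ← Real.rpow_add hy0, ← Real.rpow_add hy0]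
      norm_num
    have q : 0 ≤ y ^ (1/4:ℝ) := by positivity
    have g0 := h0 y hy
    have g1 := h1 y hy
    have g2 := h2 y hy
    simp only [pow_zero, zero_add, pow_one, Nat.cast_zero, div_one] at g0
    norm_num at g1 g2
    refine ⟨_, _, _, _, _, _, rfl, rfl, rfl, (add_sub_cancel _ _).symm, (add_sub_cancel _ _).symm, (add_sub_cancel _ _).symm, ?_, ?_, ?_⟩
    · rw [← e, ← sub_sub]; gcongr
    · rw [← e, ← sub_sub]; gcongr
    · rw [← e, ← sub_sub]; gcongr
  have hm1 := moeb_inv (fun _ => 1) (fun t => log t - C0) (2 * C1 + C0^2) (2*K1 + 64*K0 + |C0| * K0) (by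
    intro y hy1
    obtain ⟨s0, s1, s2, e0, e1, e2, q0, q1, q2, f0, f1, f2, b0, b1, b2⟩ := hy y hy1
    have hy0 : 0 < y := by linarith
    have e : ∑ d ∈ Finset.Ioc 0 ⌊y⌋₊, (log d * 1 - (log (y/d) - C0)) / d = 2 * s1 + (C0 - log y) * s0 := by
      rw [← q0, ← q1, Finset.mul_sum, Finset.mul_sum, ← Finset.sum_add_distrib]
      refine Finset.sum_congr rfl fun d hd => ?_
      have hd0 : (0:ℝ) < d := by exact_mod_cast (Finset.mem_Ioc.1 hd).1
      rw [Real.log_div hy0.ne' hd0.ne']; ring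
    rw [e, f0, f1]
    have e3 : 2 * ((log y)^2/2 + C1 + e1) + (C0 - log y) * (log y + C0 + e0) - (2*C1 + C0^2) = 2 * e1 + C0 * e0 - log y * e0 := by ring
    rw [e3]
    obtain ⟨l1, l2, l3⟩ := log_pow_le y hy1
    have l0 := log_nonneg hy1
    have t1 : |e1| ≤ K1 / √y := (bnd_aux b1 l3).1
    have t2 : |e0| ≤ K0 / √y := (bnd_aux b0 l3).1
    have t3 : |log y * e0| ≤ 64 * (K0 / √y) := (bnd_aux b0 l3).2 _ l0 l1
    have t4 : |C0 * e0| ≤ |C0| * (K0 / √y) := by rw [abs_mul]; gcongr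
    calc _ ≤ |2 * e1 + C0 * e0| + |log y * e0| := abs_sub _ _
      _ ≤ |2 * e1| + |C0 * e0| + |log y * e0| := by gcongr; exact abs_add_le _ _
      _ ≤ 2 * (K1 / √y) + |C0| * (K0 / √y) + 64 * (K0 / √y) := by
        rw [abs_mul, abs_of_pos (by norm_num : (0:ℝ) < 2)]; gcongr
      _ = _ := by ring)
  have hm2 := moeb_inv (fun t => log t) (fun t => (log t)^2/2 - C0 * log t + a) (-3/2 * C2 - C0 * C1 - a * C0)
    (3/2*K2 + 128*K1 + |C0| * K1 + 32 * K0 + 64 * |C0| * K0 + |a| * K0) (by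
    intro y hy1
    obtain ⟨s0, s1, s2, e0, e1, e2, q0, q1, q2, f0, f1, f2, b0, b1, b2⟩ := hy y hy1
    have hy0 : 0 < y := by linarith
    have e : ∑ d ∈ Finset.Ioc 0 ⌊y⌋₊, (log d * log (y/d) - ((log (y/d))^2/2 - C0 * log (y/d) + a)) / d
        = -3/2 * s2 + (2 * log y - C0) * s1 + (-(log y)^2/2 + C0 * log y - a) * s0 := by
      rw [← q0, ← q1, ← q2, Finset.mul_sum, Finset.mul_sum, Finset.mul_sum, ← Finset.sum_add_distrib, ← Finset.sum_add_distrib]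
      refine Finset.sum_congr rfl fun d hd => ?_
      have hd0 : (0:ℝ) < d := by exact_mod_cast (Finset.mem_Ioc.1 hd).1
      rw [Real.log_div hy0.ne' hd0.ne']; ring
    rw [e, f0, f1, f2]
    have e3 : -3/2 * ((log y)^3/3 + C2 + e2) + (2 * log y - C0) * ((log y)^2/2 + C1 + e1) + (-(log y)^2/2 + C0 * log y - a) * (log y + C0 + e0) - (-3/2 * C2 - C0 * C1 - a * C0) = -(3/2 * e2) + 2 * (log y * e1) - C0 * e1 - 1/2 * ((log y)^2 * e0) + C0 * (log y * e0) - a * e0 := by rw [ha]; ring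
    rw [e3]
    obtain ⟨l1, l2, l3⟩ := log_pow_le y hy1
    have l0 := log_nonneg hy1
    have t0 : |e2| ≤ K2 / √y := (bnd_aux b2 l3).1
    have t1 : |e1| ≤ K1 / √y := (bnd_aux b1 l3).1
    have t2 : |e0| ≤ K0 / √y := (bnd_aux b0 l3).1
    have t3 : |log y * e0| ≤ 64 * (K0 / √y) := (bnd_aux b0 l3).2 _ l0 l1
    have t4 : |log y * e1| ≤ 64 * (K1 / √y) := (bnd_aux b1 l3).2 _ l0 l1
    have t5 : |(log y)^2 * e0| ≤ 64 * (K0 / √y) := (bnd_aux b0 l3).2 _ (sq_nonneg _) l2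
    have t6 : |C0 * e1| ≤ |C0| * (K1 / √y) := by rw [abs_mul]; gcongr
    have t7 : |C0 * (log y * e0)| ≤ |C0| * (64 * (K0 / √y)) := by rw [abs_mul]; gcongr
    have t8 : |a * e0| ≤ |a| * (K0 / √y) := by rw [abs_mul]; gcongr
    have e4 : (3/2*K2 + 128*K1 + |C0| * K1 + 32 * K0 + 64 * |C0| * K0 + |a| * K0) / √y = 3/2 * (K2 / √y) + 128 * (K1/√y) + |C0| * (K1 / √y) + 32 * (K0/√y) + |C0| * (64 * (K0 / √y)) + |a| * (K0 / √y) := by ring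
    rw [e4]
    clear hy b0 b1 b2 l1 l2 l3 t2 e e3 e4 hm1 h0 h1 h2
    rw [abs_le] at t0 t3 t4 t5 t6 t7 t8 ⊢
    constructor <;> linarith only [t0, t3, t4, t5, t6, t7, t8])
  refine ⟨C0, C0, a, (2 * |2 * C1 + C0^2| + 2 * (2*K1 + 64*K0 + |C0| * K0)) + (2 * |-3/2 * C2 - C0 * C1 - a * C0| + 2 * (3/2*K2 + 128*K1 + |C0| * K1 + 32 * K0 + 64 * |C0| * K0 + |a| * K0)), by positivity, fun N hN => ⟨?_, ?_⟩⟩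
  · have := hm1 N hN
    simp only [mul_one] at this
    refine this.trans ?_
    have : 0 ≤ (2 * |-3/2 * C2 - C0 * C1 - a * C0| + 2 * (3/2*K2 + 128*K1 + |C0| * K1 + 32 * K0 + 64 * |C0| * K0 + |a| * K0)) := by positivity
    linarith
  · have := hm2 N hN
    have e : ∑ n ∈ Finset.Ioc 0 N, Λ n / n * (log N - log n) = ∑ n ∈ Finset.Ioc 0 N, Λ n / n * log (N / n) := by
      refine Finset.sum_congr rfl fun d hd => ?_
      have hd0 : (0:ℝ) < d := by exact_mod_cast (Finset.mem_Ioc.1 hd).1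
      have hN0 : (0:ℝ) < N := by exact_mod_cast hN
      rw [Real.log_div hN0.ne' hd0.ne']
    rw [e]
    refine this.trans ?_
    have : 0 ≤ 2 * |2 * C1 + C0^2| + 2 * (2*K1 + 64*K0 + |C0| * K0) := by positivity
    linarith

theorem nonprime_summable : Summable (fun n : ℕ => (if n.Prime then 0 else Λ n) * log n / n) := by
  obtain ⟨C, hC⟩ := Chebyshev.psi_sub_theta_le_mul_sqrt
  have h := LSeriesSummable_of_sum_norm_bigO_and_nonneg (f := fun n => if n.Prime then 0 else Λ n) (r := 1/2) (s := (3/4 : ℝ)) ?_ ?_ (by norm_num) (by simp; norm_num)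
  · rw [LSeriesSummable, ← summable_norm_iff] at h
    refine Summable.of_nonneg_of_le ?_ ?_ (h.mul_left 64)
    · intro n
      have : 0 ≤ (if n.Prime then 0 else Λ n) := by split_ifs; exact le_rfl; exact ArithmeticFunction.vonMangoldt_nonneg
      have : 0 ≤ log n := Real.log_natCast_nonneg n
      positivity
    · intro n
      rcases Nat.eq_zero_or_pos n with rfl | hn
      · simp
      rw [LSeries.norm_term_eq]
      simp only [hn.ne', if_false]
      have h1 : 0 ≤ (if n.Prime then 0 else Λ n) := by split_ifs; exact le_rfl; exact ArithmeticFunction.vonMangoldt_nonneg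
      rw [Complex.norm_real, Real.norm_of_nonneg h1, Complex.ofReal_re]
      have hn0 : (0:ℝ) < n := by exact_mod_cast hn
      obtain ⟨l1, l2, l3⟩ := log_pow_le n (by exact_mod_cast hn)
      have e : (n:ℝ) = (n:ℝ) ^ (3/4:ℝ) * (n:ℝ)^(1/4:ℝ) := by
        rw [← Real.rpow_add hn0]; norm_num
      have p : 0 < (n:ℝ) ^ (3/4:ℝ) := by positivity
      have p2 : 0 < (n:ℝ) ^ (1/4:ℝ) := by positivity
      rw [div_le_iff₀ hn0]
      nth_rewrite 3 [e]
      rw [show 64 * ((if n.Prime then 0 else Λ n) / (n:ℝ) ^ (3/4:ℝ)) * ((n:ℝ) ^ (3/4:ℝ) * (n:ℝ)^(1/4:ℝ)) = (if n.Prime then 0 else Λ n) * (64 * (n:ℝ)^(1/4:ℝ)) by field_simp]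
      gcongr
  · refine Asymptotics.IsBigO.of_bound C ?_
    filter_upwards with n
    have := hC n
    rw [Chebyshev.psi_sub_theta_eq_sum_not_prime, Nat.floor_natCast, Finset.sum_filter] at this
    rw [← Real.sqrt_eq_rpow, Real.norm_of_nonneg (Real.sqrt_nonneg _), Real.norm_of_nonneg]
    · refine le_trans (le_of_eq ?_) this
      refine Finset.sum_congr (by ext; simp [Nat.succ_le_iff]) fun k _ => ?_
      split_ifs <;> simp_all
    · exact Finset.sum_nonneg fun k _ => by split_ifs; exact le_rfl; exact ArithmeticFunction.vonMangoldt_nonneg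
  · intro k
    split_ifs; exact le_rfl; exact ArithmeticFunction.vonMangoldt_nonneg
end

section
open Real Set
open scoped ArithmeticFunction.Moebius ArithmeticFunction.zeta ArithmeticFunction.vonMangoldt

/-- Sum over the primes below `n`. -/
noncomputable def PS (f : ℕ → ℝ) (n : ℕ) : ℝ := ∑ k ∈ Finset.range n, if k.Prime then f k else 0

theorem PS_succ (f : ℕ → ℝ) (n : ℕ) : PS f (n+1) = PS f n + if n.Prime then f n else 0 :=
  Finset.sum_range_succ _ _

theorem PS_zero (f : ℕ → ℝ) : PS f 0 = 0 := rfl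

theorem lam_split (N : ℕ) (g : ℕ → ℝ) : ∑ n ∈ Finset.Ioc 0 N, Λ n / n * g n =
    PS (fun p => log p / p * g p) (N+1) + ∑ k ∈ Finset.range (N+1), (if k.Prime then 0 else Λ k) / k * g k := by
  have : Finset.range (N+1) = insert 0 (Finset.Ioc 0 N) := by ext k; simp only [Finset.mem_range, Finset.mem_insert, Finset.mem_Ioc]; omega
  rw [PS, this, Finset.sum_insert (by simp), Finset.sum_insert (by simp)]
  simp only [Nat.not_prime_zero, if_false, Nat.cast_zero, div_zero, zero_mul, zero_add]
  rw [← Finset.sum_add_distrib]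
  refine Finset.sum_congr rfl fun k hk => ?_
  split_ifs with h
  · rw [ArithmeticFunction.vonMangoldt_apply_prime h]; ring
  · ring

theorem mertens : ∃ E K : ℝ, 0 < K ∧ ∀ n : ℕ, 1 ≤ n → |PS (fun p => log p / p) n - log n| ≤ K ∧
    |PS (fun p => log p / p * (log n - log p)) n - ((log n)^2/2 + E * log n)| ≤ K := by
  obtain ⟨a0, a1, a2, K, hK, h⟩ := lam_asym
  set s : ℕ → ℝ := fun k => (if k.Prime then 0 else Λ k) / k with hs
  have hs0 : ∀ k, 0 ≤ s k := by
    intro k; simp only [hs]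
    have : 0 ≤ (if k.Prime then 0 else Λ k) := by split_ifs; exact le_rfl; exact ArithmeticFunction.vonMangoldt_nonneg
    positivity
  have ht : Summable (fun k => s k * log k) := by
    refine nonprime_summable.congr fun k => ?_
    simp only [hs]; ring
  have ht0 : ∀ k, 0 ≤ s k * log k := fun k => mul_nonneg (hs0 k) (Real.log_natCast_nonneg k)
  set B := ∑' k, s k * log k with hB
  have hBb : ∀ F : Finset ℕ, ∑ k ∈ F, s k * log k ≤ B := fun F => ht.sum_le_tsum F (fun k _ => ht0 k)
  have hB0 : 0 ≤ B := tsum_nonneg ht0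
  have hs2 : ∀ k, s k ≤ 2 * (s k * log k) := by
    intro k
    rcases Nat.lt_or_ge k 2 with h2 | h2
    · have : s k = 0 := by
        simp only [hs]; interval_cases k <;> simp
      rw [this]; simp
    · have : log 2 ≤ log k := Real.log_le_log (by norm_num) (by exact_mod_cast h2)
      have := Real.log_two_gt_d9
      nlinarith [hs0 k]
  have hss : Summable s := Summable.of_nonneg_of_le hs0 hs2 (ht.mul_left 2)
  set D := ∑' k, s k with hD
  have hD0 : 0 ≤ D := tsum_nonneg hs0
  have hsD : ∀ F : Finset ℕ, ∑ k ∈ F, s k ≤ D := fun F => hss.sum_le_tsum F (fun k _ => hs0 k)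
  have htail : ∀ n : ℕ, 1 ≤ n → log n * (D - ∑ k ∈ Finset.range (n+1), s k) ≤ B := by
    intro n hn
    have hl : 0 ≤ log n := Real.log_natCast_nonneg n
    have e : ∑' k, s (k + (n+1)) = D - ∑ k ∈ Finset.range (n+1), s k := by
      rw [hD, ← hss.sum_add_tsum_nat_add (n+1)]; ring
    rw [← e, ← tsum_mul_left]
    refine Summable.tsum_le_of_sum_range_le (((summable_nat_add_iff (n+1)).2 hss).mul_left _) ?_
    intro m
    refine le_trans (Finset.sum_le_sum (g := fun k => s (k+(n+1)) * log ((k + (n+1) : ℕ):ℝ)) ?_) ?_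
    · intro k _
      rw [mul_comm]
      refine mul_le_mul_of_nonneg_left ?_ (hs0 _)
      exact Real.log_le_log (by exact_mod_cast hn) (by push_cast; linarith [(Nat.cast_nonneg k : (0:ℝ) ≤ k)])
    · have := hBb ((Finset.range m).map (addRightEmbedding (n+1)))
      rw [Finset.sum_map] at this
      simpa using this
  refine ⟨-a1 - D, K + |a0| + D + 2 + (K + |a2| + 2 * B), by positivity, fun n hn => ⟨?_, ?_⟩⟩
  · rcases Nat.lt_or_ge n 2 with h2 | h2
    · have : n = 1 := by omega
      subst this
      have e : PS (fun p => log p / p) 1 = 0 := by simp [PS]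
      rw [e]; simp; positivity
    obtain ⟨m, rfl⟩ : ∃ m, n = m + 1 := ⟨n - 1, by omega⟩
    have hm : 1 ≤ m := by omega
    have hm' : (1:ℝ) ≤ m := by exact_mod_cast hm
    have h1 := (h m hm).1
    have h3 := lam_split m (fun _ => 1)
    simp only [mul_one] at h3
    rw [h3] at h1
    have h4 := hsD (Finset.range (m+1))
    have h5 : 0 ≤ ∑ k ∈ Finset.range (m+1), s k := Finset.sum_nonneg fun k _ => hs0 k
    have h6 : log m ≤ log ((m+1:ℕ):ℝ) := Real.log_le_log (by linarith) (by push_cast; linarith)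
    have h7 : log ((m+1:ℕ):ℝ) ≤ log m + 1 := by
      have : log ((m+1:ℕ):ℝ) ≤ log (2 * m) := Real.log_le_log (by positivity) (by push_cast; linarith)
      rw [Real.log_mul (by norm_num) (by linarith)] at this
      linarith [Real.log_two_lt_d9]
    have h8 := abs_le.1 (le_refl |a0|)
    have h9 := abs_nonneg a2
    simp only [hs] at h4 h5
    rw [abs_le] at h1 ⊢
    constructor <;> linarith
  · have h1 := (h n hn).2
    have h3 := lam_split n (fun k => log n - log k)
    rw [h3, PS_succ] at h1
    simp only [sub_self, mul_zero, ite_self, add_zero] at h1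
    have h4 := htail n hn
    have h5 : ∑ k ∈ Finset.range (n+1), s k * (log n - log k) = log n * ∑ k ∈ Finset.range (n+1), s k - ∑ k ∈ Finset.range (n+1), s k * log k := by
      rw [Finset.mul_sum, ← Finset.sum_sub_distrib]
      exact Finset.sum_congr rfl fun k _ => by ring
    have h6 := hBb (Finset.range (n+1))
    have h7 : 0 ≤ ∑ k ∈ Finset.range (n+1), s k * log k := Finset.sum_nonneg fun k _ => ht0 k
    have h9 : 0 ≤ log n * (D - ∑ k ∈ Finset.range (n+1), s k) :=
      mul_nonneg (Real.log_natCast_nonneg n) (by linarith [hsD (Finset.range (n+1))])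
    have h8 := abs_le.1 (le_refl |a2|)
    have h10 := abs_nonneg a0
    simp only [hs] at h4 h5 h6 h7 h9
    rw [h5] at h1
    rw [abs_le] at h1 ⊢
    constructor <;> nlinarith

theorem PS_add (f g : ℕ → ℝ) (n : ℕ) : PS (fun p => f p + g p) n = PS f n + PS g n := by
  simp only [PS, ← Finset.sum_add_distrib]
  exact Finset.sum_congr rfl fun k _ => by split_ifs <;> simp

theorem PS_mul (c : ℝ) (f : ℕ → ℝ) (n : ℕ) : PS (fun p => c * f p) n = c * PS f n := by
  simp only [PS, Finset.mul_sum]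
  exact Finset.sum_congr rfl fun k _ => by split_ifs <;> simp

theorem PS_congr {f g : ℕ → ℝ} {n : ℕ} (h : ∀ p, p.Prime → f p = g p) : PS f n = PS g n :=
  Finset.sum_congr rfl fun k _ => by split_ifs with hk; exact h k hk; rfl

theorem PS_le {f g : ℕ → ℝ} {n : ℕ} (h : ∀ p, p.Prime → f p ≤ g p) : PS f n ≤ PS g n :=
  Finset.sum_le_sum fun k _ => by split_ifs with hk; exact h k hk; exact le_rfl

theorem PS_abs {f g : ℕ → ℝ} {n : ℕ} (h : ∀ p, p.Prime → |f p| ≤ g p) : |PS f n| ≤ PS g n :=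
  (Finset.abs_sum_le_sum_abs _ _).trans (Finset.sum_le_sum fun k _ => by split_ifs with hk; exact h k hk; simp)

theorem log_sq_div_summable : ∃ K : ℝ, 0 < K ∧ ∀ n, PS (fun p => (log p / p)^2) n ≤ K ∧ 0 ≤ PS (fun p => (log p / p)^2) n := by
  have hsum : Summable (fun n : ℕ => 1 / (n:ℝ) ^ (3/2:ℝ)) := Real.summable_one_div_nat_rpow.2 (by norm_num)
  refine ⟨64 * (∑' n : ℕ, 1 / (n:ℝ) ^ (3/2:ℝ)) + 1, by positivity, fun n => ⟨?_, ?_⟩⟩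
  · have h1 : PS (fun p => (log p / p)^2) n ≤ ∑ k ∈ Finset.range n, 64 * (1 / (k:ℝ) ^ (3/2:ℝ)) := by
      refine Finset.sum_le_sum fun k _ => ?_
      split_ifs with hk
      · have hk1 : (1:ℝ) ≤ k := by exact_mod_cast hk.one_lt.le
        have hk0 : (0:ℝ) < k := by linarith
        obtain ⟨l1, l2, l3⟩ := log_pow_le k hk1
        have e : (k:ℝ)^2 = (k:ℝ) ^ (3/2:ℝ) * ((k:ℝ) ^ (1/4:ℝ) * (k:ℝ) ^ (1/4:ℝ)) := by
          rw [← Real.rpow_add hk0, ← Real.rpow_add hk0, ← Real.rpow_natCast]; norm_num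
        show (log k / k)^2 ≤ _
        rw [div_pow, div_le_iff₀ (by positivity), e]
        have : 0 < (k:ℝ) ^ (3/2:ℝ) := by positivity
        field_simp
        nlinarith
      · positivity
    rw [← Finset.mul_sum] at h1
    have := hsum.sum_le_tsum (Finset.range n) (fun k _ => by positivity)
    linarith
  · exact Finset.sum_nonneg fun k _ => by split_ifs <;> positivity

theorem Q_bound : ∃ E K : ℝ, 0 < K ∧ ∀ n : ℕ, 1 ≤ n → |PS (fun p => log p / p) n - log n| ≤ K ∧
    |PS (fun p => (PS (fun q => log q / q) p - log p - E) * (log p / p)) n| ≤ K := by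
  obtain ⟨E, K, hK, h⟩ := mertens
  obtain ⟨K', hK', h'⟩ := log_sq_div_summable
  refine ⟨E, 2*K + K^2 + K' + |E| * K, by positivity, fun n hn => ?_⟩
  obtain ⟨h1, h2⟩ := h n hn
  refine ⟨h1.trans (by nlinarith [mul_nonneg (abs_nonneg E) hK.le, sq_nonneg K]), ?_⟩
  set M := fun n => PS (fun q => log q / q) n with hM
  have hsq : ∀ n, 2 * PS (fun p => M p * (log p / p)) n = (M n)^2 - PS (fun p => (log p / p)^2) n := by
    intro n
    induction n with
    | zero => simp [hM, PS_zero]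
    | succ n ih =>
      simp only [hM, PS_succ] at ih ⊢
      split_ifs with hp
      · rw [mul_add, ih]; ring
      · simpa using ih
  have e1 : PS (fun p => log p / p * (log n - log p)) n = log n * M n - PS (fun p => log p * (log p / p)) n := by
    have : PS (fun p => log p / p * (log n - log p)) n = PS (fun p => log n * (log p / p) + (-1) * (log p * (log p / p))) n :=
      PS_congr fun p _ => by ring
    rw [this, PS_add (fun p => log n * (log p / p)) (fun p => (-1) * (log p * (log p / p))), PS_mul, PS_mul]; ring
  have e2 : PS (fun p => (M p - log p - E) * (log p / p)) n = PS (fun p => M p * (log p / p)) n - PS (fun p => log p * (log p / p)) n - E * M n := by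
    have : PS (fun p => (M p - log p - E) * (log p / p)) n = PS (fun p => M p * (log p / p) + ((-1) * (log p * (log p / p)) + (-E) * (log p / p))) n :=
      PS_congr fun p _ => by ring
    rw [this, PS_add (fun p => M p * (log p / p)) (fun p => ((-1) * (log p * (log p / p)) + (-E) * (log p / p))),
      PS_add (fun p => (-1) * (log p * (log p / p))) (fun p => (-E) * (log p / p)), PS_mul, PS_mul]; ring
  rw [e2]
  have e3 := hsq n
  obtain ⟨p1, p2⟩ := h' n
  rw [e1] at h2
  change |M n - log n| ≤ K at h1
  have h3 : |E * (M n - log n)| ≤ |E| * K := by rw [abs_mul]; gcongr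
  have h4 : (M n - log n)^2 ≤ K^2 := sq_le_sq' (abs_le.1 h1).1 (abs_le.1 h1).2
  rw [abs_le] at h2 h3 ⊢
  constructor <;> nlinarith [sq_nonneg (M n - log n)]
end

section
open Real Set Filter Topology

theorem abel_id (q κ : ℕ → ℝ) (n n' : ℕ) (h : n ≤ n') :
    ∑ k ∈ Finset.Ico n n', (q (k+1) - q k) * κ k
      = q n' * κ n' - q n * κ n + ∑ k ∈ Finset.Ico n n', q (k+1) * (κ k - κ (k+1)) := by
  induction n', h using Nat.le_induction with
  | base => simp
  | succ m hm ih =>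
    rw [Finset.sum_Ico_succ_top hm, Finset.sum_Ico_succ_top hm, ih]; ring

theorem abel_bound (q κ : ℕ → ℝ) (n n' : ℕ) (h : n ≤ n') (K : ℝ) (hq : ∀ k, n ≤ k → |q k| ≤ K)
    (hκ : ∀ k, n ≤ k → 0 ≤ κ k) (hanti : ∀ k, n ≤ k → κ (k+1) ≤ κ k) :
    |∑ k ∈ Finset.Ico n n', (q (k+1) - q k) * κ k| ≤ 2 * K * κ n := by
  rw [abel_id q κ n n' h]
  have h1 : |∑ k ∈ Finset.Ico n n', q (k+1) * (κ k - κ (k+1))| ≤ K * (κ n - κ n') := by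
    have e : ∑ k ∈ Finset.Ico n n', K * (κ k - κ (k+1)) = K * (κ n - κ n') := by
      rw [← Finset.mul_sum]
      congr 1
      induction n', h using Nat.le_induction with
      | base => simp
      | succ m hm ih => rw [Finset.sum_Ico_succ_top hm, ih]; ring
    rw [← e]
    refine (Finset.abs_sum_le_sum_abs _ _).trans (Finset.sum_le_sum fun k hk => ?_)
    rw [Finset.mem_Ico] at hk
    have := hanti k hk.1
    rw [abs_mul, abs_of_nonneg (show 0 ≤ κ k - κ (k+1) by linarith)]
    exact mul_le_mul_of_nonneg_right (hq _ (by omega)) (by linarith)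
  have h2 : |q n' * κ n'| ≤ K * κ n' := by
    rw [abs_mul, abs_of_nonneg (hκ n' h)]; exact mul_le_mul_of_nonneg_right (hq _ h) (hκ _ h)
  have h3 : |q n * κ n| ≤ K * κ n := by
    rw [abs_mul, abs_of_nonneg (hκ n le_rfl)]; exact mul_le_mul_of_nonneg_right (hq _ le_rfl) (hκ _ le_rfl)
  rw [abs_le] at *
  constructor <;> linarith

theorem log_le_two_sqrt {x : ℝ} (hx : 0 < x) : log x ≤ 2 * √x := by
  have h1 : log (√x) ≤ √x - 1 := Real.log_le_sub_one_of_pos (by positivity)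
  have h2 : log x = 2 * log (√x) := by rw [Real.log_sqrt hx.le]; ring
  linarith

theorem neg_log_bounds {p : ℝ} (hp : 2 ≤ p) : 1 / p ≤ - log (1 - 1/p) ∧ - log (1 - 1/p) ≤ 1 / p + 2 / p^2 := by
  have hp0 : 0 < p := by linarith
  have h1 : 0 < 1 - 1/p := by
    have : 1 / p ≤ 1/2 := one_div_le_one_div_of_le (by norm_num) hp
    linarith
  constructor
  · have := Real.log_le_sub_one_of_pos h1; linarith
  · have := Real.one_sub_inv_le_log_of_pos h1
    have e : 1 - (1 - 1/p)⁻¹ = - (1 / (p - 1)) := by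
      have : p - 1 ≠ 0 := by linarith
      field_simp; ring
    rw [e] at this
    have : 1 / (p-1) ≤ 1 / p + 2 / p^2 := by
      rw [div_add_div _ _ hp0.ne' (by positivity), div_le_div_iff₀ (by linarith) (by positivity)]
      nlinarith
    linarith

theorem log_one_add_bounds {t : ℝ} (ht : 0 ≤ t) : t - t^2 ≤ log (1+t) ∧ log (1+t) ≤ t := by
  constructor
  · have := Real.one_sub_inv_le_log_of_pos (show 0 < 1 + t by linarith)
    have e : 1 - (1+t)⁻¹ = t / (1+t) := by field_simp; ring
    rw [e] at this
    have : t - t^2 ≤ t / (1+t) := by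
      rw [le_div_iff₀ (by linarith)]; nlinarith [pow_nonneg ht 3]
    linarith
  · have := Real.log_le_sub_one_of_pos (show 0 < 1 + t by linarith); linarith

theorem sum_inv_sq_Ico (n n' : ℕ) (hn : 1 ≤ n) (h : n ≤ n') : ∑ k ∈ Finset.Ico n n', 1 / (k:ℝ)^2 ≤ 2 / (n:ℝ) - 2 / (n':ℝ) := by
  induction n', h using Nat.le_induction with
  | base => simp
  | succ m hm ih =>
    rw [Finset.sum_Ico_succ_top hm]
    have hm1 : (1:ℝ) ≤ m := by exact_mod_cast hn.trans hm
    have : 1 / (m:ℝ)^2 ≤ 2 / m - 2 / ((m+1:ℕ):ℝ) := by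
      push_cast
      rw [div_sub_div _ _ (by positivity) (by positivity), div_le_div_iff₀ (by positivity) (by positivity)]
      nlinarith [mul_nonneg (sub_nonneg.2 hm1) (sub_nonneg.2 hm1), pow_pos (show (0:ℝ) < m by linarith) 3]
    linarith

theorem log_tendsto_nat : Tendsto (fun n : ℕ => log (n:ℝ)) atTop atTop :=
  Real.tendsto_log_atTop.comp tendsto_natCast_atTop_atTop

set_option maxHeartbeats 1000000 in
theorem u_asym : ∃ A E K : ℝ, 0 < A ∧ 0 < K ∧ ∀ n : ℕ, 1 ≤ n →
    |A / VV n - (PS (fun q => log q / q) n - E)| * (log n + 1) ≤ K ∧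
    |PS (fun q => log q / q) n - log n| ≤ K ∧
    |PS (fun p => (PS (fun q => log q / q) p - log p - E) * (log p / p)) n| ≤ K := by
  obtain ⟨E, K, hK, h⟩ := Q_bound
  set M := fun n => PS (fun q => log q / q) n with hM
  set Q := fun n => PS (fun p => (M p - log p - E) * (log p / p)) n with hQ
  obtain ⟨n0, hn0⟩ := (log_tendsto_nat.eventually_ge_atTop (2 * (K + |E|) + 2)).exists_forall_of_atTop
  set n1 := max n0 3 with hn1
  have hL : ∀ n, n1 ≤ n → 2 * (K + |E|) + 2 ≤ log n := fun n hn => hn0 n ((le_max_left _ _).trans hn)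
  have hn3 : ∀ n, n1 ≤ n → 3 ≤ n := fun n hn => (le_max_right _ _).trans hn
  have hL1 : ∀ n, n1 ≤ n → 1 ≤ log n := fun n hn => by
    have := hL n hn; have := abs_nonneg E; linarith
  set w := fun n => M n - E with hw
  have hwL : ∀ n, n1 ≤ n → log n / 2 + 1 ≤ w n ∧ w n ≤ 2 * log n := by
    intro n hn
    have h1 := (h n (by have := hn3 n hn; omega)).1
    have h2 := abs_le.1 (le_refl |E|)
    have h3 := hL n hn
    change |M n - log n| ≤ K at h1
    rw [abs_le] at h1
    simp only [hw]
    constructor <;> linarith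
  have hwmono : ∀ n, n1 ≤ n → w n ≤ w (n+1) := by
    intro n hn
    simp only [hw, hM, PS_succ]
    have : 0 ≤ (if n.Prime then log n / n else 0) := by
      split_ifs
      · exact div_nonneg (Real.log_natCast_nonneg n) (Nat.cast_nonneg n)
      · exact le_rfl
    linarith
  set D := fun n => - log (VV n) - log (w n) with hD
  set κ := fun n : ℕ => 1 / (w n * log n) with hκ
  have hκ0 : ∀ n, n1 ≤ n → 0 ≤ κ n := by
    intro n hn
    have := hwL n hn; have := hL1 n hn
    exact div_nonneg zero_le_one (mul_nonneg (by linarith) (by linarith))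
  have hκa : ∀ n, n1 ≤ n → κ (n+1) ≤ κ n := by
    intro n hn
    have a1 := hwL n hn; have a2 := hL1 n hn; have a3 := hwmono n hn
    have a4 : log (n:ℝ) ≤ log ((n+1:ℕ):ℝ) := Real.log_le_log (by have := hn3 n hn; positivity) (by push_cast; linarith)
    exact one_div_le_one_div_of_le (mul_pos (by linarith) (by linarith)) (mul_le_mul a3 a4 (by linarith) (by linarith))
  have hDstep : ∀ n, n1 ≤ n → |D (n+1) - D n - (Q (n+1) - Q n) * κ n| ≤ 6 * (1 / (n:ℝ)^2) := by
    intro n hn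
    by_cases hp : n.Prime
    · have a1 := hwL n hn; have a2 := hL1 n hn
      have hn2 : (2:ℝ) ≤ n := by have := hn3 n hn; exact_mod_cast (by omega : 2 ≤ n)
      have hwp : 0 < w n := by linarith
      set t := log n / n / w n with ht
      have e1 : w (n+1) = w n * (1 + t) := by
        simp only [hw, hM, PS_succ, hp, if_true] at hwp ⊢
        simp only [ht, hw, hM]; field_simp; ring
      have t0 : 0 ≤ t := by positivity
      have t2 : t ≤ 2 / n := by
        rw [ht, div_div, div_le_div_iff₀ (by positivity) (by positivity)]
        nlinarith
      have hV : 0 < 1 - 1/(n:ℝ) := by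
        have : 1 / (n:ℝ) ≤ 1/2 := one_div_le_one_div_of_le (by norm_num) hn2
        linarith
      have e2 : D (n+1) - D n = - log (1 - 1/(n:ℝ)) - log (1 + t) := by
        simp only [hD]
        rw [e1, VV_succ_prime hp, Real.log_mul (VV_pos n).ne' hV.ne', Real.log_mul hwp.ne' (by linarith)]; ring
      have e3 : (Q (n+1) - Q n) * κ n = 1 / n - t := by
        simp only [hQ, PS_succ, hp, if_true, hκ, ht]
        have : log (n:ℝ) ≠ 0 := by linarith
        have e4 : M n = w n + E := by simp [hw]
        rw [e4]
        field_simp; ring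
      rw [e2, e3]
      obtain ⟨b1, b2⟩ := neg_log_bounds hn2
      obtain ⟨b3, b4⟩ := log_one_add_bounds t0
      have b5 : t^2 ≤ 4 * (1 / (n:ℝ)^2) := by
        calc t^2 ≤ (2 / n)^2 := by gcongr
          _ = _ := by ring
      have b6 : 2 / (n:ℝ)^2 = 2 * (1 / (n:ℝ)^2) := by ring
      have b7 : 0 < 1 / (n:ℝ)^2 := by positivity
      rw [abs_le]
      constructor <;> linarith
    · have e1 : D (n+1) - D n = 0 := by
        simp only [hD, hw, hM, PS_succ, hp, if_false, VV_succ_nonprime hp, add_zero, sub_self]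
      have e2 : Q (n+1) - Q n = 0 := by simp [hQ, PS_succ, hp]
      rw [e1, e2]; simp
  set K6 := 4 * K + 48 with hK6
  have hDD : ∀ n n', n1 ≤ n → n ≤ n' → |D n' - D n| ≤ K6 / (log n)^2 := by
    intro n n' hn hnn
    have a1 := hwL n hn; have a2 := hL1 n hn
    have hn1' : 1 ≤ n := by have := hn3 n hn; omega
    have hnpos : (0:ℝ) < n := by exact_mod_cast hn1'
    have e : D n' - D n = ∑ k ∈ Finset.Ico n n', (D (k+1) - D k - (Q (k+1) - Q k) * κ k) + ∑ k ∈ Finset.Ico n n', (Q (k+1) - Q k) * κ k := by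
      rw [← Finset.sum_add_distrib, ← Finset.sum_Ico_sub D hnn]
      exact Finset.sum_congr rfl fun k _ => by ring
    have b1 := abel_bound Q κ n n' hnn K (fun k hk => (h k (by omega)).2) (fun k hk => hκ0 k (hn.trans hk)) (fun k hk => hκa k (hn.trans hk))
    have b2 : |∑ k ∈ Finset.Ico n n', (D (k+1) - D k - (Q (k+1) - Q k) * κ k)| ≤ 12 / n := by
      refine (Finset.abs_sum_le_sum_abs _ _).trans ((Finset.sum_le_sum fun k hk => hDstep k (hn.trans (Finset.mem_Ico.1 hk).1)).trans ?_)
      rw [← Finset.mul_sum]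
      have := sum_inv_sq_Ico n n' hn1' hnn
      have h2 : (0:ℝ) ≤ 2 / n' := by positivity
      have e : (12:ℝ) / n = 6 * (2 / n) := by ring
      rw [e]; linarith
    have b3 : κ n ≤ 2 / (log n)^2 := by
      simp only [hκ]
      rw [div_le_div_iff₀ (mul_pos (by linarith) (by linarith)) (by positivity)]
      nlinarith
    have b4 : 12 / (n:ℝ) ≤ 48 / (log n)^2 := by
      have c1 := log_le_two_sqrt hnpos
      have c2 := Real.sq_sqrt hnpos.le
      rw [div_le_div_iff₀ hnpos (by positivity)]
      nlinarith [Real.sqrt_nonneg (n:ℝ)]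
    rw [e]
    refine (abs_add_le _ _).trans ?_
    have e2 : K6 / (log n)^2 = 48 / (log n)^2 + 2 * K * (2 / (log n)^2) := by rw [hK6]; ring
    have b5 : 2 * K * κ n ≤ 2 * K * (2 / (log n)^2) := by gcongr
    linarith
  have hcau : CauchySeq (fun n => D (n + n1)) := by
    refine cauchySeq_of_le_tendsto_0 (fun n => 2 * (K6 / (log ((n + n1 : ℕ):ℝ))^2)) ?_ ?_
    · intro n m N hN hM'
      rw [Real.dist_eq]
      have c1 := hDD (N + n1) (n + n1) (by omega) (by omega)
      have c2 := hDD (N + n1) (m + n1) (by omega) (by omega)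
      rw [abs_le] at *
      constructor <;> linarith
    · have : Tendsto (fun n : ℕ => log ((n + n1 : ℕ):ℝ)) atTop atTop := log_tendsto_nat.comp (tendsto_add_atTop_nat n1)
      have h2 : Tendsto (fun n : ℕ => (log ((n + n1 : ℕ):ℝ))^2) atTop atTop := (tendsto_pow_atTop (by norm_num)).comp this
      have := (h2.const_div_atTop K6).const_mul 2
      simpa using this
  obtain ⟨Dl, hDl⟩ := cauchySeq_tendsto_of_complete hcau
  have hDlim : ∀ n, n1 ≤ n → |D n - Dl| ≤ K6 / (log n)^2 := by
    intro n hn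
    have t1 : Tendsto (fun m => |D n - D (m + n1)|) atTop (𝓝 |D n - Dl|) := (tendsto_const_nhds.sub hDl).abs
    refine le_of_tendsto t1 ?_
    filter_upwards [eventually_ge_atTop n] with m hm
    rw [abs_sub_comm]
    exact hDD n (m+n1) hn (by omega)
  set u := fun n => exp (-Dl) / VV n with hu
  have huw : ∀ n, n1 ≤ n → u n = w n * exp (D n - Dl) := by
    intro n hn
    have a1 := hwL n hn; have a2 := hL1 n hn
    have hwp : 0 < w n := by linarith
    have e : D n - Dl = -Dl + (- log (VV n) - log (w n)) := by simp only [hD]; ring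
    rw [e, Real.exp_add, sub_eq_add_neg, Real.exp_add, Real.exp_neg (log _), Real.exp_neg (log _), Real.exp_log (VV_pos n), Real.exp_log hwp]
    simp only [hu]; field_simp
  obtain ⟨n2', hn2'⟩ := (log_tendsto_nat.eventually_ge_atTop (K6 + 1)).exists_forall_of_atTop
  set n2 := max n1 n2'
  set S := ∑ n ∈ Finset.range n2, |u n - w n| * (log n + 1) with hS
  have hterm : ∀ n : ℕ, 0 ≤ |u n - w n| * (log n + 1) := fun n => by
    have := Real.log_natCast_nonneg n; positivity
  have hS0 : 0 ≤ S := Finset.sum_nonneg fun n _ => hterm n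
  refine ⟨exp (-Dl), E, K + S + 8 * K6, by positivity, by positivity, fun n hn => ⟨?_, ?_, ?_⟩⟩
  · change |u n - w n| * (log n + 1) ≤ _
    by_cases hn2 : n < n2
    · have := Finset.single_le_sum (f := fun n : ℕ => |u n - w n| * (log n + 1)) (fun n _ => hterm n) (Finset.mem_range.2 hn2)
      have : 0 ≤ 8 * K6 := by positivity
      linarith
    · have hnn : n1 ≤ n := (le_max_left _ _).trans (not_lt.1 hn2)
      have hL2 : K6 + 1 ≤ log n := hn2' n ((le_max_right _ _).trans (not_lt.1 hn2))
      have a1 := hwL n hnn; have a2 := hL1 n hnn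
      have hK6p : 0 < K6 := by positivity
      have hd := hDlim n hnn
      have hd1 : K6 / (log n)^2 ≤ 1 := by rw [div_le_one (by positivity)]; nlinarith
      have he := Real.abs_exp_sub_one_le (hd.trans hd1)
      rw [huw n hnn, show w n * exp (D n - Dl) - w n = w n * (exp (D n - Dl) - 1) by ring, abs_mul, abs_of_pos (by linarith : 0 < w n)]
      calc w n * |exp (D n - Dl) - 1| * (log n + 1) ≤ (2 * log n) * (2 * (K6 / (log n)^2)) * (log n + log n) := by
            gcongr
            · exact a1.2
            · exact he.trans (by gcongr)
        _ = 8 * K6 := by field_simp; ring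
        _ ≤ _ := by linarith
  · exact (h n hn).1.trans (by have : 0 ≤ 8 * K6 := by positivity
                               linarith)
  · exact (h n hn).2.trans (by have : 0 ≤ 8 * K6 := by positivity
                               linarith)

/-- The two facts about primes used in the sieve. -/
theorem primes_main : ∃ A K : ℝ, 0 < A ∧ 0 < K ∧ ∀ n : ℕ, 1 ≤ n →
    |log n - A / VV n| ≤ K ∧
    |PS (fun p => (log p - A / VV p) * (A / VV p) / p) n| ≤ K * √(A / VV n) := by
  obtain ⟨A, E, K, hA, hK, h⟩ := u_asym
  set u := fun n => A / VV n with hu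
  have hup : ∀ n, 0 < u n := fun n => div_pos hA (VV_pos n)
  set M := fun n => PS (fun q => log q / q) n with hM
  set K8 := 2 * K + |E| with hK8
  have h2 : ∀ n : ℕ, 1 ≤ n → |log n - u n| ≤ K8 := by
    intro n hn
    obtain ⟨h1, h3, _⟩ := h n hn
    change |u n - (M n - E)| * (log n + 1) ≤ K at h1
    change |M n - log n| ≤ K at h3
    have : |u n - (M n - E)| ≤ K := by
      have := Real.log_natCast_nonneg n
      nlinarith [abs_nonneg (u n - (M n - E))]
    have h5 := abs_le.1 (le_refl |E|)
    rw [abs_le] at *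
    constructor <;> linarith
  set K9 := K + K8^2 with hK9
  have hrec : ∀ n, PS (fun p => 1 / (p:ℝ)) n ≤ log (u n) - log A := by
    intro n
    induction n with
    | zero => simp [PS_zero, hu, VV]
    | succ n ih =>
      rw [PS_succ]
      split_ifs with hp
      · have hn2 : (2:ℝ) ≤ n := by exact_mod_cast hp.two_le
        have hV : 0 < 1 - 1/(n:ℝ) := by
          have : 1 / (n:ℝ) ≤ 1/2 := one_div_le_one_div_of_le (by norm_num) hn2
          linarith
        have e : log (u (n+1)) = log (u n) - log (1 - 1/(n:ℝ)) := by
          simp only [hu]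
          rw [VV_succ_prime hp, ← div_div, Real.log_div (hup n).ne' hV.ne']
        have := (neg_log_bounds hn2).1
        rw [e]; linarith
      · have : u (n+1) = u n := by simp only [hu, VV_succ_nonprime hp]
        rw [this]; linarith
  have hmono : ∀ n, A ≤ u n := by
    intro n
    have : 0 ≤ PS (fun p => 1 / (p:ℝ)) n := Finset.sum_nonneg fun k _ => by split_ifs <;> positivity
    have := hrec n
    exact (Real.log_le_log_iff hA (hup n)).1 (by linarith)
  refine ⟨A, K8 + (2 * K9 + (K + K9 * |log A|) / √A), hA, by positivity, fun n hn => ⟨?_, ?_⟩⟩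
  · have : 0 ≤ (2 * K9 + (K + K9 * |log A|) / √A) := by positivity
    have := h2 n hn
    simp only [hu] at this; linarith
  · change |PS (fun p => (log p - u p) * u p / p) n| ≤ _ * √(u n)
    have e : PS (fun p => (log p - u p) * u p / p) n = (-1) * PS (fun p => (M p - log p - E) * (log p / p)) n + PS (fun p => (M p - E - u p) * log p / p - (log p - u p)^2 / p) n := by
      rw [← PS_mul, ← PS_add]
      exact PS_congr fun p hp => by ring
    have b1 := (h n hn).2.2
    change |PS (fun p => (M p - log p - E) * (log p / p)) n| ≤ K at b1
    have b2 : |PS (fun p => (M p - E - u p) * log p / p - (log p - u p)^2 / p) n| ≤ PS (fun p => K9 * (1 / (p:ℝ))) n := by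
      refine PS_abs fun p hp => ?_
      have hp1 : 1 ≤ p := hp.one_lt.le
      have hp0 : (0:ℝ) < p := by exact_mod_cast hp1
      have c1 := (h p hp1).1
      have c2 := h2 p hp1
      change |u p - (M p - E)| * (log p + 1) ≤ K at c1
      have c3 : |(M p - E - u p) * log p| ≤ K := by
        rw [abs_mul, abs_sub_comm, abs_of_nonneg (Real.log_natCast_nonneg p)]
        have := abs_nonneg (u p - (M p - E))
        linarith
      have c4 : (log p - u p)^2 ≤ K8^2 := sq_le_sq' (abs_le.1 c2).1 (abs_le.1 c2).2
      have c5 := sq_nonneg (log p - u p)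
      rw [← sub_div, abs_div, abs_of_pos hp0, div_eq_mul_one_div]
      gcongr
      rw [abs_le] at c3 ⊢
      constructor <;> linarith
    rw [PS_mul] at b2
    have b3 := hrec n
    have b4 := log_le_two_sqrt (hup n)
    have sA : 0 < √A := by positivity
    have b5 : √A ≤ √(u n) := Real.sqrt_le_sqrt (hmono n)
    have b6 := neg_le_abs (log A)
    have b7 : K9 * PS (fun p => 1 / (p:ℝ)) n ≤ K9 * (2 * √(u n) + |log A|) := by
      gcongr; linarith
    have b8 : K + K9 * |log A| ≤ (K + K9 * |log A|) / √A * √(u n) := by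
      rw [div_mul_eq_mul_div, le_div_iff₀ sA]
      gcongr
    have b9 : 0 ≤ K8 * √(u n) := by positivity
    rw [e]
    refine (abs_add_le _ _).trans ?_
    rw [abs_mul]; simp only [abs_neg, abs_one, one_mul]
    nlinarith
end

section
open Real Set

noncomputable def JJ : ℕ → ℝ → ℝ
  | 0 => fun _ => 1
  | 1 => fun s => Real.log (s - 1)
  | (n + 2) => fun s => ∫ t in (3 : ℝ)..s, JJ (n + 1) (max t 3 - 1) / (max t 3 - 1)

lemma JJ_succ (n : ℕ) (s : ℝ) : JJ (n + 2) s = ∫ t in (3 : ℝ)..s, JJ (n + 1) (max t 3 - 1) / (max t 3 - 1) := by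
  rw [JJ]

lemma JJ_contOn (n : ℕ) : ContinuousOn (JJ (n + 1)) (Ioi 1) ∧
    Continuous (fun t : ℝ => JJ (n + 1) (max t 3 - 1) / (max t 3 - 1)) ∧ ∀ s : ℝ, s ≤ n + 2 → (1 < n + 1 ∨ s = 2) → JJ (n + 1) s = 0 := by
  have gen : ∀ f : ℝ → ℝ, ContinuousOn f (Ioi 1) → Continuous (fun t : ℝ => f (max t 3 - 1) / (max t 3 - 1)) := by
    intro f hf
    apply Continuous.div
    · apply hf.comp_continuous (by fun_prop)
      intro t; have := le_max_right t 3; simp only [mem_Ioi]; linarith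
    · fun_prop
    · intro t; have := le_max_right t 3; linarith
  induction n with
  | zero =>
    have h1 : ContinuousOn (JJ (0 + 1)) (Ioi 1) := by
      simp only [JJ]
      apply ContinuousOn.log (by fun_prop)
      intro s hs; simp only [mem_Ioi] at hs; linarith
    refine ⟨h1, gen _ h1, ?_⟩
    intro s _ h
    rcases h with h | h
    · omega
    · rw [h]; simp [JJ]; norm_num
  | succ n ih =>
    have h1 : ContinuousOn (JJ (n + 1 + 1)) (Ioi 1) := by
      have : Continuous (JJ (n + 1 + 1)) := by
        have e : JJ (n + 1 + 1) = fun s => ∫ t in (3 : ℝ)..s, JJ (n + 1) (max t 3 - 1) / (max t 3 - 1) := by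
          funext s; exact JJ_succ n s
        rw [e]
        exact intervalIntegral.continuous_primitive (fun a b => ih.2.1.intervalIntegrable a b) 3
      exact this.continuousOn
    refine ⟨h1, gen _ h1, ?_⟩
    intro s hs _
    rw [JJ_succ]
    apply intervalIntegral.integral_zero_ae
    apply Filter.Eventually.of_forall
    intro t ht
    push_cast at hs
    have ht' : t ≤ max 3 s := by
      rw [uIoc] at ht; exact ht.2
    have : JJ (n + 1) (max t 3 - 1) = 0 := by
      rcases Nat.eq_zero_or_pos n with h0 | h0
      · subst h0
        apply ih.2.2
        · simp only [Nat.cast_zero] at *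
          have : max t 3 ≤ 3 := by
            apply max_le _ le_rfl
            apply ht'.trans; apply max_le le_rfl; linarith
          linarith
        · right
          have : max t 3 = 3 := by
            apply le_antisymm _ (le_max_right _ _)
            apply max_le _ le_rfl
            apply ht'.trans; apply max_le le_rfl; simp at hs; linarith
          rw [this]; norm_num
      · apply ih.2.2 _ _ (Or.inl (by omega))
        have hn : (1 : ℝ) ≤ n := by exact_mod_cast h0
        have : max t 3 ≤ n + 3 := by
          apply max_le _ (by linarith)
          apply ht'.trans; apply max_le <;> linarith
        linarith
    rw [this, zero_div]

lemma JJ_zero (n : ℕ) (s : ℝ) (hs : s ≤ n + 3) : JJ (n + 2) s = 0 := by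
  apply (JJ_contOn (n + 1)).2.2
  · push_cast; linarith
  · left; omega

lemma JJ_deriv (n : ℕ) (s : ℝ) : HasDerivAt (JJ (n + 2)) (JJ (n + 1) (max s 3 - 1) / (max s 3 - 1)) s := by
  have e : JJ (n + 2) = fun s => ∫ t in (3 : ℝ)..s, JJ (n + 1) (max t 3 - 1) / (max t 3 - 1) := by
    funext s; exact JJ_succ n s
  rw [e]
  have hc := (JJ_contOn n).2.1
  exact intervalIntegral.integral_hasDerivAt_right (hc.intervalIntegrable _ _)
    (hc.stronglyMeasurableAtFilter _ _) hc.continuousAt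

noncomputable def sP (s : ℝ) : ℝ := ∑ m ∈ Finset.range (⌈s⌉₊ + 1), JJ (2 * m) s
noncomputable def sp (s : ℝ) : ℝ := ∑ m ∈ Finset.range (⌈s⌉₊ + 1), JJ (2 * m + 1) s

lemma sP_eq (n : ℕ) (s : ℝ) (hs : s ≤ n) : sP s = ∑ m ∈ Finset.range (n + 1), JJ (2 * m) s := by
  unfold sP
  apply Finset.sum_subset
  · apply Finset.range_subset_range.2
    have := Nat.ceil_le.2 hs
    omega
  · intro m _ hm
    simp only [Finset.mem_range, not_lt] at hm
    obtain ⟨k, rfl⟩ : ∃ k, m = k + 1 := ⟨m - 1, by omega⟩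
    rw [show 2 * (k + 1) = 2 * k + 2 by ring]
    apply JJ_zero
    have h1 : s ≤ ⌈s⌉₊ := Nat.le_ceil s
    have h2 : (⌈s⌉₊ : ℝ) ≤ k := by exact_mod_cast (by omega : ⌈s⌉₊ ≤ k)
    push_cast
    have : (0 : ℝ) ≤ k := Nat.cast_nonneg _
    linarith

lemma sp_eq (n : ℕ) (s : ℝ) (hs : s ≤ n) : sp s = ∑ m ∈ Finset.range (n + 1), JJ (2 * m + 1) s := by
  unfold sp
  apply Finset.sum_subset
  · apply Finset.range_subset_range.2
    have := Nat.ceil_le.2 hs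
    omega
  · intro m _ hm
    simp only [Finset.mem_range, not_lt] at hm
    obtain ⟨k, rfl⟩ : ∃ k, m = k + 1 := ⟨m - 1, by omega⟩
    rw [show 2 * (k + 1) + 1 = (2 * k + 1) + 2 by ring]
    apply JJ_zero
    have h1 : s ≤ ⌈s⌉₊ := Nat.le_ceil s
    have h2 : (⌈s⌉₊ : ℝ) ≤ k := by exact_mod_cast (by omega : ⌈s⌉₊ ≤ k)
    push_cast
    have : (0 : ℝ) ≤ k := Nat.cast_nonneg _
    linarith

lemma sP_one (s : ℝ) (hs : s ≤ 3) : sP s = 1 := by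
  rw [sP_eq 3 s (by exact_mod_cast hs), Finset.sum_range_succ']
  have : ∀ m ∈ Finset.range 3, JJ (2 * (m + 1)) s = 0 := by
    intro m _
    rw [show 2 * (m + 1) = 2 * m + 2 by ring]
    apply JJ_zero
    have : (0 : ℝ) ≤ ((2 * m : ℕ) : ℝ) := Nat.cast_nonneg _
    linarith
  rw [Finset.sum_eq_zero this]; simp [JJ]

lemma sp_log (s : ℝ) (hs : s ≤ 4) : sp s = Real.log (s - 1) := by
  rw [sp_eq 4 s (by exact_mod_cast hs), Finset.sum_range_succ']
  have : ∀ m ∈ Finset.range 4, JJ (2 * (m + 1) + 1) s = 0 := by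
    intro m _
    rw [show 2 * (m + 1) + 1 = (2 * m + 1) + 2 by ring]
    apply JJ_zero
    push_cast
    have : (0 : ℝ) ≤ m := Nat.cast_nonneg _
    linarith
  rw [Finset.sum_eq_zero this]; simp [JJ]

lemma sP_deriv (s : ℝ) : HasDerivAt sP (sp (max s 3 - 1) / (max s 3 - 1)) s := by
  obtain ⟨n, hn⟩ := exists_nat_gt (max s 3)
  have hsn : s < n := lt_of_le_of_lt (le_max_left _ _) hn
  have h1 : HasDerivAt (fun t => ∑ m ∈ Finset.range (n + 1 + 1), JJ (2 * m) t)
      (sp (max s 3 - 1) / (max s 3 - 1)) s := by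
    rw [sp_eq n _ (by linarith), Finset.sum_div]
    have : (fun t => ∑ m ∈ Finset.range (n + 1 + 1), JJ (2 * m) t) =
        fun t => ∑ m ∈ Finset.range (n + 1), JJ (2 * m + 1 + 1) t + 1 := by
      funext t; rw [Finset.sum_range_succ']; simp [JJ, mul_add]
    rw [this]
    apply HasDerivAt.add_const
    apply HasDerivAt.fun_sum
    intro m _
    exact JJ_deriv (2 * m) s
  apply h1.congr_of_eventuallyEq
  filter_upwards [Iio_mem_nhds hsn] with t ht
  apply sP_eq
  simp only [mem_Iio] at ht; push_cast; linarith

lemma sp_deriv (s : ℝ) (hs : 1 < s) : HasDerivAt sp (sP (s - 1) / (s - 1)) s := by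
  obtain ⟨n, hn⟩ := exists_nat_gt (max s 3)
  have hsn : s < n := lt_of_le_of_lt (le_max_left _ _) hn
  have hJ1 : HasDerivAt (JJ 1) (1 / (s - 1)) s := by
    simp only [JJ]
    exact ((hasDerivAt_id s).sub_const 1).log (by simp; linarith)
  have h1 : HasDerivAt (fun t => ∑ m ∈ Finset.range (n + 1 + 1), JJ (2 * m + 1) t)
      ((sP (max s 3 - 1) - 1) / (max s 3 - 1) + 1 / (s - 1)) s := by
    rw [sP_eq (n + 1) _ (by push_cast; linarith), Finset.sum_range_succ', JJ, add_sub_cancel_right, Finset.sum_div]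
    have : (fun t => ∑ m ∈ Finset.range (n + 1 + 1), JJ (2 * m + 1) t) =
        fun t => ∑ m ∈ Finset.range (n + 1), JJ (2 * m + 1 + 2) t + JJ 1 t := by
      funext t; rw [Finset.sum_range_succ']; simp [mul_add, add_right_comm]
    rw [this]
    apply HasDerivAt.add _ hJ1
    apply HasDerivAt.fun_sum
    intro m _
    exact JJ_deriv (2 * m + 1) s
  have e : (sP (max s 3 - 1) - 1) / (max s 3 - 1) + 1 / (s - 1) = sP (s - 1) / (s - 1) := by
    rcases le_total s 3 with h | h
    · rw [max_eq_right h, sP_one (3 - 1) (by norm_num), sP_one (s - 1) (by linarith)]; simp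
    · rw [max_eq_left h, ← add_div]; congr 1; ring
  rw [← e]
  apply h1.congr_of_eventuallyEq
  filter_upwards [Iio_mem_nhds hsn] with t ht
  apply sp_eq
  simp only [mem_Iio] at ht; push_cast; linarith
end

section
open Real Set

lemma first_fail (φ : ℝ → ℝ) (hc : ContinuousOn φ (Ici 3))
    (h : ∀ s, 3 ≤ s → (∀ t, 3 ≤ t → t < s → 0 < φ t) → 0 < φ s) : ∀ s, 3 ≤ s → 0 < φ s := by
  intro s hs
  by_contra hcon
  push Not at hcon
  have hcl : IsCompact (Icc 3 s ∩ φ ⁻¹' Iic 0) := by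
    have : IsClosed (Icc 3 s ∩ φ ⁻¹' Iic 0) :=
      (hc.mono Icc_subset_Ici_self).preimage_isClosed_of_isClosed isClosed_Icc isClosed_Iic
    exact isCompact_Icc.of_isClosed_subset this inter_subset_left
  obtain ⟨m, hm, hmin⟩ := hcl.exists_isMinOn ⟨s, ⟨⟨hs, le_rfl⟩, hcon⟩⟩ (f := id) continuousOn_id
  have hm2 := hm.2
  simp only [mem_preimage, mem_Iic] at hm2
  have := h m hm.1.1 (by
    intro t ht htm
    by_contra hc2
    push Not at hc2
    have h5 := hmin (show t ∈ Icc 3 s ∩ φ ⁻¹' Iic 0 from ⟨⟨ht, htm.le.trans hm.1.2⟩, hc2⟩)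
    simp at h5
    linarith)
  linarith

noncomputable def sw (s : ℝ) : ℝ := sP s - sp s

lemma sw_deriv (s : ℝ) (hs : 3 ≤ s) : HasDerivAt sw (-(sw (s - 1) / (s - 1))) s := by
  have := (sP_deriv s).sub (sp_deriv s (by linarith))
  rw [max_eq_left hs] at this
  refine this.congr_deriv ?_
  unfold sw; ring

lemma sw_log (s : ℝ) (hs : s ≤ 3) : sw s = 1 - Real.log (s - 1) := by
  unfold sw; rw [sP_one s hs, sp_log s (by linarith)]

lemma sP_cont : Continuous sP := continuous_iff_continuousAt.2 fun s => (sP_deriv s).continuousAt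

lemma sw_contAt (s : ℝ) (hs : 1 < s) : ContinuousAt sw s :=
  (sP_deriv s).continuousAt.sub (sp_deriv s hs).continuousAt

lemma swc_cont : Continuous (fun t : ℝ => sw (max t 2)) := by
  rw [continuous_iff_continuousAt]
  intro t
  have h := sw_contAt (max t 2) (by have := le_max_right t 2; linarith)
  exact ContinuousAt.comp (f := fun t : ℝ => max t 2) h (by fun_prop)

noncomputable def Wi (s : ℝ) : ℝ := ∫ t in (2 : ℝ)..s, sw (max t 2)

lemma Wi_deriv (s : ℝ) : HasDerivAt Wi (sw (max s 2)) s :=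
  intervalIntegral.integral_hasDerivAt_right (swc_cont.intervalIntegrable _ _)
    (swc_cont.stronglyMeasurableAtFilter _ _) swc_cont.continuousAt

lemma Wi_two : Wi 2 = 0 := by simp [Wi]

lemma Wi_three : Wi 3 = 2 - 2 * Real.log 2 := by
  have h : ∀ s ∈ Icc (2 : ℝ) 3, (fun s => Wi s - (2 * s - (s - 1) * Real.log (s - 1))) s =
      (fun s => Wi s - (2 * s - (s - 1) * Real.log (s - 1))) 2 := by
    have hd : ∀ s ∈ Icc (2 : ℝ) 3, HasDerivAt (fun s => Wi s - (2 * s - (s - 1) * Real.log (s - 1))) 0 s := by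
      intro s hs
      have h1 := Wi_deriv s
      rw [max_eq_left hs.1, sw_log s hs.2] at h1
      have hne : s - 1 ≠ 0 := by linarith [hs.1]
      have h2 : HasDerivAt (fun s : ℝ => (s - 1)) 1 s := (hasDerivAt_id s).sub_const 1
      have h3 := h2.mul (h2.log hne)
      have h4 := h1.sub (((hasDerivAt_id s).const_mul 2).sub h3)
      refine h4.congr_deriv ?_
      field_simp; ring
    apply constant_of_has_deriv_right_zero
    · intro s hs; exact (hd s hs).continuousAt.continuousWithinAt
    · intro s hs; exact (hd s ⟨hs.1, hs.2.le⟩).hasDerivWithinAt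
  have := h 3 ⟨by norm_num, le_rfl⟩
  simp only [Wi_two] at this
  norm_num at this
  linarith

lemma sw_int (s : ℝ) (hs : 3 ≤ s) : (s - 1) * sw s = Wi s - Wi (s - 1) := by
  have hd : ∀ t, 3 ≤ t → HasDerivAt (fun s => (s - 1) * sw s - (Wi s - Wi (s - 1))) 0 t := by
    intro t ht
    have h2 : HasDerivAt (fun s : ℝ => (s - 1)) 1 t := (hasDerivAt_id t).sub_const 1
    have h3 := h2.mul (sw_deriv t ht)
    have h5 : HasDerivAt (fun s => Wi (s - 1)) (sw (max (t - 1) 2) * 1) t := HasDerivAt.comp (h₂ := Wi) t (Wi_deriv (t - 1)) h2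
    have h4 := h3.sub ((Wi_deriv t).sub h5)
    refine h4.congr_deriv ?_
    rw [max_eq_left (by linarith : (2 : ℝ) ≤ t), max_eq_left (by linarith : (2 : ℝ) ≤ t - 1)]
    have hne : t - 1 ≠ 0 := by linarith
    field_simp; ring
  have := constant_of_has_deriv_right_zero (a := 3) (b := s)
    (f := (fun s => (s - 1) * sw s - (Wi s - Wi (s - 1))))
    (fun t ht => (hd t ht.1).continuousAt.continuousWithinAt)
    (fun t ht => (hd t ht.1).hasDerivWithinAt) s ⟨hs, le_rfl⟩
  rw [Wi_three, sw_log 3 le_rfl, show (3 : ℝ) - 1 = 2 by norm_num, Wi_two] at this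
  linarith

lemma log_two_lt : Real.log 2 < 0.6931471808 := Real.log_two_lt_d9

lemma sw_pos_small (s : ℝ) (h1 : 1 < s) (hs : s ≤ 3) : 0 < sw s := by
  rw [sw_log s hs]
  have := Real.log_le_log (by linarith : 0 < s - 1) (by linarith : s - 1 ≤ 2)
  have := log_two_lt
  linarith

lemma sw_pos (s : ℝ) (h1 : 1 < s) : 0 < sw s := by
  rcases le_total s 3 with h | h
  · exact sw_pos_small s h1 h
  · revert s
    suffices H : ∀ s, 3 ≤ s → 0 < sw s from fun s _ h => H s h
    apply first_fail
    · intro s hs; simp only [mem_Ici] at hs; exact (sw_contAt s (by linarith)).continuousWithinAt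
    · intro s hs hlt
      have h2 := sw_int s hs
      have h3 : Wi (s - 1) < Wi s := by
        have hm : StrictMonoOn Wi (Icc (s - 1) s) := by
          apply strictMonoOn_of_deriv_pos (convex_Icc _ _)
          · intro t _; exact (Wi_deriv t).continuousAt.continuousWithinAt
          · intro t ht
            rw [interior_Icc] at ht
            rw [(Wi_deriv t).deriv, max_eq_left (by linarith [ht.1])]
            rcases le_total t 3 with h' | h'
            · exact sw_pos_small t (by linarith [ht.1]) h'
            · exact hlt t h' ht.2
        exact hm ⟨le_rfl, by linarith⟩ ⟨by linarith, le_rfl⟩ (by linarith)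
      have : 0 < (s - 1) * sw s := by rw [h2]; linarith
      exact pos_of_mul_pos_right this (by linarith)

lemma sw_anti : AntitoneOn sw (Ici 2) := by
  have h1 : AntitoneOn sw (Icc 2 3) := by
    intro s hs t ht hst
    rw [sw_log s hs.2, sw_log t ht.2]
    have := Real.log_le_log (by linarith [hs.1] : 0 < s - 1) (by linarith : s - 1 ≤ t - 1)
    linarith
  have h2 : AntitoneOn sw (Ici 3) := by
    apply antitoneOn_of_deriv_nonpos (convex_Ici _)
    · intro s hs; exact (sw_deriv s hs).continuousAt.continuousWithinAt
    · intro s hs; rw [interior_Ici] at hs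
      exact (sw_deriv s (le_of_lt hs)).differentiableAt.differentiableWithinAt
    · intro s hs; rw [interior_Ici] at hs
      simp only [mem_Ioi] at hs
      rw [(sw_deriv s (le_of_lt hs)).deriv]
      have := sw_pos (s - 1) (by linarith)
      have : 0 ≤ sw (s - 1) / (s - 1) := div_nonneg this.le (by linarith)
      linarith
  intro s hs t ht hst
  simp only [mem_Ici] at hs ht
  rcases le_total t 3 with h | h
  · exact h1 ⟨hs, hst.trans h⟩ ⟨ht, h⟩ hst
  · rcases le_total s 3 with h' | h'
    · exact (h2 (le_refl (3 : ℝ)) h h).trans (h1 ⟨hs, h'⟩ ⟨by norm_num, le_rfl⟩ h')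
    · exact h2 h' h hst

lemma sw_step (s : ℝ) (hs : 3 ≤ s) : sw s ≤ sw (s - 1) / (s - 1) := by
  have h := sw_int s hs
  rw [le_div_iff₀ (by linarith), mul_comm, h]
  obtain ⟨c, hc, he⟩ := exists_hasDerivAt_eq_slope Wi (fun t => sw (max t 2)) (a := s - 1) (b := s) (by linarith)
    (fun t _ => (Wi_deriv t).continuousAt.continuousWithinAt) (fun t _ => Wi_deriv t)
  have e : s - (s - 1) = 1 := by ring
  rw [e, div_one] at he
  rw [← he, max_eq_left (by linarith [hc.1])]
  exact sw_anti (by simp only [mem_Ici]; linarith) (by simp only [mem_Ici]; linarith [hc.1]) hc.1.le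

lemma sw_decay : ∀ s, 2 ≤ s → sw s ≤ 5 ^ 6 / s ^ 6 := by
  have hsmall : ∀ s, 2 ≤ s → s ≤ 5 → sw s ≤ 5 ^ 6 / s ^ 6 := by
    intro s hs h5
    have h1 := sw_anti (show (2 : ℝ) ∈ Ici (2 : ℝ) from self_mem_Ici) (show s ∈ Ici (2 : ℝ) from hs) hs
    rw [sw_log 2 (by norm_num)] at h1
    norm_num at h1
    refine h1.trans ?_
    rw [le_div_iff₀ (by positivity), one_mul]
    gcongr
  have : ∀ n : ℕ, ∀ s : ℝ, 2 ≤ s → s ≤ 5 + n → sw s ≤ 5 ^ 6 / s ^ 6 := by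
    intro n
    induction n with
    | zero => intro s hs h5; exact hsmall s hs (by simpa using h5)
    | succ n ih =>
      intro s hs h5
      push_cast at h5
      rcases le_total s 5 with h | h
      · exact hsmall s hs h
      · refine (sw_step s (by linarith)).trans ?_
        have h1 := ih (s - 1) (by linarith) (by linarith)
        have hpos : 0 < s - 1 := by linarith
        calc sw (s - 1) / (s - 1) ≤ (5 ^ 6 / (s - 1) ^ 6) / (s - 1) := by gcongr
          _ = 5 ^ 6 / ((s - 1) ^ 6 * (s - 1)) := by rw [div_div]
          _ ≤ 5 ^ 6 / s ^ 6 := by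
            gcongr
            have h2 : (4 : ℝ) * s ≤ 5 * (s - 1) := by linarith
            have h3 : (4 * s) ^ 6 ≤ (5 * (s - 1)) ^ 6 := by gcongr
            have h4 : (0 : ℝ) ≤ (s - 1) ^ 6 := by positivity
            rw [mul_pow, mul_pow] at h3
            nlinarith
  intro s hs
  obtain ⟨n, hn⟩ := exists_nat_ge s
  exact this n s hs (by linarith)

noncomputable def Rp (s : ℝ) : ℝ := sP s - s * (sp (max s 3 - 1) / (max s 3 - 1))
noncomputable def Rm (s : ℝ) : ℝ := s * (sP (s - 1) / (s - 1)) - sp s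

lemma Rp_one (s : ℝ) (hs : s ≤ 3) : Rp s = 1 := by
  unfold Rp
  rw [max_eq_right hs, sP_one s hs, sp_log _ (by norm_num)]; norm_num

lemma Rm_small (s : ℝ) (hs : s ≤ 4) : Rm s = s / (s - 1) - Real.log (s - 1) := by
  unfold Rm; rw [sP_one _ (by linarith), sp_log s hs]; ring

lemma F_deriv (s : ℝ) (hs : 0 < s) : HasDerivAt (fun s => sP s / s) (-(Rp s / s ^ 2)) s := by
  have := (sP_deriv s).div (hasDerivAt_id s) (by simpa using hs.ne')
  refine this.congr_deriv ?_
  unfold Rp; simp only [id]; ring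

lemma f_deriv (s : ℝ) (hs : 1 < s) : HasDerivAt (fun s => sp s / s) (Rm s / s ^ 2) s := by
  have := (sp_deriv s hs).div (hasDerivAt_id s) (by simp; linarith)
  refine this.congr_deriv ?_
  unfold Rm; simp only [id]; ring

lemma Rp_deriv (s : ℝ) (hs : 3 < s) : HasDerivAt Rp (-(s * (Rm (s - 1) / (s - 1) ^ 2))) s := by
  have h2 : HasDerivAt (fun s : ℝ => (s - 1)) 1 s := (hasDerivAt_id s).sub_const 1
  have h3 : HasDerivAt (fun s => sp (s - 1) / (s - 1)) (Rm (s - 1) / (s - 1) ^ 2 * 1) s :=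
    HasDerivAt.comp (h₂ := fun s => sp s / s) s (f_deriv (s - 1) (by linarith)) h2
  have h4 := (sP_deriv s).sub ((hasDerivAt_id s).mul h3)
  have h5 : HasDerivAt (fun s => sP s - s * (sp (s - 1) / (s - 1))) (-(s * (Rm (s - 1) / (s - 1) ^ 2))) s := by
    refine h4.congr_deriv ?_
    rw [max_eq_left hs.le]; simp only [id]; ring
  apply h5.congr_of_eventuallyEq
  filter_upwards [Ioi_mem_nhds hs] with t ht
  unfold Rp; rw [max_eq_left (le_of_lt ht)]

lemma Rm_deriv (s : ℝ) (hs : 1 < s) : HasDerivAt Rm (-(s * (Rp (s - 1) / (s - 1) ^ 2))) s := by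
  have h2 : HasDerivAt (fun s : ℝ => (s - 1)) 1 s := (hasDerivAt_id s).sub_const 1
  have h3 : HasDerivAt (fun s => sP (s - 1) / (s - 1)) (-(Rp (s - 1) / (s - 1) ^ 2) * 1) s :=
    HasDerivAt.comp (h₂ := fun s => sP s / s) s (F_deriv (s - 1) (by linarith)) h2
  have h4 := ((hasDerivAt_id s).mul h3).sub (sp_deriv s hs)
  refine h4.congr_deriv ?_
  simp only [id]; ring

lemma Rp_cont : Continuous Rp := by
  unfold Rp
  apply sP_cont.sub
  apply continuous_id.mul
  apply Continuous.div
  · rw [continuous_iff_continuousAt]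
    intro t
    have h := (sp_deriv (max t 3 - 1) (by have := le_max_right t 3; linarith)).continuousAt
    exact ContinuousAt.comp (f := fun t : ℝ => max t 3 - 1) h (by fun_prop)
  · fun_prop
  · intro t; have := le_max_right t 3; linarith

lemma Rm_pos_small (s : ℝ) (h1 : 1 < s) (hs : s ≤ 3) : 0 < Rm s := by
  rw [Rm_small s (by linarith)]
  have := Real.log_le_log (by linarith : 0 < s - 1) (by linarith : s - 1 ≤ 2)
  have := log_two_lt
  have : 1 ≤ s / (s - 1) := by rw [le_div_iff₀ (by linarith)]; linarith
  linarith

lemma R_pos_aux : ∀ s, 3 ≤ s → 0 < min (Rp s) (Rm s) := by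
  apply first_fail
  · intro s hs; simp only [mem_Ici] at hs
    exact ContinuousAt.continuousWithinAt (Filter.Tendsto.min Rp_cont.continuousAt (Rm_deriv s (by linarith)).continuousAt)
  · intro s hs hlt
    have hp : ∀ t, s - 1 < t → t < s → 0 < Rp t := by
      intro t _ hts
      rcases le_total t 3 with h | h
      · rw [Rp_one t h]; norm_num
      · exact (lt_min_iff.1 (hlt t h hts)).1
    have hm : ∀ t, s - 1 < t → t < s → 0 < Rm t := by
      intro t h1 hts
      rcases le_total t 3 with h | h
      · exact Rm_pos_small t (by linarith) h
      · exact (lt_min_iff.1 (hlt t h hts)).2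
    have hF : AntitoneOn (fun s => sP s / s) (Icc (s - 1) s) := by
      apply antitoneOn_of_deriv_nonpos (convex_Icc _ _)
      · intro t ht; exact (F_deriv t (by linarith [ht.1])).continuousAt.continuousWithinAt
      · intro t ht; rw [interior_Icc] at ht
        exact (F_deriv t (by linarith [ht.1])).differentiableAt.differentiableWithinAt
      · intro t ht; rw [interior_Icc] at ht
        rw [(F_deriv t (by linarith [ht.1])).deriv]
        have := hp t ht.1 ht.2
        have : 0 < Rp t / t ^ 2 := div_pos this (by have := ht.1; have : 0 < t := by linarith
                                                    positivity)
        linarith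
    have hf : MonotoneOn (fun s => sp s / s) (Icc (s - 1) s) := by
      apply monotoneOn_of_deriv_nonneg (convex_Icc _ _)
      · intro t ht; exact (f_deriv t (by linarith [ht.1])).continuousAt.continuousWithinAt
      · intro t ht; rw [interior_Icc] at ht
        exact (f_deriv t (by linarith [ht.1])).differentiableAt.differentiableWithinAt
      · intro t ht; rw [interior_Icc] at ht
        rw [(f_deriv t (by linarith [ht.1])).deriv]
        have := hm t ht.1 ht.2
        positivity
    have ha : s - 1 ∈ Icc (s - 1) s := ⟨le_rfl, by linarith⟩
    have hb : s ∈ Icc (s - 1) s := ⟨by linarith, le_rfl⟩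
    have h1 := hF ha hb (by linarith)
    have h2 := hf ha hb (by linarith)
    simp only at h1 h2
    have hw := sw_pos s (by linarith)
    unfold sw at hw
    have hs0 : 0 < s := by linarith
    have e1 : s * (sP s / s) = sP s := by field_simp
    have e2 : s * (sp s / s) = sp s := by field_simp
    rw [lt_min_iff]
    constructor
    · unfold Rp; rw [max_eq_left hs]
      have := mul_le_mul_of_nonneg_left h2 hs0.le
      linarith
    · unfold Rm
      have := mul_le_mul_of_nonneg_left h1 hs0.le
      linarith

lemma Rp_pos (s : ℝ) : 0 < Rp s := by
  rcases le_total s 3 with h | h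
  · rw [Rp_one s h]; norm_num
  · exact (lt_min_iff.1 (R_pos_aux s h)).1

lemma Rm_pos (s : ℝ) (hs : 1 < s) : 0 < Rm s := by
  rcases le_total s 3 with h | h
  · exact Rm_pos_small s hs h
  · exact (lt_min_iff.1 (R_pos_aux s h)).2
end

section
open Real Set

lemma anti_of_deriv {f f' : ℝ → ℝ} {s : Set ℝ} (hs : Convex ℝ s) (h : ∀ x ∈ s, HasDerivAt f (f' x) x)
    (h0 : ∀ x ∈ s, f' x ≤ 0) : AntitoneOn f s := by
  apply antitoneOn_of_deriv_nonpos hs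
  · intro x hx; exact (h x hx).continuousAt.continuousWithinAt
  · intro x hx; exact (h x (interior_subset hx)).differentiableAt.differentiableWithinAt
  · intro x hx; rw [(h x (interior_subset hx)).deriv]; exact h0 x (interior_subset hx)

lemma F_anti : AntitoneOn (fun s => sP s / s) (Ioi 0) := by
  apply anti_of_deriv (convex_Ioi 0) (fun x hx => F_deriv x hx)
  intro x hx
  have := Rp_pos x
  simp only [mem_Ioi] at hx
  have : 0 < Rp x / x ^ 2 := by positivity
  linarith

lemma f_mono : MonotoneOn (fun s => sp s / s) (Ioi 1) := by
  have : AntitoneOn (fun s => -(sp s / s)) (Ioi 1) := by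
    apply anti_of_deriv (convex_Ioi 1) (fun x hx => (f_deriv x hx).neg)
    intro x hx
    have := Rm_pos x hx
    simp only [mem_Ioi] at hx
    have : 0 < Rm x / x ^ 2 := by positivity
    linarith
  intro a ha b hb hab
  have := this ha hb hab
  simpa using this

lemma f_le_F (s t : ℝ) (hs : 1 < s) (ht : 0 < t) : sp s / s ≤ sP t / t := by
  have hm : 1 < max s t := lt_of_lt_of_le hs (le_max_left _ _)
  have h1 := f_mono hs hm (le_max_left s t)
  have h2 := F_anti ht (show max s t ∈ Ioi 0 from by simp only [mem_Ioi]; linarith) (le_max_right s t)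
  have h3 := sw_pos _ hm
  unfold sw at h3
  simp only at h1 h2
  have h4 : sp (max s t) / max s t ≤ sP (max s t) / max s t := by gcongr; linarith
  linarith

noncomputable def sL : ℝ := sSup ((fun s => sp s / s) '' Ioi 1)

lemma f_le_sL (s : ℝ) (hs : 1 < s) : sp s / s ≤ sL := by
  apply le_csSup
  · refine ⟨sP 1 / 1, ?_⟩
    rintro _ ⟨t, ht, rfl⟩
    exact f_le_F t 1 ht one_pos
  · exact ⟨s, hs, rfl⟩

lemma sL_le_F (t : ℝ) (ht : 0 < t) : sL ≤ sP t / t := by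
  apply csSup_le
  · exact ⟨_, 2, by simp, rfl⟩
  · rintro _ ⟨s, hs, rfl⟩
    exact f_le_F s t hs ht

lemma sL_pos : 0 < sL := by
  refine lt_of_lt_of_le ?_ (f_le_sL 3 (by norm_num))
  rw [sp_log 3 (by norm_num)]
  have : 0 < Real.log (3 - 1) := Real.log_pos (by norm_num)
  positivity

noncomputable def alp (s : ℝ) : ℝ := sP s - sL * s
noncomputable def alm (s : ℝ) : ℝ := sL * s - sp s

lemma alp_nonneg (s : ℝ) (hs : 0 < s) : 0 ≤ alp s := by
  have := sL_le_F s hs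
  rw [le_div_iff₀ hs] at this
  unfold alp; linarith

lemma alm_nonneg (s : ℝ) (hs : 1 < s) : 0 ≤ alm s := by
  have := f_le_sL s hs
  rw [div_le_iff₀ (by linarith)] at this
  unfold alm; linarith

lemma alp_deriv (s : ℝ) : HasDerivAt alp (-(alm (max s 3 - 1) / (max s 3 - 1))) s := by
  have h := (sP_deriv s).sub ((hasDerivAt_id s).const_mul sL)
  refine h.congr_deriv ?_
  unfold alm
  have : max s 3 - 1 ≠ 0 := by have := le_max_right s 3; linarith
  field_simp; ring

lemma alm_deriv (s : ℝ) (hs : 1 < s) : HasDerivAt alm (-(alp (s - 1) / (s - 1))) s := by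
  have h := ((hasDerivAt_id s).const_mul sL).sub (sp_deriv s hs)
  refine h.congr_deriv ?_
  unfold alp
  have : s - 1 ≠ 0 := by linarith
  field_simp; ring

lemma alp_anti : AntitoneOn alp (Ioi 0) := by
  apply anti_of_deriv (convex_Ioi 0) (fun x _ => alp_deriv x)
  intro x _
  have h := le_max_right x 3
  have := alm_nonneg (max x 3 - 1) (by linarith)
  have : 0 ≤ alm (max x 3 - 1) / (max x 3 - 1) := div_nonneg this (by linarith)
  linarith

lemma alm_anti : AntitoneOn alm (Ioi 1) := by
  apply anti_of_deriv (convex_Ioi 1) (fun x hx => alm_deriv x hx)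
  intro x hx
  simp only [mem_Ioi] at hx
  have := alp_nonneg (x - 1) (by linarith)
  have : 0 ≤ alp (x - 1) / (x - 1) := div_nonneg this (by linarith)
  linarith

lemma Rp_alp (s : ℝ) : alp s + s * (alm (max s 3 - 1) / (max s 3 - 1)) = Rp s := by
  unfold alp alm Rp
  have : max s 3 - 1 ≠ 0 := by have := le_max_right s 3; linarith
  field_simp; ring

lemma Rm_alm (s : ℝ) (hs : 1 < s) : alm s + s * (alp (s - 1) / (s - 1)) = Rm s := by
  unfold alp alm Rm
  have : s - 1 ≠ 0 := by linarith
  field_simp; ring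

lemma Rm_anti : AntitoneOn Rm (Ioi 1) := by
  apply anti_of_deriv (convex_Ioi 1) (fun x hx => Rm_deriv x hx)
  intro x hx
  simp only [mem_Ioi] at hx
  have := Rp_pos (x - 1)
  have h2 : 0 < x - 1 := by linarith
  have : 0 < x * (Rp (x - 1) / (x - 1) ^ 2) := by positivity
  linarith

lemma Rp_anti3 : AntitoneOn Rp (Ici 3) := by
  apply antitoneOn_of_deriv_nonpos (convex_Ici 3) Rp_cont.continuousOn
  · intro x hx; rw [interior_Ici] at hx; exact (Rp_deriv x hx).differentiableAt.differentiableWithinAt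
  · intro x hx; rw [interior_Ici] at hx; rw [(Rp_deriv x hx).deriv]
    simp only [mem_Ioi] at hx
    have := Rm_pos (x - 1) (by linarith)
    have h2 : 0 < x - 1 := by linarith
    have : 0 < x * (Rm (x - 1) / (x - 1) ^ 2) := by positivity
    linarith

lemma Rp_anti : Antitone Rp := by
  intro s t hst
  rcases le_total t 3 with h | h
  · rw [Rp_one t h, Rp_one s (hst.trans h)]
  · rcases le_total s 3 with h' | h'
    · rw [Rp_one s h', ← Rp_one 3 le_rfl]
      exact Rp_anti3 self_mem_Ici h h
    · exact Rp_anti3 h' h hst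

lemma R_sum (s : ℝ) (hs : 3 ≤ s) : Rp s + Rm s = sw s + s * (sw (s - 1) / (s - 1)) := by
  unfold Rp Rm sw; rw [max_eq_left hs]; ring

lemma R_decay : ∃ K : ℝ, 0 < K ∧ (∀ s, 0 < s → Rp s ≤ K / s ^ 6) ∧ ∀ s, 3 / 2 ≤ s → Rm s ≤ K / s ^ 6 := by
  have hbig : ∀ s, 3 ≤ s → Rp s + Rm s ≤ (5 ^ 6 + 2 * 5 ^ 6 * 2 ^ 6) / s ^ 6 := by
    intro s hs
    rw [R_sum s hs, add_div]
    apply add_le_add (sw_decay s (by linarith))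
    have h1 := sw_decay (s - 1) (by linarith)
    have h2 := sw_pos (s - 1) (by linarith)
    have h3 : s / (s - 1) ≤ 2 := by rw [div_le_iff₀ (by linarith)]; linarith
    calc s * (sw (s - 1) / (s - 1)) = (s / (s - 1)) * sw (s - 1) := by ring
      _ ≤ 2 * (5 ^ 6 / (s - 1) ^ 6) := by gcongr
      _ ≤ 2 * (5 ^ 6 / (s / 2) ^ 6) := by gcongr; linarith
      _ = _ := by rw [div_pow]; field_simp
  refine ⟨5 ^ 6 + 2 * 5 ^ 6 * 2 ^ 6, by norm_num, ?_, ?_⟩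
  · intro s hs
    rcases le_total s 3 with h | h
    · rw [Rp_one s h, le_div_iff₀ (by positivity), one_mul]
      calc s ^ 6 ≤ 3 ^ 6 := by gcongr
        _ ≤ _ := by norm_num
    · have := hbig s h
      have := Rm_pos s (by linarith)
      linarith
  · intro s hs
    rcases le_total s 3 with h | h
    · have h1 := Rm_anti (show (3 / 2 : ℝ) ∈ Ioi 1 from by norm_num) (show s ∈ Ioi 1 from by simp only [mem_Ioi]; linarith) hs
      rw [Rm_small (3 / 2) (by norm_num)] at h1
      have h2 : Real.log (3 / 2 - 1) = -Real.log 2 := by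
        rw [show (3 / 2 - 1 : ℝ) = 2⁻¹ by norm_num, Real.log_inv]
      rw [h2] at h1
      have := log_two_lt
      have h3 : Rm s ≤ 4 := by norm_num at h1 ⊢; linarith
      refine h3.trans ?_
      rw [le_div_iff₀ (by positivity)]
      calc 4 * s ^ 6 ≤ 4 * 3 ^ 6 := by gcongr
        _ ≤ _ := by norm_num
    · have := hbig s h
      have := Rp_pos s
      linarith

lemma lip_of_deriv {f f' : ℝ → ℝ} {a b K : ℝ} (hab : a ≤ b) (hc : ContinuousOn f (Icc a b))
    (hd : ∀ x ∈ Ioo a b, HasDerivAt f (f' x) x) (hK : ∀ x ∈ Ioo a b, -K ≤ f' x) :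
    f a - f b ≤ K * (b - a) := by
  rcases hab.eq_or_lt with h | h
  · subst h; simp
  · obtain ⟨c, hc1, hc2⟩ := exists_hasDerivAt_eq_slope f f' h hc hd
    have := hK c hc1
    rw [hc2, le_div_iff₀ (by linarith)] at this
    linarith

lemma R_lip : ∃ K : ℝ, 0 < K ∧ (∀ s t, 0 < s → s ≤ t → Rp s - Rp t ≤ K / s ^ 4 * (t - s)) ∧
    ∀ s t, 3 / 2 ≤ s → s ≤ t → Rm s - Rm t ≤ K / s ^ 4 * (t - s) := by
  obtain ⟨K, hK, hp, hm⟩ := R_decay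
  have key : ∀ x s : ℝ, 0 < s → s ≤ x → 3 / 2 ≤ x → x * (K / (x - 1) ^ 6 / (x - 1) ^ 2) ≤ 3 ^ 8 * K / s ^ 4 := by
    intro x s hs hsx hx
    have h1 : x / 3 ≤ x - 1 := by linarith
    calc x * (K / (x - 1) ^ 6 / (x - 1) ^ 2) ≤ x * (K / (x / 3) ^ 6 / (x / 3) ^ 2) := by
          have : 0 < x / 3 := by linarith
          gcongr
      _ = 3 ^ 8 * K / (x ^ 4 * x ^ 3) := by field_simp
      _ ≤ 3 ^ 8 * K / (s ^ 4 * 1) := by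
          have : 1 ≤ x ^ 3 := one_le_pow₀ (by linarith)
          gcongr
      _ = _ := by rw [mul_one]
  have hp3 : ∀ s t a, 0 < a → a ≤ s → 3 ≤ s → s ≤ t → Rp s - Rp t ≤ 3 ^ 8 * K / a ^ 4 * (t - s) := by
    intro s t a ha has h3 hst
    apply lip_of_deriv hst Rp_cont.continuousOn (fun x hx => Rp_deriv x (by linarith [hx.1]))
    intro x hx
    have h1 := hm (x - 1) (by linarith [hx.1])
    have h2 : 0 < x - 1 := by linarith [hx.1]
    have h4 : 0 < x := by linarith
    have : x * (Rm (x - 1) / (x - 1) ^ 2) ≤ x * (K / (x - 1) ^ 6 / (x - 1) ^ 2) := by gcongr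
    have := key x a ha (by linarith [hx.1]) (by linarith [hx.1])
    linarith
  refine ⟨3 ^ 8 * K, by positivity, ?_, ?_⟩
  · intro s t hs hst
    rcases le_total t 3 with h | h
    · rw [Rp_one t h, Rp_one s (hst.trans h), sub_self]
      apply mul_nonneg (by positivity) (by linarith)
    · rcases le_total s 3 with h' | h'
      · rw [Rp_one s h', ← Rp_one 3 le_rfl]
        refine (hp3 3 t s hs h' le_rfl h).trans ?_
        gcongr
      · exact hp3 s t s hs le_rfl h' hst
  · intro s t hs hst
    apply lip_of_deriv hst (fun x hx => (Rm_deriv x (by linarith [hx.1])).continuousAt.continuousWithinAt)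
      (fun x hx => Rm_deriv x (by linarith [hx.1]))
    intro x hx
    have h2 : 0 < x - 1 := by linarith [hx.1]
    have h1 := hp (x - 1) h2
    have h4 : 0 < x := by linarith
    have : x * (Rp (x - 1) / (x - 1) ^ 2) ≤ x * (K / (x - 1) ^ 6 / (x - 1) ^ 2) := by gcongr
    have := key x s (by linarith) (by linarith [hx.1]) (by linarith [hx.1])
    linarith
end

section
open Real Set

noncomputable def cap (x u : ℝ) : ℝ := alp (x / u) / x
noncomputable def cam (x u : ℝ) : ℝ := alm (x / u) / x
noncomputable def crp (x u : ℝ) : ℝ := Rp (x / u) / x ^ 2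
noncomputable def crm (x u : ℝ) : ℝ := Rm (x / u) / x ^ 2

lemma cap_nonneg {x u : ℝ} (hu : 0 < u) (hx : 0 < x) : 0 ≤ cap x u :=
  div_nonneg (alp_nonneg _ (div_pos hx hu)) hx.le
lemma cam_nonneg {x u : ℝ} (hu : 0 < u) (hx : u < x) : 0 ≤ cam x u :=
  div_nonneg (alm_nonneg _ ((one_lt_div hu).2 hx)) (hu.trans hx).le
lemma crp_pos {x u : ℝ} (hx : 0 < x) : 0 < crp x u :=
  div_pos (Rp_pos _) (by positivity)
lemma crm_pos {x u : ℝ} (hu : 0 < u) (hx : u < x) : 0 < crm x u :=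
  div_pos (Rm_pos _ ((one_lt_div hu).2 hx)) (by have := hu.trans hx; positivity)

lemma cap_deriv_x {x u : ℝ} (hu : 0 < u) (hx : 0 < x) : HasDerivAt (fun x => cap x u) (-crp x u) x := by
  have h1 : HasDerivAt (fun x : ℝ => x / u) (1 / u) x := (hasDerivAt_id x).div_const u
  have h2 : HasDerivAt (fun x => alp (x / u)) _ x := HasDerivAt.comp (h₂ := alp) x (alp_deriv (x / u)) h1
  have h3 := h2.div (hasDerivAt_id x) hx.ne'
  refine h3.congr_deriv ?_
  unfold crp; rw [← Rp_alp]; simp only [id]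
  have : max (x / u) 3 - 1 ≠ 0 := by have := le_max_right (x / u) 3; linarith
  field_simp; ring

lemma cam_deriv_x {x u : ℝ} (hu : 0 < u) (hx : u < x) : HasDerivAt (fun x => cam x u) (-crm x u) x := by
  have hs := (one_lt_div hu).2 hx
  have h1 : HasDerivAt (fun x : ℝ => x / u) (1 / u) x := (hasDerivAt_id x).div_const u
  have h2 : HasDerivAt (fun x => alm (x / u)) _ x := HasDerivAt.comp (h₂ := alm) x (alm_deriv (x / u) hs) h1
  have hx0 : 0 < x := by linarith
  have h3 := h2.div (hasDerivAt_id x) hx0.ne'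
  refine h3.congr_deriv ?_
  unfold crm; rw [← Rm_alm _ hs]; simp only [id]
  have : x / u - 1 ≠ 0 := by linarith
  have : x - u ≠ 0 := by linarith
  field_simp; ring

lemma inv_deriv (x v : ℝ) (hv : 0 < v) : HasDerivAt (fun v : ℝ => x / v) (-(x / v ^ 2)) v := by
  have := (hasDerivAt_const v x).div (hasDerivAt_id v) hv.ne'
  refine this.congr_deriv ?_
  simp only [id]; ring

lemma div_sub_one' {x v : ℝ} (hv : 0 < v) : x / v - 1 = (x - v) / v := by field_simp

lemma cap_deriv_u {x v : ℝ} (hv : 0 < v) (hx : 3 * v ≤ x) : HasDerivAt (fun v => cap x v) (cam (x - v) v / v) v := by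
  have hs : 3 ≤ x / v := by rwa [le_div_iff₀ hv]
  have h2 : HasDerivAt (fun v => alp (x / v)) _ v := HasDerivAt.comp (h₂ := alp) v (alp_deriv (x / v)) (inv_deriv x v hv)
  have h3 := h2.div_const x
  refine h3.congr_deriv ?_
  rw [max_eq_left hs]
  unfold cam; rw [div_sub_one' hv]
  have : x - v ≠ 0 := by linarith
  have : x ≠ 0 := by linarith
  field_simp

lemma cam_deriv_u {x v : ℝ} (hv : 0 < v) (hx : v < x) : HasDerivAt (fun v => cam x v) (cap (x - v) v / v) v := by
  have hs := (one_lt_div hv).2 hx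
  have h2 : HasDerivAt (fun v => alm (x / v)) _ v := HasDerivAt.comp (h₂ := alm) v (alm_deriv (x / v) hs) (inv_deriv x v hv)
  have h3 := h2.div_const x
  refine h3.congr_deriv ?_
  unfold cap; rw [div_sub_one' hv]
  have : x - v ≠ 0 := by linarith
  have : x ≠ 0 := by linarith
  field_simp

lemma crp_deriv_u {x v : ℝ} (hv : 0 < v) (hx : 3 * v < x) : HasDerivAt (fun v => crp x v) (crm (x - v) v / v) v := by
  have hs : 3 < x / v := by rwa [lt_div_iff₀ hv]
  have h2 : HasDerivAt (fun v => Rp (x / v)) _ v := HasDerivAt.comp (h₂ := Rp) v (Rp_deriv (x / v) hs) (inv_deriv x v hv)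
  have h3 := h2.div_const (x ^ 2)
  refine h3.congr_deriv ?_
  unfold crm; rw [div_sub_one' hv]
  have : x - v ≠ 0 := by linarith
  have : x ≠ 0 := by linarith
  field_simp

lemma crm_deriv_u {x v : ℝ} (hv : 0 < v) (hx : v < x) : HasDerivAt (fun v => crm x v) (crp (x - v) v / v) v := by
  have hs := (one_lt_div hv).2 hx
  have h2 : HasDerivAt (fun v => Rm (x / v)) _ v := HasDerivAt.comp (h₂ := Rm) v (Rm_deriv (x / v) hs) (inv_deriv x v hv)
  have h3 := h2.div_const (x ^ 2)
  refine h3.congr_deriv ?_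
  unfold crp; rw [div_sub_one' hv]
  have : x - v ≠ 0 := by linarith
  have : x ≠ 0 := by linarith
  field_simp

lemma crp_cont_u {x v : ℝ} (hv : 0 < v) : ContinuousAt (fun v => crp x v) v := by
  have : ContinuousAt (fun v => Rp (x / v)) v :=
    ContinuousAt.comp (f := fun v => x / v) Rp_cont.continuousAt (inv_deriv x v hv).continuousAt
  exact this.div_const _

lemma mvt_step {Θ g : ℝ → ℝ} {v1 v2 : ℝ} (h1 : 0 < v1) (h12 : v1 ≤ v2) (hc : ContinuousOn Θ (Icc v1 v2))
    (hd : ∀ v ∈ Ioo v1 v2, HasDerivAt Θ (g v / v) v) (hg0 : 0 ≤ g v1) (hg : ∀ v ∈ Ioo v1 v2, g v1 ≤ g v) :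
    g v1 * ((v2 - v1) / v2) ≤ Θ v2 - Θ v1 := by
  rcases h12.eq_or_lt with h | h
  · subst h; simp
  · obtain ⟨c, hc1, hc2⟩ := exists_hasDerivAt_eq_slope Θ (fun v => g v / v) h hc hd
    have hpos : 0 < v2 - v1 := by linarith
    have hc0 : 0 < c := by linarith [hc1.1]
    have h2 : g v1 / v2 ≤ g c / c := div_le_div₀ (hg0.trans (hg c hc1)) (hg c hc1) hc0 hc1.2.le
    rw [hc2, le_div_iff₀ hpos] at h2
    calc g v1 * ((v2 - v1) / v2) = g v1 / v2 * (v2 - v1) := by ring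
      _ ≤ _ := h2

lemma ratio_anti {x v w : ℝ} (hv : 0 < v) (hvw : v ≤ w) (hx : w < x) : (x - w) / w ≤ (x - v) / v := by
  rw [← div_sub_one' hv, ← div_sub_one' (hv.trans_le hvw)]
  have : x / w ≤ x / v := by gcongr; linarith
  linarith

lemma cap_g_mono {x v w : ℝ} (hv : 0 < v) (hvw : v ≤ w) (hx : w < x) : cap (x - v) v ≤ cap (x - w) w := by
  unfold cap
  have hw : 0 < w := by linarith
  have h0 : 0 < (x - w) / w := div_pos (by linarith) hw
  have h1 := ratio_anti hv hvw hx
  have h2 := alp_anti (show (x - w) / w ∈ Ioi 0 from h0) (show (x - v) / v ∈ Ioi 0 from h0.trans_le h1) h1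
  exact div_le_div₀ (alp_nonneg _ h0) h2 (by linarith) (by linarith)

lemma cam_g_mono {x v w : ℝ} (hv : 0 < v) (hvw : v ≤ w) (hx : 2 * w < x) : cam (x - v) v ≤ cam (x - w) w := by
  unfold cam
  have hw : 0 < w := by linarith
  have h0 : 1 < (x - w) / w := by rw [lt_div_iff₀ hw]; linarith
  have h1 := ratio_anti hv hvw (by linarith : w < x)
  have h2 := alm_anti (show (x - w) / w ∈ Ioi 1 from h0) (show (x - v) / v ∈ Ioi 1 from h0.trans_le h1) h1
  exact div_le_div₀ (alm_nonneg _ h0) h2 (by linarith) (by linarith)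

lemma crp_g_mono {x v w : ℝ} (hv : 0 < v) (hvw : v ≤ w) (hx : w < x) : crp (x - v) v ≤ crp (x - w) w := by
  unfold crp
  have h1 := ratio_anti hv hvw hx
  have h3 : 0 < x - w := by linarith
  exact div_le_div₀ (Rp_pos _).le (Rp_anti h1) (by positivity) (by gcongr)

lemma crm_g_mono {x v w : ℝ} (hv : 0 < v) (hvw : v ≤ w) (hx : 2 * w < x) : crm (x - v) v ≤ crm (x - w) w := by
  unfold crm
  have hw : 0 < w := by linarith
  have h0 : 1 < (x - w) / w := by rw [lt_div_iff₀ hw]; linarith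
  have h1 := ratio_anti hv hvw (by linarith : w < x)
  have h2 := Rm_anti (show (x - w) / w ∈ Ioi 1 from h0) (show (x - v) / v ∈ Ioi 1 from h0.trans_le h1) h1
  have h3 : 0 < x - w := by linarith
  exact div_le_div₀ (Rm_pos _ h0).le h2 (by positivity) (by gcongr)

lemma cam_step {x v1 v2 : ℝ} (h1 : 0 < v1) (h12 : v1 ≤ v2) (hx : v2 < x) :
    cap (x - v1) v1 * ((v2 - v1) / v2) ≤ cam x v2 - cam x v1 :=
  mvt_step (Θ := fun v => cam x v) (g := fun v => cap (x - v) v) h1 h12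
    (fun v hv => (cam_deriv_u (by linarith [hv.1]) (by linarith [hv.2])).continuousAt.continuousWithinAt)
    (fun v hv => cam_deriv_u (by linarith [hv.1]) (by linarith [hv.2]))
    (cap_nonneg h1 (by linarith)) (fun v hv => cap_g_mono h1 hv.1.le (by linarith [hv.2]))

lemma cap_step {x v1 v2 : ℝ} (h1 : 0 < v1) (h12 : v1 ≤ v2) (hx : 3 * v2 ≤ x) :
    cam (x - v1) v1 * ((v2 - v1) / v2) ≤ cap x v2 - cap x v1 :=
  mvt_step (Θ := fun v => cap x v) (g := fun v => cam (x - v) v) h1 h12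
    (fun v hv => (cap_deriv_u (by linarith [hv.1]) (by linarith [hv.2])).continuousAt.continuousWithinAt)
    (fun v hv => cap_deriv_u (by linarith [hv.1]) (by linarith [hv.2]))
    (cam_nonneg h1 (by linarith)) (fun v hv => cam_g_mono h1 hv.1.le (by linarith [hv.1, hv.2]))

lemma crm_step {x v1 v2 : ℝ} (h1 : 0 < v1) (h12 : v1 ≤ v2) (hx : v2 < x) :
    crp (x - v1) v1 * ((v2 - v1) / v2) ≤ crm x v2 - crm x v1 :=
  mvt_step (Θ := fun v => crm x v) (g := fun v => crp (x - v) v) h1 h12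
    (fun v hv => (crm_deriv_u (by linarith [hv.1]) (by linarith [hv.2])).continuousAt.continuousWithinAt)
    (fun v hv => crm_deriv_u (by linarith [hv.1]) (by linarith [hv.2]))
    (crp_pos (by linarith)).le (fun v hv => crp_g_mono h1 hv.1.le (by linarith [hv.2]))

lemma crp_step {x v1 v2 : ℝ} (h1 : 0 < v1) (h12 : v1 ≤ v2) (hx : 3 * v2 ≤ x) :
    crm (x - v1) v1 * ((v2 - v1) / v2) ≤ crp x v2 - crp x v1 :=
  mvt_step (Θ := fun v => crp x v) (g := fun v => crm (x - v) v) h1 h12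
    (fun v hv => (crp_cont_u (by linarith [hv.1])).continuousWithinAt)
    (fun v hv => crp_deriv_u (by linarith [hv.1]) (by linarith [hv.2]))
    (crm_pos h1 (by linarith)).le (fun v hv => crm_g_mono h1 hv.1.le (by linarith [hv.1, hv.2]))

lemma r_shift_gen (R : ℝ → ℝ) (s0 K : ℝ) (hs0 : 0 < s0)
    (hanti : ∀ s t, s0 ≤ s → s ≤ t → R t ≤ R s)
    (hdec : ∀ s, s0 ≤ s → R s ≤ K / s ^ 3)
    (hlip : ∀ s t, s0 ≤ s → s ≤ t → R s - R t ≤ K / s ^ 4 * (t - s))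
    {u y' y : ℝ} (hu : 0 < u) (hy' : s0 * u ≤ y') (hyy : y' ≤ y) :
    R (y' / u) / y' ^ 2 ≤ R (y / u) / y ^ 2 + 3 * K * (y - y') * u ^ 3 / y' ^ 6 := by
  have hy0 : 0 < y' := lt_of_lt_of_le (by positivity) hy'
  have hy1 : 0 < y := by linarith
  have hs : s0 ≤ y' / u := by rwa [le_div_iff₀ hu]
  have hst : y' / u ≤ y / u := by gcongr
  have h1 := hlip _ _ hs hst
  have h2 := hanti _ _ hs hst
  have h3 := hdec _ hs
  have e1 : 1 / y' ^ 2 - 1 / y ^ 2 = (y - y') * (y + y') / (y ^ 2 * y' ^ 2) := by field_simp; ring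
  have h4 : 1 / y' ^ 2 - 1 / y ^ 2 ≤ 2 * (y - y') / y' ^ 3 := by
    rw [e1, div_le_div_iff₀ (by positivity) (by positivity)]
    have h5 : (y + y') * y' ≤ 2 * y ^ 2 := by nlinarith
    have h6 : 0 ≤ (y - y') * y' ^ 2 := mul_nonneg (by linarith) (by positivity)
    nlinarith [mul_le_mul_of_nonneg_left h5 h6]
  have h0 : 0 ≤ 1 / y' ^ 2 - 1 / y ^ 2 := by
    rw [sub_nonneg]; gcongr
  have h7 : R (y / u) * (1 / y' ^ 2 - 1 / y ^ 2) ≤ K / (y' / u) ^ 3 * (2 * (y - y') / y' ^ 3) := by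
    calc R (y / u) * (1 / y' ^ 2 - 1 / y ^ 2) ≤ K / (y' / u) ^ 3 * (1 / y' ^ 2 - 1 / y ^ 2) := by
          apply mul_le_mul_of_nonneg_right _ h0; linarith
      _ ≤ _ := by
          apply mul_le_mul_of_nonneg_left h4
          have : 0 ≤ K := by
            by_contra hc
            push Not at hc
            have hq := hdec 1
            have h9 := hlip (y' / u) (y' / u + 1) hs (by linarith)
            have h10 := hanti (y' / u) (y' / u + 1) hs (by linarith)
            have h11 : K / (y' / u) ^ 4 < 0 := div_neg_of_neg_of_pos hc (by positivity)
            simp at h9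
            linarith
          positivity
  have e2 : R (y' / u) / y' ^ 2 - R (y / u) / y ^ 2 = (R (y' / u) - R (y / u)) * (1 / y' ^ 2) +
      R (y / u) * (1 / y' ^ 2 - 1 / y ^ 2) := by ring
  have h8 : (R (y' / u) - R (y / u)) * (1 / y' ^ 2) ≤ K / (y' / u) ^ 4 * (y / u - y' / u) * (1 / y' ^ 2) := by
    gcongr
  have e3 : K / (y' / u) ^ 4 * (y / u - y' / u) * (1 / y' ^ 2) = K * (y - y') * u ^ 3 / y' ^ 6 := by
    field_simp
  have e4 : K / (y' / u) ^ 3 * (2 * (y - y') / y' ^ 3) = 2 * K * (y - y') * u ^ 3 / y' ^ 6 := by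
    field_simp
  have e5 : 3 * K * (y - y') * u ^ 3 / y' ^ 6 = K * (y - y') * u ^ 3 / y' ^ 6 + 2 * K * (y - y') * u ^ 3 / y' ^ 6 := by ring
  rw [e5, ← e3, ← e4]
  linarith

lemma a_shift_gen (a r : ℝ → ℝ) (m B : ℝ)
    (hd : ∀ y, m ≤ y → HasDerivAt a (-r y) y)
    (hanti : ∀ y' y, m ≤ y' → y' ≤ y → r y ≤ r y')
    (hr : ∀ y' y, m ≤ y' → y' ≤ y → r y' ≤ r y + B * (y - y'))
    {y y' : ℝ} (hy : m ≤ y) (hy' : m ≤ y') :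
    a y' ≤ a y + (y - y') * r y + B * (y - y') ^ 2 := by
  rcases lt_trichotomy y' y with h | h | h
  · obtain ⟨c, hc1, hc2⟩ := exists_hasDerivAt_eq_slope a (fun y => -r y) h
      (fun t ht => (hd t (by linarith [ht.1])).continuousAt.continuousWithinAt) (fun t ht => hd t (by linarith [ht.1]))
    have hpos : 0 < y - y' := by linarith
    rw [eq_div_iff hpos.ne'] at hc2
    have h1 := hanti y' c hy' hc1.1.le
    have h2 := hr y' y hy' h.le
    have h3 := mul_le_mul_of_nonneg_left (h1.trans h2) hpos.le
    nlinarith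
  · subst h; simp
  · obtain ⟨c, hc1, hc2⟩ := exists_hasDerivAt_eq_slope a (fun y => -r y) h
      (fun t ht => (hd t (by linarith [ht.1])).continuousAt.continuousWithinAt) (fun t ht => hd t (by linarith [ht.1]))
    have hpos : 0 < y' - y := by linarith
    rw [eq_div_iff hpos.ne'] at hc2
    have h1 := hanti c y' (by linarith [hc1.1]) hc1.2.le
    have h2 := hr y y' hy h.le
    have h3 : r y - B * (y' - y) ≤ r c := by linarith
    have h4 := mul_le_mul_of_nonneg_left h3 hpos.le
    nlinarith

/-- shift estimates for both signs -/
lemma shifts : ∃ K : ℝ, 0 < K ∧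
    (∀ u y' y, 0 < u → 0 < y' → y' ≤ y → crp y' u ≤ crp y u + K * (y - y') * u ^ 3 / y' ^ 6) ∧
    (∀ u y' y, 0 < u → 3 / 2 * u ≤ y' → y' ≤ y → crm y' u ≤ crm y u + K * (y - y') * u ^ 3 / y' ^ 6) ∧
    (∀ u m y' y, 0 < u → 0 < m → m ≤ y' → m ≤ y →
      cap y' u ≤ cap y u + (y - y') * crp y u + K * (y - y') ^ 2 * u ^ 3 / m ^ 6) ∧
    (∀ u m y' y, 0 < u → 3 / 2 * u ≤ m → m ≤ y' → m ≤ y →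
      cam y' u ≤ cam y u + (y - y') * crm y u + K * (y - y') ^ 2 * u ^ 3 / m ^ 6) := by
  obtain ⟨K1, hK1, d1, d2⟩ := R_decay
  obtain ⟨K2, hK2, l1, l2⟩ := R_lip
  -- work with K = max of things on s ≥ s0, using decay weakened to s^-3
  have hp : ∀ u y' y, 0 < u → 0 < y' → y' ≤ y → crp y' u ≤ crp y u + 3 * (K1 + K2 + 27) * (y - y') * u ^ 3 / y' ^ 6 := by
    intro u y' y hu hy' hyy
    have hs0 : 0 < y' / u := by positivity
    apply r_shift_gen Rp (y' / u) (K1 + K2 + 27) hs0 (fun s t _ h => Rp_anti h) _ _ hu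
      (by rw [div_mul_cancel₀ _ hu.ne']) hyy
    · intro s hs
      have hsp : 0 < s := by linarith
      rcases le_total s 3 with h | h
      · rw [Rp_one s h, le_div_iff₀ (by positivity), one_mul]
        have : s ^ 3 ≤ 3 ^ 3 := by gcongr
        linarith
      · refine (d1 s hsp).trans ?_
        have : s ^ 3 ≤ s ^ 6 := pow_le_pow_right₀ (by linarith) (by norm_num)
        calc K1 / s ^ 6 ≤ K1 / s ^ 3 := by gcongr
          _ ≤ _ := by gcongr; linarith
    · intro s t hs hst
      have hsp : 0 < s := by linarith
      refine (l1 s t hsp hst).trans ?_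
      have : 0 ≤ t - s := by linarith
      gcongr; linarith
  have hm : ∀ u y' y, 0 < u → 3 / 2 * u ≤ y' → y' ≤ y → crm y' u ≤ crm y u + 3 * (K1 + K2 + 27) * (y - y') * u ^ 3 / y' ^ 6 := by
    intro u y' y hu hy' hyy
    apply r_shift_gen Rm (3 / 2) (K1 + K2 + 27) (by norm_num) _ _ _ hu hy' hyy
    · intro s t hs hst
      exact Rm_anti (show s ∈ Ioi 1 from by simp only [mem_Ioi]; linarith) (show t ∈ Ioi 1 from by simp only [mem_Ioi]; linarith) hst
    · intro s hs
      refine (d2 s hs).trans ?_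
      have : s ^ 3 ≤ s ^ 6 := pow_le_pow_right₀ (by linarith) (by norm_num)
      calc K1 / s ^ 6 ≤ K1 / s ^ 3 := by gcongr
        _ ≤ _ := by gcongr; linarith
    · intro s t hs hst
      refine (l2 s t hs hst).trans ?_
      have : 0 ≤ t - s := by linarith
      gcongr; linarith
  refine ⟨3 * (K1 + K2 + 27), by positivity, hp, hm, ?_, ?_⟩
  · intro u m y' y hu hm0 hy' hy
    have := a_shift_gen (fun y => cap y u) (fun y => crp y u) m (3 * (K1 + K2 + 27) * u ^ 3 / m ^ 6)
      (fun y hy => cap_deriv_x hu (by linarith)) (by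
        intro y' y h1 h2
        have h3 : 0 < y' := by linarith
        exact div_le_div₀ (Rp_pos _).le (Rp_anti (by gcongr)) (by positivity) (by gcongr)) (by
        intro y' y h1 h2
        refine (hp u y' y hu (by linarith) h2).trans ?_
        have h3 : 0 ≤ y - y' := by linarith
        have : 3 * (K1 + K2 + 27) * (y - y') * u ^ 3 / y' ^ 6 ≤ 3 * (K1 + K2 + 27) * (y - y') * u ^ 3 / m ^ 6 := by gcongr
        have e : 3 * (K1 + K2 + 27) * u ^ 3 / m ^ 6 * (y - y') = 3 * (K1 + K2 + 27) * (y - y') * u ^ 3 / m ^ 6 := by ring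
        rw [e]; linarith) hy hy'
    refine this.trans (le_of_eq ?_); ring
  · intro u m y' y hu hm0 hy' hy
    have hmp : 0 < m := by linarith
    have := a_shift_gen (fun y => cam y u) (fun y => crm y u) m (3 * (K1 + K2 + 27) * u ^ 3 / m ^ 6)
      (fun y hy => cam_deriv_x hu (by linarith)) (by
        intro y' y h1 h2
        have h3 : 0 < y' := by linarith
        have hu1 : 1 < y' / u := by rw [lt_div_iff₀ hu]; linarith
        have hst : y' / u ≤ y / u := by gcongr
        exact div_le_div₀ (Rm_pos _ hu1).le (Rm_anti hu1 (hu1.trans_le hst) hst) (by positivity) (by gcongr)) (by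
        intro y' y h1 h2
        refine (hm u y' y hu (by linarith) h2).trans ?_
        have h3 : 0 ≤ y - y' := by linarith
        have : 3 * (K1 + K2 + 27) * (y - y') * u ^ 3 / y' ^ 6 ≤ 3 * (K1 + K2 + 27) * (y - y') * u ^ 3 / m ^ 6 := by gcongr
        have e : 3 * (K1 + K2 + 27) * u ^ 3 / m ^ 6 * (y - y') = 3 * (K1 + K2 + 27) * (y - y') * u ^ 3 / m ^ 6 := by ring
        rw [e]; linarith) hy hy'
    refine this.trans (le_of_eq ?_); ring
end

section
open Real Set

noncomputable def uw (u : ℕ → ℝ) (k : ℕ) : ℝ := (u (k+1) - u k) / u (k+1)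

structure USys (u : ℕ → ℝ) (K : ℝ) : Prop where
  pos : ∀ k, 0 < u k
  mono : Monotone u
  jump : ∀ k, u (k+1) ≤ 2 * u k
  logd : ∀ n : ℕ, 1 ≤ n → |log n - u n| ≤ K
  W : ∀ n : ℕ, 1 ≤ n → |∑ k ∈ Finset.range n, uw u k * (log k - u k) * u k| ≤ K * √(u n)
  wp : ∀ k : ℕ, k.Prime → uw u k = 1 / k
  wn : ∀ k : ℕ, ¬ k.Prime → uw u k = 0

noncomputable def fl (x u : ℝ) : ℝ := u ^ 3 / (x ^ 5 * √x)

lemma USys.w_nonneg {u : ℕ → ℝ} {K : ℝ} (h : USys u K) (k : ℕ) : 0 ≤ uw u k :=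
  div_nonneg (sub_nonneg.2 (h.mono (Nat.le_succ k))) (h.pos _).le

lemma USys.Knn {u : ℕ → ℝ} {K : ℝ} (h : USys u K) : 0 ≤ K := (abs_nonneg _).trans (h.logd 1 le_rfl)

lemma cube_step {a b : ℝ} (ha : 0 < a) (hab : a ≤ b) : (b - a) * a ^ 2 ≤ (b ^ 3 - a ^ 3) / 3 := by
  nlinarith [mul_nonneg (sub_nonneg.2 hab) (sq_nonneg (b - a)), mul_nonneg (mul_nonneg (sub_nonneg.2 hab) ha.le) (sub_nonneg.2 hab)]

lemma USys.sum_cube {u : ℕ → ℝ} {K : ℝ} (h : USys u K) {z0 z : ℕ} (hz : z0 ≤ z) :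
    ∑ k ∈ Finset.Ico z0 z, uw u k * u k ^ 3 ≤ u z ^ 3 / 3 := by
  have : ∑ k ∈ Finset.Ico z0 z, uw u k * u k ^ 3 ≤ ∑ k ∈ Finset.Ico z0 z, (u (k+1) ^ 3 / 3 - u k ^ 3 / 3) := by
    apply Finset.sum_le_sum
    intro k _
    have hp := h.pos k
    have hm := h.mono (Nat.le_succ k)
    simp only [Nat.succ_eq_add_one] at hm
    have hp' := h.pos (k+1)
    have h1 := cube_step hp hm
    unfold uw
    have h2 : (u (k+1) - u k) / u (k+1) * u k ^ 3 ≤ (u (k+1) - u k) * u k ^ 2 := by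
      rw [div_mul_eq_mul_div, div_le_iff₀ hp']
      have : 0 ≤ (u (k+1) - u k) * u k ^ 2 := mul_nonneg (sub_nonneg.2 hm) (sq_nonneg _)
      nlinarith
    linarith
  refine this.trans ?_
  rw [Finset.sum_Ico_sub (fun k => u k ^ 3 / 3) hz]
  have := h.pos z0
  have : 0 < u z0 ^ 3 := by positivity
  linarith

lemma fl_aux {a b E : ℝ} (ha : 0 < a) (hab : a ≤ b) (hE : 0 ≤ E) :
    E * (a ^ 2) ^ 6 / (b ^ 2) ^ 8 / a ≤ E * ((a ^ 2) ^ 3 / ((b ^ 2) ^ 5 * b)) := by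
  have hb : 0 < b := by linarith
  have h1 : a ^ 5 ≤ b ^ 5 := by gcongr
  rw [div_div, ← mul_div_assoc, div_le_div_iff₀ (by positivity) (by positivity)]
  have : 0 ≤ E * a ^ 7 * b ^ 11 := by positivity
  nlinarith [mul_le_mul_of_nonneg_left h1 this]

lemma fl_aux1 {u x E g : ℝ} (hu : 0 < u) (hux : u ≤ x) (hE : 0 ≤ E) (hg : g ≤ E * u ^ 6 / x ^ 8) :
    g / √u ≤ E * fl x u := by
  have hx : 0 < x := by linarith
  have h1 := fl_aux (Real.sqrt_pos.2 hu) (Real.sqrt_le_sqrt hux) hE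
  rw [Real.sq_sqrt hu.le, Real.sq_sqrt hx.le] at h1
  unfold fl
  refine le_trans ?_ h1
  gcongr

lemma USys.lin {u : ℕ → ℝ} {K : ℝ} (h : USys u K) {E x : ℝ} (hE : 0 ≤ E) {z0 z : ℕ} (hz0 : 1 ≤ z0) (hz : z0 ≤ z)
    (hx : u z ≤ x) (g : ℕ → ℝ) (gm : ∀ k, z0 ≤ k → k < z → g k ≤ g (k+1)) (g0 : ∀ k, z0 ≤ k → k ≤ z → 0 ≤ g k)
    (gE : ∀ k, z0 ≤ k → k ≤ z → g k ≤ E * u k ^ 6 / x ^ 8) :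
    ∑ k ∈ Finset.Ico z0 z, uw u k * (log k - u k) * g k ≤ 3 * K * E * fl x (u z) := by
  have hK := h.Knn
  have hx0 : 0 < x := (h.pos z).trans_le hx
  set q : ℕ → ℝ := fun n => ∑ k ∈ Finset.range n, uw u k * (log k - u k) * u k with hq
  set κ : ℕ → ℝ := fun n => g n / u n with hκ
  have e1 : ∑ k ∈ Finset.Ico z0 z, uw u k * (log k - u k) * g k = ∑ k ∈ Finset.Ico z0 z, (q (k+1) - q k) * κ k := by
    apply Finset.sum_congr rfl
    intro k _
    simp only [hq, hκ, Finset.sum_range_succ]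
    have := (h.pos k).ne'
    field_simp
    ring
  rw [e1, abel_id q κ z0 z hz]
  set t : ℝ := 1 / (x ^ 5 * √x) with ht
  have ht0 : 0 < t := by positivity
  have hfl : ∀ v, fl x v = v ^ 3 * t := fun v => by simp only [fl, ht]; ring
  have b1 : ∑ k ∈ Finset.Ico z0 z, q (k+1) * (κ k - κ (k+1)) ≤
      ∑ k ∈ Finset.Ico z0 z, K * ((g (k+1) / √(u (k+1)) + 2 * E * t * (u (k+1) ^ 3 / 3)) - (g k / √(u k) + 2 * E * t * (u k ^ 3 / 3))) := by
    apply Finset.sum_le_sum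
    intro k hk
    rw [Finset.mem_Ico] at hk
    have hp := h.pos k
    have hp' := h.pos (k+1)
    have hm := h.mono (Nat.le_succ k)
    simp only [Nat.succ_eq_add_one] at hm
    have hkx : u k ≤ x := (h.mono hk.2.le).trans hx
    have c1 : g k / √(u k) ≤ E * fl x (u k) := fl_aux1 hp hkx hE (gE k hk.1 hk.2.le)
    rw [hfl] at c1
    have c2 := cube_step hp hm
    have g1 := gm k hk.1 hk.2
    have g2 := g0 k hk.1 hk.2.le
    have c3 : |κ k - κ (k+1)| ≤ (g (k+1) - g k) / u (k+1) + g k * (1 / u k - 1 / u (k+1)) := by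
      have e : κ k - κ (k+1) = g k * (1 / u k - 1 / u (k+1)) - (g (k+1) - g k) / u (k+1) := by
        simp only [hκ]; ring
      have p1 : 0 ≤ g k * (1 / u k - 1 / u (k+1)) := mul_nonneg g2 (sub_nonneg.2 (one_div_le_one_div_of_le hp hm))
      have p2 : 0 ≤ (g (k+1) - g k) / u (k+1) := div_nonneg (by linarith) hp'.le
      rw [e, abs_le]; constructor <;> linarith
    have hqk : |q (k+1)| ≤ K * √(u (k+1)) := h.W (k+1) (by omega)
    have c4 : q (k+1) * (κ k - κ (k+1)) ≤ K * √(u (k+1)) * ((g (k+1) - g k) / u (k+1) + g k * (1 / u k - 1 / u (k+1))) := by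
      refine (le_abs_self _).trans ?_
      rw [abs_mul]
      exact mul_le_mul hqk c3 (abs_nonneg _) (by positivity)
    refine c4.trans ?_
    rw [mul_assoc]
    refine mul_le_mul_of_nonneg_left ?_ hK
    -- in terms of a = √u, b = √u'
    have ha : 0 < √(u k) := Real.sqrt_pos.2 hp
    have hb : 0 < √(u (k+1)) := Real.sqrt_pos.2 hp'
    have hab : √(u k) ≤ √(u (k+1)) := Real.sqrt_le_sqrt hm
    have ea : u k = √(u k) ^ 2 := (Real.sq_sqrt hp.le).symm
    have eb : u (k+1) = √(u (k+1)) ^ 2 := (Real.sq_sqrt hp'.le).symm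
    have c5 : √(u (k+1)) * ((g (k+1) - g k) / u (k+1) + g k * (1 / u k - 1 / u (k+1)))
        ≤ g (k+1) / √(u (k+1)) - g k / √(u k) + 2 * ((g k / √(u k)) * ((u (k+1) - u k) / u k)) := by
      rw [ea, eb]
      rw [Real.sqrt_sq ha.le, Real.sqrt_sq hb.le]
      generalize √(u k) = a at *
      generalize √(u (k+1)) = b at *
      generalize g k = c at *
      generalize g (k+1) = d at *
      have p : 0 ≤ c * (2 * b^3 - a * b ^2 -3 * a ^ 2 * b + 2 * a ^ 3) / (a ^ 3 * b) := by
        apply div_nonneg _ (by positivity)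
        apply mul_nonneg g2
        nlinarith [mul_nonneg (sub_nonneg.2 hab) (sq_nonneg (b - a)), mul_nonneg ha.le (sq_nonneg (b-a)), mul_nonneg hb.le (sq_nonneg (b-a)), mul_nonneg (mul_nonneg ha.le hb.le) (sub_nonneg.2 hab)]
      have q : d / b - c / a + 2 * (c / a * ((b ^ 2 - a ^ 2) / a ^ 2)) - b * ((d - c) / b ^ 2 + c * (1 / a ^ 2 - 1 / b ^ 2)) = c * (2 * b^3 - a * b ^2 -3 * a ^ 2 * b + 2 * a ^ 3) / (a ^ 3 * b) := by
        field_simp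
        ring
      linarith
    refine c5.trans ?_
    have c6 : g k / √(u k) * ((u (k+1) - u k) / u k) ≤ E * t * ((u (k+1) ^ 3 - u k ^ 3) / 3) := by
      calc g k / √(u k) * ((u (k+1) - u k) / u k) ≤ E * (u k ^ 3 * t) * ((u (k+1) - u k) / u k) :=
            mul_le_mul_of_nonneg_right c1 (div_nonneg (sub_nonneg.2 hm) hp.le)
        _ = E * t * ((u (k+1) - u k) * u k ^ 2) := by field_simp
        _ ≤ _ := mul_le_mul_of_nonneg_left c2 (by positivity)
    linarith
  rw [← Finset.mul_sum, Finset.sum_Ico_sub (fun k => g k / √(u k) + 2 * E * t * (u k ^ 3 / 3)) hz] at b1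
  have bq : ∀ n, z0 ≤ n → n ≤ z → |q n * κ n| ≤ K * (g n / √(u n)) := by
    intro n hn hn'
    have hp := h.pos n
    rw [abs_mul]
    have h1 : |q n| ≤ K * √(u n) := h.W n (by omega)
    have h2 : |κ n| = g n / (√(u n) * √(u n)) := by
      rw [Real.mul_self_sqrt hp.le, abs_of_nonneg (div_nonneg (g0 n hn hn') hp.le)]
    rw [h2]
    have hs := Real.sqrt_pos.2 hp
    have := g0 n hn hn'
    calc |q n| * (g n / (√(u n) * √(u n))) ≤ K * √(u n) * (g n / (√(u n) * √(u n))) := by gcongr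
      _ = _ := by field_simp
  have q1 := (abs_le.1 (bq z hz le_rfl)).2
  have q2 := (abs_le.1 (bq z0 le_rfl hz)).1
  have c1 : g z / √(u z) ≤ E * fl x (u z) := fl_aux1 (h.pos z) hx hE (gE z hz le_rfl)
  have hf0 : fl x (u z) = u z ^ 3 * t := hfl _
  have hp0 := h.pos z0
  have hp := h.pos z
  have : 0 ≤ K * (2 * E * t * (u z0 ^ 3 / 3)) := by positivity
  have : 0 ≤ K * (E * fl x (u z)) := by rw [hf0]; positivity
  have h9 := mul_le_mul_of_nonneg_left c1 hK
  have e9 : K * (2 * E * t * (u z ^ 3 / 3)) = 2 / 3 * (K * (E * fl x (u z))) := by rw [hf0]; ring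
  have e10 : 3 * K * E * fl x (u z) = 3 * (K * (E * fl x (u z))) := by ring
  generalize ∑ k ∈ Finset.Ico z0 z, q (k+1) * (κ k - κ (k+1)) = SS at *
  simp only [mul_sub, mul_add] at b1
  linarith
end

section
open Real Set

noncomputable def cc (x : ℝ) : ℝ := 2 - 1 / √√x

lemma cc_mono {x y : ℝ} (hx : 0 < x) (hxy : x ≤ y) : cc x ≤ cc y := by
  unfold cc
  have : 0 < √√x := by positivity
  have : 1 / √√y ≤ 1 / √√x := one_div_le_one_div_of_le this (by gcongr)
  linarith

lemma cc_nonneg {x : ℝ} (hx : 1 ≤ x) : 1 ≤ cc x := by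
  unfold cc
  have : 1 ≤ √√x := by
    rw [Real.one_le_sqrt, Real.one_le_sqrt]; exact hx
  have : 1 / √√x ≤ 1 := by rw [div_le_one (by linarith)]; exact this
  linarith

lemma cc_le (x : ℝ) : cc x ≤ 2 := by
  unfold cc; have : 0 ≤ 1 / √√x := by positivity
  linarith

lemma cc_gap {x y : ℝ} (hy : 0 < y) (hyx : y ≤ x * (1 - 1/64)) : 1 / (256 * √√x) ≤ cc x - cc y := by
  have hx : 0 < x := by nlinarith
  unfold cc
  have hr : 0 < √√x := by positivity
  have hs : 0 < √√y := by positivity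
  have h4 : ∀ t : ℝ, 0 < t → √√t ^ 4 = t := fun t ht => by
    have : √√t ^ 4 = (√√t ^ 2) ^ 2 := by ring
    rw [this, Real.sq_sqrt (by positivity), Real.sq_sqrt ht.le]
  have h1 : √√y ≤ √√x * (1 - 1/256) := by
    apply le_of_pow_le_pow_left₀ (n := 4) (by norm_num) (by positivity)
    rw [mul_pow, h4 x hx, h4 y hy]
    nlinarith
  have h2 : 1 / (√√x * (1 - 1/256)) ≤ 1 / √√y := one_div_le_one_div_of_le hs h1
  have h3 : 1 / (√√x * (1 - 1/256)) = 1 / √√x * (256/255) := by field_simp; norm_num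
  have h5 : 1 / (256 * √√x) = 1 / √√x * (1/256) := by field_simp
  have : 0 < 1 / √√x := by positivity
  rw [h5]; rw [h3] at h2; linarith

lemma fl_scale {x y θ u : ℝ} (hx : 0 < x) (hθ : 0 < θ) (hθ1 : θ ≤ 1) (hy : θ * x ≤ y) (hu : 0 ≤ u) :
    fl y u ≤ (1 / θ ^ 6) * fl x u := by
  unfold fl
  have h1 : θ * √x ≤ √y := by
    apply Real.le_sqrt_of_sq_le
    rw [mul_pow, Real.sq_sqrt hx.le]
    nlinarith [mul_nonneg hθ.le hx.le]
  have hy0 : 0 < y := lt_of_lt_of_le (by positivity) hy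
  have h2 : (θ * x) ^ 5 * (θ * √x) ≤ y ^ 5 * √y := by gcongr
  have e : (1 / θ ^ 6) * (u ^ 3 / (x ^ 5 * √x)) = u ^ 3 / ((θ * x) ^ 5 * (θ * √x)) := by field_simp
  rw [e]
  have : 0 < √x := by positivity
  gcongr

noncomputable def clampW (x v : ℝ) : ℝ := max (x/16) (min v (x/8))

lemma clampW_mono {x v w : ℝ} (h : v ≤ w) : clampW x v ≤ clampW x w := by
  unfold clampW; gcongr

set_option maxHeartbeats 1600000 in
lemma seq_main (K E ε : ℝ) (hK : 0 ≤ K) (hE : 0 < E) (hε : 0 < ε) : ∃ x1 K1 : ℝ, 1 ≤ x1 ∧ 1 ≤ K1 ∧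
    ∀ u : ℕ → ℝ, USys u K → ∀ z0 z : ℕ, 1 ≤ z0 → z0 ≤ z → ∀ x Kf : ℝ, x1 ≤ x → K1 ≤ Kf → 16 * u z0 ≤ x → 2 * u z ≤ x →
    ∀ a a0 b g Ah Rh : ℕ → ℝ, 0 ≤ Ah z0 → 0 ≤ Rh z0 →
    (∀ k, z0 ≤ k → k < z → a0 k * uw u k ≤ Ah (k+1) - Ah k) →
    (∀ k, z0 ≤ k → k < z → g k * uw u k ≤ Rh (k+1) - Rh k) →
    (∀ k, z0 ≤ k → k < z → a k ≤ a0 k + (log k - u k) * g k + E * u k ^ 3 / x ^ 6) →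
    (∀ k, z0 ≤ k → k < z → b k ≤ g k + E * u k ^ 3 / x ^ 6) →
    (∀ k, z0 ≤ k → k < z → g k ≤ g (k+1)) →
    (∀ k, z0 ≤ k → k ≤ z → 0 ≤ g k) →
    (∀ k, z0 ≤ k → k ≤ z → g k ≤ E * u k ^ 6 / x ^ 8) →
    (∀ k, z0 ≤ k → k < z → x / 32 ≤ u k → u k ≤ x / 8 → ε / x ^ 2 ≤ g k) →
    ∑ k ∈ Finset.Ico z0 z, uw u k * (a k + Kf * (cc (x - log k) * b k + fl (x - log k) (u k))) + fl x (u z)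
      ≤ Ah z + Kf * (cc x * Rh z + fl x (u z)) := by
  set R : ℝ := 1024 * (3 * K * E + 2 * E + 1367) / ε + 20 * E + 1 with hR
  clear_value R
  have hR1 : 1 ≤ R := by
    have : 0 ≤ 1024 * (3 * K * E + 2 * E + 1367) / ε + 20 * E := by positivity
    linarith
  refine ⟨R ^ 4 + 100 * K + 4, 10 * (3 * K * E + E + 1), by have := pow_pos (by linarith : 0 < R) 4; linarith, by have := mul_nonneg hK hE.le; linarith, ?_⟩
  intro u hs z0 z hz0 hz x Kf hx hKf hxz0 hxz a a0 b g Ah Rh hA0 hR0 h1 h2 h3 h4 h5 h6 h7 h8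
  have hR4 : 0 < R ^ 4 := by positivity
  have hxK : 100 * K ≤ x := by linarith
  have hx4 : 4 ≤ x := by linarith
  have hx0 : 0 < x := by linarith
  have hKf1 : 1 ≤ Kf := by have := mul_nonneg hK hE.le; linarith
  set r := √√x with hr
  have hr0 : 0 < r := by positivity
  have hr2 : r ^ 2 = √x := Real.sq_sqrt (by positivity)
  have hrR : R ≤ r := by
    apply Real.le_sqrt_of_sq_le
    apply Real.le_sqrt_of_sq_le
    have : (R ^ 2) ^ 2 = R ^ 4 := by ring
    rw [this]; linarith
  have hr1 : 1 ≤ r := hR1.trans hrR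
  clear_value r
  have hux : ∀ k, k ≤ z → u k ≤ x / 2 := fun k hk => by linarith [hs.mono hk]
  have hup := hs.pos
  have hw := hs.w_nonneg
  set f := fl x (u z) with hf
  have hfe : f = u z ^ 3 / (x ^ 5 * √x) := rfl
  clear_value f
  have hf0 : 0 < f := by rw [hfe]; have := hup z; positivity
  have hlog : ∀ k, z0 ≤ k → 0 ≤ log k ∧ |log k - u k| ≤ K := fun k hk =>
    ⟨Real.log_nonneg (by exact_mod_cast hz0.trans hk), hs.logd k (hz0.trans hk)⟩
  have hy : ∀ k, z0 ≤ k → k < z → x / 4 ≤ x - log k ∧ x - log k ≤ x := by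
    intro k hk hk'
    obtain ⟨l1, l2⟩ := hlog k hk
    have := hux k hk'.le
    rw [abs_le] at l2
    constructor <;> linarith
  have hcube := hs.sum_cube hz
  have hcube0 : u z ^ 3 / x ^ 6 = f / √x := by
    rw [hfe, div_div]; congr 1
    have : √x * √x = x := Real.mul_self_sqrt hx0.le
    calc x ^ 6 = x ^ 5 * x := by ring
      _ = _ := by rw [mul_assoc, this]
  have hsx1 : 1 ≤ √x := by rw [← hr2]; nlinarith only [hr1]
  have hE6 : ∑ k ∈ Finset.Ico z0 z, uw u k * (E * u k ^ 3 / x ^ 6) ≤ E / 3 * (f / √x) := by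
    have e : ∑ k ∈ Finset.Ico z0 z, uw u k * (E * u k ^ 3 / x ^ 6) = E / x ^ 6 * ∑ k ∈ Finset.Ico z0 z, uw u k * u k ^ 3 := by
      rw [Finset.mul_sum]; apply Finset.sum_congr rfl; intros; ring
    rw [e, ← hcube0]
    calc _ ≤ E / x ^ 6 * (u z ^ 3 / 3) := by gcongr
      _ = _ := by ring
  -- S1
  have S1 : ∑ k ∈ Finset.Ico z0 z, uw u k * a k ≤ Ah z + 3 * K * E * f + E / 3 * (f / √x) := by
    have t1 : ∑ k ∈ Finset.Ico z0 z, uw u k * a k ≤ ∑ k ∈ Finset.Ico z0 z, ((Ah (k+1) - Ah k) + uw u k * (log k - u k) * g k + uw u k * (E * u k ^ 3 / x ^ 6)) := by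
      apply Finset.sum_le_sum
      intro k hk
      rw [Finset.mem_Ico] at hk
      have := mul_le_mul_of_nonneg_left (h3 k hk.1 hk.2) (hw k)
      have := h1 k hk.1 hk.2
      linarith
    rw [Finset.sum_add_distrib, Finset.sum_add_distrib, Finset.sum_Ico_sub (fun k => Ah k) hz] at t1
    have t2 := hs.lin hE.le hz0 hz (by linarith [hup z] : u z ≤ x) g h5 h6 h7
    rw [← hf] at t2
    linarith
  set lam : ℝ := ε / (64 * r * x ^ 3) with hlam
  have hlam0 : 0 < lam := by rw [hlam]; positivity
  clear_value lam
  have S2 : ∑ k ∈ Finset.Ico z0 z, uw u k * (cc (x - log k) * b k) ≤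
      cc x * Rh z - lam * (clampW x (u z) - clampW x (u z0)) + 2 * (E / 3 * (f / √x)) := by
    have t1 : ∑ k ∈ Finset.Ico z0 z, uw u k * (cc (x - log k) * b k) ≤ ∑ k ∈ Finset.Ico z0 z,
       (cc x * (Rh (k+1) - Rh k) - lam * (clampW x (u (k+1)) - clampW x (u k)) + 2 * (uw u k * (E * u k ^ 3 / x ^ 6))) := by
      apply Finset.sum_le_sum
      intro k hk
      rw [Finset.mem_Ico] at hk
      obtain ⟨y1, y2⟩ := hy k hk.1 hk.2
      have c1 : 1 ≤ cc (x - log k) := cc_nonneg (by linarith)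
      have c2 := cc_le (x - log k)
      have c3 := cc_mono (by linarith) y2
      have b1 := h4 k hk.1 hk.2
      have g1 := h2 k hk.1 hk.2
      have g0 := h6 k hk.1 hk.2.le
      have hwk := hw k
      have hE0 : 0 ≤ uw u k * (E * u k ^ 3 / x ^ 6) := by have := hup k; positivity
      have d1 : uw u k * (cc (x - log k) * b k) ≤ cc (x - log k) * (uw u k * g k) + 2 * (uw u k * (E * u k ^ 3 / x ^ 6)) := by
        have e1 : uw u k * (cc (x - log k) * b k) ≤ uw u k * (cc (x - log k) * (g k + E * u k ^ 3 / x ^ 6)) := by gcongr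
        clear * - e1 c2 hE0
        have : 0 ≤ (2 - cc (x - log k)) * (uw u k * (E * u k ^ 3 / x ^ 6)) := mul_nonneg (by linarith) hE0
        nlinarith only [e1, this]
      have d2 : lam * (clampW x (u (k+1)) - clampW x (u k)) ≤ (cc x - cc (x - log k)) * (uw u k * g k) := by
        have hgn : 0 ≤ (cc x - cc (x - log k)) * (uw u k * g k) := by
          apply mul_nonneg; linarith
          exact mul_nonneg hwk g0
        have hm : u k ≤ u (k+1) := hs.mono (Nat.le_succ k)
        have hj := hs.jump k
        by_cases q1 : u (k+1) ≤ x / 16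
        · have : clampW x (u (k+1)) = clampW x (u k) := by
            unfold clampW
            rw [max_eq_left ((min_le_left _ _).trans q1), max_eq_left ((min_le_left _ _).trans (hm.trans q1))]
          rw [this]; simpa using hgn
        by_cases q2 : x / 8 ≤ u k
        · have : clampW x (u (k+1)) = clampW x (u k) := by
            unfold clampW
            rw [min_eq_right q2, min_eq_right (q2.trans hm)]
          rw [this]; simpa using hgn
        push Not at q1 q2
        have gl := h8 k hk.1 hk.2 (by linarith) q2.le
        have l2 := (hlog k hk.1).2
        rw [abs_le] at l2
        have gap := cc_gap (by linarith : 0 < x - log k) (by linarith : x - log k ≤ x * (1 - 1/64))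
        have cl : clampW x (u (k+1)) - clampW x (u k) ≤ u (k+1) - u k := by
          unfold clampW
          rw [min_eq_left q2.le]
          rcases max_cases (x/16) (min (u (k+1)) (x/8)) with m | m <;>
          rcases max_cases (x/16) (u k) with n | n <;>
          have := min_le_left (u (k+1)) (x/8) <;> linarith
        have wl : 4 / x * (u (k+1) - u k) ≤ uw u k := by
          unfold uw
          have : u (k+1) ≤ x / 4 := by linarith
          rw [div_mul_eq_mul_div, div_le_div_iff₀ hx0 (hup _)]
          nlinarith only [sub_nonneg.2 hm, this]
        calc lam * (clampW x (u (k+1)) - clampW x (u k)) ≤ lam * (u (k+1) - u k) := by gcongr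
          _ = 1 / (256 * r) * ((4 / x * (u (k+1) - u k)) * (ε / x ^ 2)) := by
            rw [hlam]; field_simp; ring
          _ ≤ _ := by
            rw [hr]
            have : 0 ≤ u (k+1) - u k := by linarith
            gcongr
      have d3 : cc x * (uw u k * g k) ≤ cc x * (Rh (k+1) - Rh k) := by
        have : 0 ≤ cc x := by linarith
        gcongr; linarith
      linarith
    rw [Finset.sum_add_distrib, Finset.sum_sub_distrib, ← Finset.mul_sum, ← Finset.mul_sum, ← Finset.mul_sum, Finset.sum_Ico_sub (fun k => Rh k) hz,
      Finset.sum_Ico_sub (fun k => clampW x (u k)) hz] at t1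
    have : 0 ≤ cc x * Rh z0 := mul_nonneg (by linarith [cc_nonneg (by linarith : 1 ≤ x)]) hR0
    linarith
  have S3 : ∀ θ : ℝ, 0 < θ → θ ≤ 1 → (∀ k, z0 ≤ k → k < z → θ * x ≤ x - log k) →
      ∑ k ∈ Finset.Ico z0 z, uw u k * fl (x - log k) (u k) ≤ 1 / θ ^ 6 / 3 * f := by
    intro θ t1 t2 t3
    have s1 : ∑ k ∈ Finset.Ico z0 z, uw u k * fl (x - log k) (u k) ≤ ∑ k ∈ Finset.Ico z0 z, (1 / θ ^ 6) * (1 / (x ^ 5 * √x)) * (uw u k * u k ^ 3) := by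
      apply Finset.sum_le_sum
      intro k hk
      rw [Finset.mem_Ico] at hk
      have := mul_le_mul_of_nonneg_left (fl_scale hx0 t1 t2 (t3 k hk.1 hk.2) (hup k).le) (hw k)
      refine this.trans (le_of_eq ?_)
      unfold fl; ring
    rw [← Finset.mul_sum] at s1
    refine s1.trans ?_
    calc _ ≤ (1 / θ ^ 6) * (1 / (x ^ 5 * √x)) * (u z ^ 3 / 3) := by gcongr
      _ = _ := by rw [hfe]; ring
  have split : ∑ k ∈ Finset.Ico z0 z, uw u k * (a k + Kf * (cc (x - log k) * b k + fl (x - log k) (u k))) =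
     ∑ k ∈ Finset.Ico z0 z, uw u k * a k + Kf * (∑ k ∈ Finset.Ico z0 z, uw u k * (cc (x - log k) * b k) + ∑ k ∈ Finset.Ico z0 z, uw u k * fl (x - log k) (u k)) := by
    rw [← Finset.sum_add_distrib, Finset.mul_sum, ← Finset.sum_add_distrib]
    apply Finset.sum_congr rfl; intros; ring
  rw [split]
  have hfx : f / √x ≤ f := div_le_self hf0.le hsx1
  generalize ∑ k ∈ Finset.Ico z0 z, uw u k * a k = s1 at *
  generalize ∑ k ∈ Finset.Ico z0 z, uw u k * (cc (x - log k) * b k) = s2 at *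
  generalize ∑ k ∈ Finset.Ico z0 z, uw u k * fl (x - log k) (u k) = s3 at *
  have hcl := clampW_mono (x := x) (hs.mono hz)
  rcases le_or_gt (u z) (x / 8) with hc | hc
  · have T3 := S3 (86/100) (by norm_num) (by norm_num) (by
      intro k hk hk'
      have l2 := (hlog k hk).2
      rw [abs_le] at l2
      have := hs.mono hk'.le
      linarith)
    have T3' : s3 ≤ 84/100 * f := T3.trans (mul_le_mul_of_nonneg_right (by norm_num) hf0.le)
    have hEx : E * (f / √x) ≤ 1/20 * f := by
      have : 20 * E ≤ √x := by
        have : 20 * E ≤ R := by rw [hR]; have : 0 ≤ 1024 * (3 * K * E + 2 * E + 1367) / ε := by positivity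
                                linarith
        rw [← hr2]; nlinarith only [this, hr1, hrR]
      rw [mul_div_assoc', div_le_iff₀ (by linarith)]
      nlinarith only [this, hf0]
    have T2 : s2 ≤ cc x * Rh z + 1/20 * f := by
      have : 0 ≤ lam * (clampW x (u z) - clampW x (u z0)) := mul_nonneg hlam0.le (by linarith)
      linarith
    have h11 : Kf * (s2 + s3) ≤ Kf * (cc x * Rh z + 89/100 * f) := mul_le_mul_of_nonneg_left (by linarith) (by linarith)
    have : (10 * (3 * K * E + E + 1)) * f ≤ Kf * f := by gcongr
    nlinarith only [mul_nonneg (mul_nonneg hK hE.le) hf0.le, mul_nonneg hE.le hf0.le, this, S1, hfx, hEx, h11]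
  · have T3 := S3 (1/4) (by norm_num) (by norm_num) (by
      intro k hk hk'
      have := (hy k hk hk').1
      linarith)
    have T3' : s3 ≤ 1366 * f := T3.trans (mul_le_mul_of_nonneg_right (by norm_num) hf0.le)
    have q1 : clampW x (u z) - clampW x (u z0) = x / 16 := by
      unfold clampW
      rw [min_eq_right hc.le, max_eq_right (by linarith), max_eq_left ((min_le_left _ _).trans (by linarith))]
      ring
    rw [q1] at S2
    have q2 : lam * (x / 16) = ε / (1024 * r * x ^ 2) := by rw [hlam]; field_simp; norm_num
    rw [q2] at S2
    have q3 : (3 * K * E + 2 * E + 1367) * f ≤ ε / (1024 * r * x ^ 2) := by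
      have f1 : f ≤ 1 / (x ^ 2 * r ^ 2) := by
        rw [hfe, hr2]
        calc u z ^ 3 / (x ^ 5 * √x) ≤ x ^ 3 / (x ^ 5 * √x) := by
              have := hup z
              have : u z ≤ x := by linarith
              gcongr
          _ = _ := by have : 0 < √x := by positivity
                      field_simp
      have hq : 0 < 3 * K * E + 2 * E + 1367 := by positivity
      calc _ ≤ (3 * K * E + 2 * E + 1367) * (1 / (x ^ 2 * r ^ 2)) := by gcongr
        _ ≤ _ := by
          rw [mul_one_div, div_le_div_iff₀ (by positivity) (by positivity)]
          have : 1024 * (3 * K * E + 2 * E + 1367) / ε ≤ r := by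
            refine le_trans ?_ hrR
            rw [hR]; linarith
          rw [div_le_iff₀ hε] at this
          have h0 : 0 ≤ r * x ^ 2 := by positivity
          nlinarith only [mul_le_mul_of_nonneg_left this h0]
    generalize ε / (1024 * r * x ^ 2) = q at *
    have q4 : s2 + s3 ≤ cc x * Rh z - (3 * K * E + E) * f - f := by nlinarith only [S2, q3, T3', mul_le_mul_of_nonneg_left hfx hE.le, mul_nonneg hE.le hf0.le]
    have q5 : Kf * (s2 + s3) ≤ Kf * (cc x * Rh z - (3 * K * E + E) * f - f) := by gcongr
    have q6 : 0 ≤ (Kf - 1) * ((3 * K * E + E + 1) * f) := by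
      apply mul_nonneg; linarith
      positivity
    have q7 := mul_le_mul_of_nonneg_left hfx hE.le
    have q8 := mul_nonneg hE.le hf0.le
    clear * - q5 q6 q7 q8 S1 hKf1 hf0
    nlinarith only [mul_pos (by linarith : 0 < Kf) hf0, q5, q6, q7, q8, S1]
end

section
open Real Set

lemma m_pow {x m t : ℝ} (hx : 0 < x) (hm : x / 4 ≤ m) (ht : 0 ≤ t) : t / m ^ 6 ≤ 4096 * t / x ^ 6 := by
  have : (x / 4) ^ 6 ≤ m ^ 6 := by gcongr
  rw [div_le_div_iff₀ (by have : 0 < m := by linarith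
                          positivity) (by positivity)]
  have e : (x / 4) ^ 6 = x ^ 6 / 4096 := by ring
  rw [e] at this
  nlinarith [mul_le_mul_of_nonneg_left this ht]

lemma decay_g {x u Kd R : ℝ} (hu : 0 < u) (hx : 2 * u ≤ x) (hKd : 0 < Kd) (hR : R ≤ Kd / ((x - u) / u) ^ 6) :
    R / (x - u) ^ 2 ≤ 256 * Kd * u ^ 6 / x ^ 8 := by
  have hy : 0 < x - u := by linarith
  have hx0 : 0 < x := by linarith
  have e : Kd / ((x - u) / u) ^ 6 / (x - u) ^ 2 = Kd * u ^ 6 / (x - u) ^ 8 := by field_simp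
  calc R / (x - u) ^ 2 ≤ Kd / ((x - u) / u) ^ 6 / (x - u) ^ 2 := by gcongr
    _ = Kd * u ^ 6 / (x - u) ^ 8 := e
    _ ≤ Kd * u ^ 6 / (x / 2) ^ 8 := by gcongr; linarith
    _ = _ := by field_simp; norm_num

lemma ana_minus (K : ℝ) (hK : 0 ≤ K) : ∃ x1 K1 : ℝ, 1 ≤ x1 ∧ 1 ≤ K1 ∧
    ∀ u : ℕ → ℝ, USys u K → ∀ z0 z : ℕ, 1 ≤ z0 → z0 ≤ z → ∀ x Kf : ℝ, x1 ≤ x → K1 ≤ Kf → 16 * u z0 ≤ x → 2 * u z ≤ x →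
    ∑ k ∈ Finset.Ico z0 z, uw u k * (cap (x - log k) (u k) + Kf * (cc (x - log k) * crp (x - log k) (u k) + fl (x - log k) (u k))) + fl x (u z)
      ≤ cam x (u z) + Kf * (cc x * crm x (u z) + fl x (u z)) := by
  obtain ⟨Ks, hKs, sh1, -, sh3, -⟩ := shifts
  obtain ⟨Kd, hKd, de1, -⟩ := R_decay
  set E : ℝ := 4096 * (Ks * K ^ 2) + 4096 * (Ks * K) + 256 * Kd with hE
  have hE0 : 0 < E := by positivity
  have e1 : 4096 * (Ks * K ^ 2) ≤ E := by have : 0 ≤ 4096 * (Ks * K) := by positivity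
                                          linarith
  have e2 : 4096 * (Ks * K) ≤ E := by have : 0 ≤ 4096 * (Ks * K ^ 2) := by positivity
                                      linarith
  have e3 : 256 * Kd ≤ E := by have : 0 ≤ 4096 * (Ks * K ^ 2) := by positivity
                               have : 0 ≤ 4096 * (Ks * K) := by positivity
                               linarith
  clear_value E
  obtain ⟨x1, K1, hx1, hK1, main⟩ := seq_main K E (Rp 31) hK hE0 (Rp_pos 31)
  refine ⟨x1 + 100 * K, K1, by linarith, hK1, ?_⟩
  intro u hs z0 z hz0 hz x Kf hx hKf hxz0 hxz
  have hx0 : 0 < x := by linarith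
  have hup := hs.pos
  have hux : ∀ k, k ≤ z → 2 * u k ≤ x := fun k hk => by linarith [hs.mono hk]
  have hlog : ∀ k, z0 ≤ k → |log k - u k| ≤ K := fun k hk => hs.logd k (hz0.trans hk)
  refine main u hs z0 z hz0 hz x Kf (by linarith) hKf hxz0 hxz (fun k => cap (x - log k) (u k)) (fun k => cap (x - u k) (u k))
    (fun k => crp (x - log k) (u k)) (fun k => crp (x - u k) (u k)) (fun k => cam x (u k)) (fun k => crm x (u k))
    (cam_nonneg (hup _) (by linarith [hux z0 hz, hup z0])) (crm_pos (hup _) (by linarith [hux z0 hz, hup z0])).le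
    ?_ ?_ ?_ ?_ ?_ ?_ ?_ ?_
  · intro k hk hk'
    exact cam_step (hup k) (hs.mono (Nat.le_succ k)) (by linarith [hux (k+1) hk', hup (k+1)])
  · intro k hk hk'
    exact crm_step (hup k) (hs.mono (Nat.le_succ k)) (by linarith [hux (k+1) hk', hup (k+1)])
  · intro k hk hk'
    have l := hlog k hk
    have l' := abs_le.1 l
    have hu := hup k
    have hu2 := hux k hk'.le
    have := sh3 (u k) (x / 4) (x - log k) (x - u k) (hup k) (by linarith) (by linarith) (by linarith)
    have e : x - u k - (x - log k) = log k - u k := by ring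
    rw [e] at this
    refine this.trans ?_
    refine add_le_add le_rfl ?_
    have hd : (log k - u k) ^ 2 ≤ K ^ 2 := by rw [← sq_abs]; gcongr
    calc Ks * (log k - u k) ^ 2 * u k ^ 3 / (x / 4) ^ 6 ≤ Ks * K ^ 2 * u k ^ 3 / (x / 4) ^ 6 := by gcongr
      _ ≤ 4096 * (Ks * K ^ 2 * u k ^ 3) / x ^ 6 := m_pow hx0 le_rfl (by positivity)
      _ = 4096 * (Ks * K ^ 2) * u k ^ 3 / x ^ 6 := by ring
      _ ≤ _ := by gcongr
  · intro k hk hk'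
    have l' := abs_le.1 (hlog k hk)
    have hu := hup k
    have hu2 := hux k hk'.le
    have hEn : 0 ≤ E * u k ^ 3 / x ^ 6 := by positivity
    rcases le_total (x - log k) (x - u k) with q | q
    · have := sh1 (u k) (x - log k) (x - u k) hu (by linarith) q
      refine this.trans ?_
      refine add_le_add le_rfl ?_
      have hd : x - u k - (x - log k) ≤ K := by linarith
      have hm : x / 4 ≤ x - log k := by linarith
      have h0 : 0 < x - log k := by linarith
      calc Ks * (x - u k - (x - log k)) * u k ^ 3 / (x - log k) ^ 6 ≤ Ks * K * u k ^ 3 / (x - log k) ^ 6 := by gcongr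
        _ ≤ 4096 * (Ks * K * u k ^ 3) / x ^ 6 := m_pow hx0 hm (by positivity)
        _ = 4096 * (Ks * K) * u k ^ 3 / x ^ 6 := by ring
        _ ≤ _ := by gcongr
    · have : crp (x - log k) (u k) ≤ crp (x - u k) (u k) := by
        unfold crp
        have h0 : 0 < x - u k := by linarith
        exact div_le_div₀ (Rp_pos _).le (Rp_anti (by gcongr)) (by positivity) (by gcongr)
      linarith
  · intro k hk hk'
    exact crp_g_mono (hup k) (hs.mono (Nat.le_succ k)) (by linarith [hux (k+1) hk', hup (k+1)])
  · intro k hk hk'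
    exact (crp_pos (by linarith [hux k hk', hup k])).le
  · intro k hk hk'
    have hu := hup k
    have hu2 := hux k hk'
    have := decay_g hu hu2 hKd (de1 ((x - u k) / u k) (div_pos (by linarith) hu))
    refine this.trans ?_
    gcongr
  · intro k hk hk' q1 q2
    have hu := hup k
    have hu2 := hux k hk'.le
    have h0 : 0 < x - u k := by linarith
    have h31 : (x - u k) / u k ≤ 31 := by rw [div_le_iff₀ hu]; linarith
    unfold crp
    exact div_le_div₀ (Rp_pos _).le (Rp_anti h31) (by positivity) (by gcongr; linarith)

lemma ana_plus (K : ℝ) (hK : 0 ≤ K) : ∃ x1 K1 : ℝ, 1 ≤ x1 ∧ 1 ≤ K1 ∧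
    ∀ u : ℕ → ℝ, USys u K → ∀ z0 z : ℕ, 1 ≤ z0 → z0 ≤ z → ∀ x Kf : ℝ, x1 ≤ x → K1 ≤ Kf → 16 * u z0 ≤ x → 3 * u z ≤ x → 2 * K ≤ u z0 →
    ∑ k ∈ Finset.Ico z0 z, uw u k * (cam (x - log k) (u k) + Kf * (cc (x - log k) * crm (x - log k) (u k) + fl (x - log k) (u k))) + fl x (u z)
      ≤ cap x (u z) + Kf * (cc x * crp x (u z) + fl x (u z)) := by
  obtain ⟨Ks, hKs, -, sh1, -, sh3⟩ := shifts
  obtain ⟨Kd, hKd, -, de1⟩ := R_decay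
  set E : ℝ := 4096 * (Ks * K ^ 2) + 4096 * (Ks * K) + 256 * Kd with hE
  have hE0 : 0 < E := by positivity
  have e1 : 4096 * (Ks * K ^ 2) ≤ E := by have : 0 ≤ 4096 * (Ks * K) := by positivity
                                          linarith
  have e2 : 4096 * (Ks * K) ≤ E := by have : 0 ≤ 4096 * (Ks * K ^ 2) := by positivity
                                      linarith
  have e3 : 256 * Kd ≤ E := by have : 0 ≤ 4096 * (Ks * K ^ 2) := by positivity
                               have : 0 ≤ 4096 * (Ks * K) := by positivity
                               linarith
  clear_value E
  obtain ⟨x1, K1, hx1, hK1, main⟩ := seq_main K E (Rm 31) hK hE0 (Rm_pos 31 (by norm_num))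
  refine ⟨x1 + 100 * K, K1, by linarith, hK1, ?_⟩
  intro u hs z0 z hz0 hz x Kf hx hKf hxz0 hxz hU
  have hx0 : 0 < x := by linarith
  have hup := hs.pos
  have hux : ∀ k, k ≤ z → 3 * u k ≤ x := fun k hk => by linarith [hs.mono hk]
  have huK : ∀ k, z0 ≤ k → 2 * K ≤ u k := fun k hk => by linarith [hs.mono hk]
  have hlog : ∀ k, z0 ≤ k → |log k - u k| ≤ K := fun k hk => hs.logd k (hz0.trans hk)
  refine main u hs z0 z hz0 hz x Kf (by linarith) hKf hxz0 (by linarith [hup z]) (fun k => cam (x - log k) (u k)) (fun k => cam (x - u k) (u k))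
    (fun k => crm (x - log k) (u k)) (fun k => crm (x - u k) (u k)) (fun k => cap x (u k)) (fun k => crp x (u k))
    (cap_nonneg (hup _) (by linarith [hux z0 hz, hup z0])) (crp_pos (by linarith [hux z0 hz, hup z0])).le
    ?_ ?_ ?_ ?_ ?_ ?_ ?_ ?_
  · intro k hk hk'
    exact cap_step (hup k) (hs.mono (Nat.le_succ k)) (by linarith [hux (k+1) hk', hup (k+1)])
  · intro k hk hk'
    exact crp_step (hup k) (hs.mono (Nat.le_succ k)) (by linarith [hux (k+1) hk', hup (k+1)])
  · intro k hk hk'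
    have l := hlog k hk
    have l' := abs_le.1 l
    have hu := hup k
    have hu2 := hux k hk'.le
    have hu3 := huK k hk
    have := sh3 (u k) (x - u k - K) (x - log k) (x - u k) (hup k) (by linarith) (by linarith) (by linarith)
    have e : x - u k - (x - log k) = log k - u k := by ring
    rw [e] at this
    refine this.trans ?_
    refine add_le_add le_rfl ?_
    have hd : (log k - u k) ^ 2 ≤ K ^ 2 := by rw [← sq_abs]; gcongr
    have h0 : 0 < x - u k - K := by linarith
    calc Ks * (log k - u k) ^ 2 * u k ^ 3 / (x - u k - K) ^ 6 ≤ Ks * K ^ 2 * u k ^ 3 / (x - u k - K) ^ 6 := by gcongr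
      _ ≤ 4096 * (Ks * K ^ 2 * u k ^ 3) / x ^ 6 := m_pow hx0 (by linarith) (by positivity)
      _ = 4096 * (Ks * K ^ 2) * u k ^ 3 / x ^ 6 := by ring
      _ ≤ _ := by gcongr
  · intro k hk hk'
    have l' := abs_le.1 (hlog k hk)
    have hu := hup k
    have hu2 := hux k hk'.le
    have hu3 := huK k hk
    have hEn : 0 ≤ E * u k ^ 3 / x ^ 6 := by positivity
    rcases le_total (x - log k) (x - u k) with q | q
    · have := sh1 (u k) (x - log k) (x - u k) hu (by linarith) q
      refine this.trans ?_
      refine add_le_add le_rfl ?_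
      have hd : x - u k - (x - log k) ≤ K := by linarith
      have hm : x / 4 ≤ x - log k := by linarith
      have h0 : 0 < x - log k := by linarith
      calc Ks * (x - u k - (x - log k)) * u k ^ 3 / (x - log k) ^ 6 ≤ Ks * K * u k ^ 3 / (x - log k) ^ 6 := by gcongr
        _ ≤ 4096 * (Ks * K * u k ^ 3) / x ^ 6 := m_pow hx0 hm (by positivity)
        _ = 4096 * (Ks * K) * u k ^ 3 / x ^ 6 := by ring
        _ ≤ _ := by gcongr
    · have : crm (x - log k) (u k) ≤ crm (x - u k) (u k) := by
        unfold crm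
        have h0 : 0 < x - u k := by linarith
        have h1 : 1 < (x - u k) / u k := by rw [lt_div_iff₀ hu]; linarith
        have h2 : (x - u k) / u k ≤ (x - log k) / u k := by gcongr
        exact div_le_div₀ (Rm_pos _ h1).le (Rm_anti (show _ ∈ Ioi (1:ℝ) from h1) (show _ ∈ Ioi (1:ℝ) from h1.trans_le h2) h2) (by positivity) (by gcongr)
      linarith
  · intro k hk hk'
    exact crm_g_mono (hup k) (hs.mono (Nat.le_succ k)) (by linarith [hux (k+1) hk', hup (k+1)])
  · intro k hk hk'
    exact (crm_pos (hup k) (by linarith [hux k hk', hup k])).le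
  · intro k hk hk'
    have hu := hup k
    have hu2 := hux k hk'
    have := decay_g hu (by linarith) hKd (de1 ((x - u k) / u k) (by rw [le_div_iff₀ hu]; linarith))
    refine this.trans ?_
    gcongr
  · intro k hk hk' q1 q2
    have hu := hup k
    have hu2 := hux k hk'.le
    have h0 : 0 < x - u k := by linarith
    have h31 : (x - u k) / u k ≤ 31 := by rw [div_le_iff₀ hu]; linarith
    have h1 : 1 < (x - u k) / u k := by rw [lt_div_iff₀ hu]; linarith
    unfold crm
    exact div_le_div₀ (Rm_pos _ h1).le (Rm_anti (show _ ∈ Ioi (1:ℝ) from h1) (show (31:ℝ) ∈ Ioi (1:ℝ) by norm_num) h31) (by positivity) (by gcongr; linarith)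
end

section
open Real Set

lemma usys_exists : ∃ (u : ℕ → ℝ) (K A' : ℝ), USys u K ∧ 0 < A' ∧ ∀ n, VV n = A' * (sL / u n) := by
  obtain ⟨A, K, hA, hK, h⟩ := primes_main
  have hup : ∀ n, 0 < A / VV n := fun n => div_pos hA (VV_pos n)
  have hwp : ∀ k : ℕ, k.Prime → uw (fun n => A / VV n) k = 1 / k := by
    intro k hk
    unfold uw
    simp only [VV_succ_prime hk]
    have h1 : (1:ℝ) < k := by exact_mod_cast hk.one_lt
    have h2 : (0:ℝ) < k - 1 := by linarith
    have := VV_pos k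
    have h3 : 1 - 1 / (k:ℝ) = (k - 1) / k := by field_simp
    rw [h3]
    field_simp
    ring
  have hwn : ∀ k : ℕ, ¬ k.Prime → uw (fun n => A / VV n) k = 0 := by
    intro k hk
    unfold uw
    simp only [VV_succ_nonprime hk]
    simp
  have hd : ∀ k, A / VV (k+1) - A / VV k = uw (fun n => A / VV n) k * (A / VV (k+1)) := by
    intro k
    unfold uw
    simp only []
    rw [div_mul_cancel₀ _ (hup _).ne']
  refine ⟨fun n => A / VV n, K, A / sL, ⟨hup, ?_, ?_, fun n hn => (h n hn).1, ?_, hwp, hwn⟩, div_pos hA sL_pos, ?_⟩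
  · apply monotone_nat_of_le_succ
    intro k
    have h1 := hd k
    have : 0 ≤ uw (fun n => A / VV n) k := by
      by_cases hk : k.Prime
      · rw [hwp k hk]; positivity
      · rw [hwn k hk]
    have := mul_nonneg this (hup (k+1)).le
    linarith
  · intro k
    have h1 := hd k
    have : uw (fun n => A / VV n) k ≤ 1 / 2 := by
      by_cases hk : k.Prime
      · rw [hwp k hk]
        have : (2:ℝ) ≤ k := by exact_mod_cast hk.two_le
        gcongr
      · rw [hwn k hk]; norm_num
    have := mul_le_mul_of_nonneg_right this (hup (k+1)).le
    linarith
  · intro n hn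
    have e : ∑ k ∈ Finset.range n, uw (fun n => A / VV n) k * (log k - A / VV k) * (A / VV k) = PS (fun p => (log p - A / VV p) * (A / VV p) / p) n := by
      unfold PS
      apply Finset.sum_congr rfl
      intro k _
      split_ifs with hk
      · rw [hwp k hk]; ring
      · rw [hwn k hk]; ring
    rw [e]; exact (h n hn).2
  · intro n
    have := VV_pos n
    have := sL_pos
    field_simp

noncomputable def TP (Kf x u : ℝ) : ℝ := sP (x / u) / x + Kf * (cc x * crp x u + fl x u)
noncomputable def TM (Kf x u : ℝ) : ℝ := sp (x / u) / x - Kf * (cc x * crm x u + fl x u)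

lemma TP_eq {Kf x u : ℝ} (hx : 0 < x) (hu : 0 < u) : TP Kf x u = sL / u + (cap x u + Kf * (cc x * crp x u + fl x u)) := by
  unfold TP cap alp; field_simp; ring
lemma TM_eq {Kf x u : ℝ} (hx : 0 < x) (hu : 0 < u) : TM Kf x u = sL / u - (cam x u + Kf * (cc x * crm x u + fl x u)) := by
  unfold TM cam alm; field_simp; ring

lemma fl_lower {x u : ℝ} (hx : 1 ≤ x) (hu : 1 ≤ u) : 1 / x ^ 6 ≤ fl x u := by
  unfold fl
  have h1 : √x ≤ x := by
    rw [Real.sqrt_le_left (by linarith)]; nlinarith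
  have h2 : x ^ 5 * √x ≤ x ^ 6 := by
    calc x ^ 5 * √x ≤ x ^ 5 * x := by gcongr
      _ = x ^ 6 := by ring
  have : 0 < √x := by positivity
  exact div_le_div₀ (by positivity) (one_le_pow₀ hu) (by positivity) h2

lemma fl_pos {x u : ℝ} (hx : 0 < x) (hu : 0 < u) : 0 < fl x u := by unfold fl; positivity

lemma exp_decay {x M : ℝ} (hx : 0 < x) (hM : 0 ≤ M) (h : M * 42 ^ 7 ≤ x) : M * exp (-(x / 6)) ≤ 1 / x ^ 6 := by
  have h1 : x / 42 ≤ exp (x / 42) := by linarith [Real.add_one_le_exp (x / 42)]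
  have h2 : (x / 42) ^ 7 ≤ exp (x / 6) := by
    have : exp (x / 6) = exp (x / 42) ^ 7 := by rw [← Real.exp_nat_mul]; congr 1; push_cast; ring
    rw [this]; gcongr
  rw [Real.exp_neg, ← div_eq_mul_inv, div_le_div_iff₀ (exp_pos _) (by positivity)]
  have e : (x / 42) ^ 7 = x ^ 6 * x / 42 ^ 7 := by ring
  rw [e, div_le_iff₀ (by norm_num)] at h2
  have := mul_le_mul_of_nonneg_right h (by positivity : 0 ≤ x ^ 6)
  nlinarith

lemma USys.tele {u : ℕ → ℝ} {K : ℝ} (hs : USys u K) {z0 z : ℕ} (hz : z0 ≤ z) :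
    ∑ k ∈ Finset.Ico z0 z, uw u k * (sL / u k) = sL / u z0 - sL / u z := by
  have : ∑ k ∈ Finset.Ico z0 z, uw u k * (sL / u k) = ∑ k ∈ Finset.Ico z0 z, ((fun n => -(sL / u n)) (k+1) - (fun n => -(sL / u n)) k) := by
    apply Finset.sum_congr rfl
    intro k _
    have := hs.pos k
    have := hs.pos (k+1)
    unfold uw
    field_simp
    ring
  rw [this, Finset.sum_Ico_sub (fun n => -(sL / u n)) hz]; ring

lemma USys.filter_sum {u : ℕ → ℝ} {K : ℝ} (hs : USys u K) (z0 z : ℕ) (G : ℕ → ℝ) :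
    ∑ p ∈ (Finset.Ico z0 z).filter Nat.Prime, (1 / (p:ℝ)) * G p = ∑ k ∈ Finset.Ico z0 z, uw u k * G k := by
  rw [Finset.sum_filter]
  apply Finset.sum_congr rfl
  intro k _
  split_ifs with hk
  · rw [hs.wp k hk]
  · rw [hs.wn k hk]; ring

lemma exp_child {x : ℝ} {p : ℕ} (hp : p.Prime) : exp x / p = exp (x - log p) := by
  have : (0:ℝ) < p := by exact_mod_cast hp.pos
  rw [Real.exp_sub, Real.exp_log this]
end

section
open Real Set

lemma low_step {u : ℕ → ℝ} {K A' Kf : ℝ} (hs : USys u K) (hA' : 0 < A') (hV : ∀ n, VV n = A' * (sL / u n))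
    {z0 z : ℕ} (hz0 : 1 ≤ z0) (hz : z0 ≤ z) (hU : 2 * K ≤ u z0) {x : ℝ} (hx : 2 * u z ≤ x)
    (ih : ∀ p : ℕ, z0 ≤ p → p < z → ∀ a T y, u p / 2 ≤ y → (sieveS a T (exp y) p : ℝ) ≤ exp y * (A' * TP Kf y (u p)))
    (ana : ∑ k ∈ Finset.Ico z0 z, uw u k * (cap (x - log k) (u k) + Kf * (cc (x - log k) * crp (x - log k) (u k) + fl (x - log k) (u k))) + fl x (u z)
      ≤ cam x (u z) + Kf * (cc x * crm x (u z) + fl x (u z)))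
    (a : ℕ → ℤ) (T : ℝ) : exp x * (A' * (TM Kf x (u z) + fl x (u z))) - 2 ^ z0 ≤ sieveS a T (exp x) z := by
  obtain ⟨a', T', hb⟩ := sieveS_buchstab a T
  have h1 := sieveS_sum a T a' T' (exp x) (fun p hp => (hb p hp).2 _) z0 z hz
  have h2 := (abs_le.1 (sieveS_base z0 a T (exp x) (exp_pos x).le)).1
  have hup := hs.pos
  have hx0 : 0 < x := by linarith [hup z]
  have hlow : ∀ k, z0 ≤ k → k < z → u k / 2 ≤ x - log k := by
    intro k hk hk'
    have l := abs_le.1 (hs.logd k (hz0.trans hk))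
    have := hs.mono hk'.le
    have := hs.mono hk
    linarith
  have h3 : ∑ p ∈ (Finset.Ico z0 z).filter Nat.Prime, (sieveS (a' p) (T' p) (exp x / p) p : ℝ)
      ≤ exp x * (A' * ∑ k ∈ Finset.Ico z0 z, uw u k * TP Kf (x - log k) (u k)) := by
    rw [← hs.filter_sum, Finset.mul_sum, Finset.mul_sum]
    apply Finset.sum_le_sum
    intro p hp
    rw [Finset.mem_filter, Finset.mem_Ico] at hp
    obtain ⟨⟨p1, p2⟩, p3⟩ := hp
    have := ih p p1 p2 (a' p) (T' p) (x - log p) (hlow p p1 p2)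
    rw [← exp_child p3] at this
    refine this.trans (le_of_eq ?_)
    ring
  have h4 : ∑ k ∈ Finset.Ico z0 z, uw u k * TP Kf (x - log k) (u k) = sL / u z0 - sL / u z +
     ∑ k ∈ Finset.Ico z0 z, uw u k * (cap (x - log k) (u k) + Kf * (cc (x - log k) * crp (x - log k) (u k) + fl (x - log k) (u k))) := by
    rw [← hs.tele hz, ← Finset.sum_add_distrib]
    apply Finset.sum_congr rfl
    intro k hk
    rw [Finset.mem_Ico] at hk
    rw [TP_eq (by have := hlow k hk.1 hk.2; linarith [hup k]) (hup k)]
    ring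
  rw [h1, TM_eq hx0 (hup z)]
  rw [hV] at h2
  have h5 : exp x * (A' * ∑ k ∈ Finset.Ico z0 z, uw u k * TP Kf (x - log k) (u k)) ≤
     exp x * (A' * (sL / u z0 - sL / u z + (cam x (u z) + Kf * (cc x * crm x (u z) + fl x (u z)) - fl x (u z)))) := by
    rw [h4]
    refine mul_le_mul_of_nonneg_left (mul_le_mul_of_nonneg_left ?_ hA'.le) (exp_pos x).le
    linarith
  generalize cam x (u z) + Kf * (cc x * crm x (u z) + fl x (u z)) = Q at *
  linarith

lemma up_step {u : ℕ → ℝ} {K A' Kf : ℝ} (hs : USys u K) (hA' : 0 < A') (hV : ∀ n, VV n = A' * (sL / u n))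
    {z0 z : ℕ} (hz0 : 1 ≤ z0) (hz : z0 ≤ z) (hU : 2 * K ≤ u z0) {x : ℝ} (hx : 3 * u z ≤ x)
    (ih : ∀ p : ℕ, z0 ≤ p → p < z → ∀ a T y, 3 / 2 * u p ≤ y → exp y * (A' * TM Kf y (u p)) ≤ (sieveS a T (exp y) p : ℝ))
    (ana : ∑ k ∈ Finset.Ico z0 z, uw u k * (cam (x - log k) (u k) + Kf * (cc (x - log k) * crm (x - log k) (u k) + fl (x - log k) (u k))) + fl x (u z)
      ≤ cap x (u z) + Kf * (cc x * crp x (u z) + fl x (u z)))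
    (a : ℕ → ℤ) (T : ℝ) : (sieveS a T (exp x) z : ℝ) ≤ exp x * (A' * (TP Kf x (u z) - fl x (u z))) + 2 ^ z0 := by
  obtain ⟨a', T', hb⟩ := sieveS_buchstab a T
  have h1 := sieveS_sum a T a' T' (exp x) (fun p hp => (hb p hp).2 _) z0 z hz
  have h2 := (abs_le.1 (sieveS_base z0 a T (exp x) (exp_pos x).le)).2
  have hup := hs.pos
  have hx0 : 0 < x := by linarith [hup z]
  have hlow : ∀ k, z0 ≤ k → k < z → 3 / 2 * u k ≤ x - log k := by
    intro k hk hk'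
    have l := abs_le.1 (hs.logd k (hz0.trans hk))
    have := hs.mono hk'.le
    have := hs.mono hk
    linarith
  have h3 : exp x * (A' * ∑ k ∈ Finset.Ico z0 z, uw u k * TM Kf (x - log k) (u k)) ≤ ∑ p ∈ (Finset.Ico z0 z).filter Nat.Prime, (sieveS (a' p) (T' p) (exp x / p) p : ℝ) := by
    rw [← hs.filter_sum, Finset.mul_sum, Finset.mul_sum]
    apply Finset.sum_le_sum
    intro p hp
    rw [Finset.mem_filter, Finset.mem_Ico] at hp
    obtain ⟨⟨p1, p2⟩, p3⟩ := hp
    have := ih p p1 p2 (a' p) (T' p) (x - log p) (hlow p p1 p2)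
    rw [← exp_child p3] at this
    refine le_trans (le_of_eq ?_) this
    ring
  have h4 : ∑ k ∈ Finset.Ico z0 z, uw u k * TM Kf (x - log k) (u k) = sL / u z0 - sL / u z -
     ∑ k ∈ Finset.Ico z0 z, uw u k * (cam (x - log k) (u k) + Kf * (cc (x - log k) * crm (x - log k) (u k) + fl (x - log k) (u k))) := by
    rw [← hs.tele hz, ← Finset.sum_sub_distrib]
    apply Finset.sum_congr rfl
    intro k hk
    rw [Finset.mem_Ico] at hk
    rw [TM_eq (by have := hlow k hk.1 hk.2; linarith [hup k]) (hup k)]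
    ring
  rw [h1, TP_eq hx0 (hup z)]
  rw [hV] at h2
  have h5 :
     exp x * (A' * (sL / u z0 - sL / u z - (cap x (u z) + Kf * (cc x * crp x (u z) + fl x (u z)) - fl x (u z)))) ≤ exp x * (A' * ∑ k ∈ Finset.Ico z0 z, uw u k * TM Kf (x - log k) (u k)) := by
    rw [h4]
    refine mul_le_mul_of_nonneg_left (mul_le_mul_of_nonneg_left ?_ hA'.le) (exp_pos x).le
    linarith
  generalize cap x (u z) + Kf * (cc x * crp x (u z) + fl x (u z)) = Q at *
  linarith
end

section
open Real Set

lemma exists_crossing {u : ℕ → ℝ} {x : ℝ} {z0 z : ℕ} (hz : z0 ≤ z) (h0 : 3 * u z0 ≤ x) (h1 : x < 3 * u z) :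
    ∃ w, z0 ≤ w ∧ w < z ∧ 3 * u w ≤ x ∧ x < 3 * u (w+1) := by
  by_contra hc
  push Not at hc
  have : ∀ n, z0 ≤ n → n ≤ z → 3 * u n ≤ x := by
    intro n hn
    induction n, hn using Nat.le_induction with
    | base => intro _; exact h0
    | succ n hn ih => intro h; exact hc n hn (by omega) (ih (by omega))
  linarith [this z hz le_rfl]

lemma cross_bound {u : ℕ → ℝ} {K : ℝ} (hs : USys u K) {x : ℝ} {w : ℕ} (hw : 1 ≤ w) (hx : 1 ≤ x) (h1 : 3 * u w ≤ x) (h2 : x < 3 * u (w+1)) :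
    sP (x / u w) / x ≤ 1 / x + 2 * exp K * exp (-(x / 6)) := by
  have hup := hs.pos w
  have hup' := hs.pos (w+1)
  have hx0 : 0 < x := by linarith
  have hpr : w.Prime := by
    by_contra hc
    have := hs.wn w hc
    unfold uw at this
    rw [div_eq_zero_iff] at this
    rcases this with h | h <;> linarith
  have hw2 : (2:ℝ) ≤ w := by exact_mod_cast hpr.two_le
  have hwp := hs.wp w hpr
  unfold uw at hwp
  have hu : u w = u (w+1) * (1 - 1 / w) := by
    rw [div_eq_iff hup'.ne'] at hwp; linarith
  have hF := F_anti (show (3:ℝ) ∈ Ioi 0 by norm_num) (show x / u w ∈ Ioi 0 from div_pos hx0 hup) (by rw [le_div_iff₀ hup]; linarith)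
  simp only [sP_one 3 le_rfl] at hF
  have e1 : sP (x / u w) / (x / u w) = sP (x / u w) / x * u w := by field_simp
  rw [e1] at hF
  have e2 : sP (x / u w) / x ≤ 1 / (3 * u w) := by
    rw [le_div_iff₀ (by positivity)]; linarith
  have hq : 1 / 2 ≤ 1 - 1 / (w:ℝ) := by
    have : 1 / (w:ℝ) ≤ 1 / 2 := by gcongr
    linarith
  have e3 : 1 / (3 * u w) ≤ (1 / x) * (1 / (1 - 1 / w)) := by
    rw [hu, one_div_mul_one_div]
    apply one_div_le_one_div_of_le (mul_pos hx0 (by linarith))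
    nlinarith
  have e4 : 1 / (1 - 1 / (w:ℝ)) ≤ 1 + 2 / w := by
    rw [div_le_iff₀ (by linarith)]
    have : 1 / (w:ℝ) * (1/w) ≤ 1/2 * (1 / w) := by
      apply mul_le_mul_of_nonneg_right _ (by positivity)
      linarith
    have e : (2:ℝ) / w = 2 * (1 / w) := by ring
    rw [e]; nlinarith
  have e5 : 1 / (w:ℝ) ≤ exp K * exp (-(x / 6)) := by
    have l := abs_le.1 (hs.logd w hw)
    have j := hs.jump w
    have : exp (x / 6 - K) ≤ w := by
      rw [← Real.le_log_iff_exp_le (by linarith)]; linarith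
    have h := one_div_le_one_div_of_le (exp_pos _) this
    rw [one_div (exp _), ← Real.exp_neg] at h
    rw [← Real.exp_add]
    have e : K + -(x / 6) = -(x / 6 - K) := by ring
    rw [e]; exact h
  have hx1 : 1 / x ≤ 1 := by rw [div_le_one hx0]; exact hx
  have hx2 : 0 < 1 / x := by positivity
  have hw3 : 0 ≤ 1 / (w:ℝ) := by positivity
  calc sP (x / u w) / x ≤ (1 / x) * (1 + 2 / w) := (e2.trans e3).trans (mul_le_mul_of_nonneg_left e4 hx2.le)
    _ = 1 / x + (1 / x) * (2 * (1 / w)) := by ring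
    _ ≤ 1 / x + 1 * (2 * (1 / w)) := by gcongr
    _ ≤ _ := by linarith

theorem sieve_main : ∃ (u : ℕ → ℝ) (K A' Kf : ℝ) (z0 : ℕ), USys u K ∧ 0 < A' ∧ 1 ≤ Kf ∧ 1 ≤ z0 ∧ 2 * K + 2 ≤ u z0 ∧
    ∀ z, z0 ≤ z → ∀ a T x,
      (u z / 2 ≤ x → (sieveS a T (exp x) z : ℝ) ≤ exp x * (A' * TP Kf x (u z))) ∧
      (3 / 2 * u z ≤ x → exp x * (A' * TM Kf x (u z)) ≤ (sieveS a T (exp x) z : ℝ)) := by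
  obtain ⟨u, K, A', hs, hA', hV⟩ := usys_exists
  have hK := hs.Knn
  have hup := hs.pos
  obtain ⟨xm, Km, hxm, hKm, hm⟩ := ana_minus K hK
  obtain ⟨xp, Kp, hxp, hKp, hp⟩ := ana_plus K hK
  obtain ⟨z0, hz0, hU⟩ : ∃ z0 : ℕ, 1 ≤ z0 ∧ 2 * K + 2 ≤ u z0 := by
    refine ⟨⌈exp (3 * K + 2)⌉₊, Nat.one_le_iff_ne_zero.2 (Nat.ceil_pos.2 (exp_pos _)).ne', ?_⟩
    have h1 := Nat.le_ceil (exp (3 * K + 2))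
    have h0 : 1 ≤ ⌈exp (3 * K + 2)⌉₊ := Nat.one_le_iff_ne_zero.2 (Nat.ceil_pos.2 (exp_pos _)).ne'
    have l := abs_le.1 (hs.logd _ h0)
    have := (Real.le_log_iff_exp_le (lt_of_lt_of_le (exp_pos _) h1)).2 h1
    linarith
  obtain ⟨M, hM⟩ : ∃ M, M = 2 * exp K + 2 ^ z0 / A' := ⟨_, rfl⟩
  have hM0 : 0 < M := by rw [hM]; have := exp_pos K; positivity
  obtain ⟨X1, hX1⟩ : ∃ X1, X1 = xm + xp + 16 * u z0 + M * 42 ^ 7 := ⟨_, rfl⟩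
  have hM7 : 0 < M * 42 ^ 7 := by positivity
  have hu0 := hup z0
  have hsL := sL_pos
  have hX1pos : 1 ≤ X1 := by linarith
  obtain ⟨Kf, hKf⟩ : ∃ Kf, Kf = Km + Kp + (2 / A' + sL) * X1 ^ 6 := ⟨_, rfl⟩
  have hKe : 0 < (2 / A' + sL) * X1 ^ 6 := by positivity
  have hKf1 : 1 ≤ Kf := by linarith
  refine ⟨u, K, A', Kf, z0, hs, hA', hKf1, hz0, hU, ?_⟩
  have small : ∀ x v, 1 ≤ x → x ≤ X1 → 1 ≤ v → 2 / A' + sL ≤ Kf * fl x v := by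
    intro x v h1 h2 h3
    have f1 := fl_lower h1 h3
    have f2 : 1 / X1 ^ 6 ≤ fl x v := le_trans (by gcongr) f1
    have f3 : (2 / A' + sL) * X1 ^ 6 ≤ Kf := by linarith
    calc 2 / A' + sL = ((2 / A' + sL) * X1 ^ 6) * (1 / X1 ^ 6) := by field_simp
      _ ≤ _ := mul_le_mul f3 f2 (by positivity) (by linarith)
  have hdec : ∀ x, X1 ≤ x → 2 * exp K * exp (-(x / 6)) + 2 ^ z0 / (exp x * A') ≤ 1 / x ^ 6 := by
    intro x hx
    have hx0 : 0 < x := by linarith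
    have := exp_decay hx0 hM0.le (by linarith)
    refine le_trans ?_ this
    rw [hM, add_mul]
    gcongr
    have : exp (-x) ≤ exp (-(x / 6)) := by gcongr; linarith
    calc 2 ^ z0 / (exp x * A') = 2 ^ z0 / A' * exp (-x) := by rw [Real.exp_neg]; field_simp
      _ ≤ _ := by gcongr
  intro z
  induction z using Nat.strong_induction_on with
  | _ z ih =>
  intro hz a T x
  have huz : 2 * K + 2 ≤ u z := hU.trans (hs.mono hz)
  have huz1 : 1 ≤ u z := by linarith
  have hupz := hup z
  have hex := exp_pos x
  have cancel : ∀ Q : ℝ, exp x * (A' * (Q + 2 ^ z0 / (exp x * A'))) = exp x * (A' * Q) + 2 ^ z0 := by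
    intro Q; field_simp
  constructor
  · intro hx
    have hx1 : 1 ≤ x := by linarith
    have hx0 : 0 < x := by linarith
    rcases le_total x X1 with hxs | hxs
    · have h1 := sieveS_le a T (exp x) hex.le z
      have h2 : 1 ≤ exp x := Real.one_le_exp hx0.le
      have h3 : 2 / A' ≤ TP Kf x (u z) := by
        rw [TP_eq hx0 hupz]
        have := small x (u z) hx1 hxs huz1
        have h4 := cap_nonneg hupz hx0
        have h5 : 0 ≤ Kf * (cc x * crp x (u z)) := by
          have := cc_nonneg hx1
          have := (crp_pos (u := u z) hx0).le
          positivity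
        have : 0 < sL / u z := by positivity
        rw [mul_add]; linarith
      have h4 : 2 ≤ A' * TP Kf x (u z) := by
        rw [div_le_iff₀ hA'] at h3; linarith
      nlinarith
    · have big : ∀ w, z0 ≤ w → w ≤ z → 3 * u w ≤ x → (sieveS a T (exp x) w : ℝ) ≤ exp x * (A' * (TP Kf x (u w) - fl x (u w) + 2 ^ z0 / (exp x * A'))) := by
        intro w hw hwz hwx
        rw [cancel]
        refine up_step hs hA' hV hz0 hw (by linarith) hwx ?_ ?_ a T
        · intro p p1 p2 a T y hy
          exact (ih p (by omega) p1 a T y).2 hy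
        · exact hp u hs z0 w hz0 hw x Kf (by linarith) (by linarith) (by linarith) hwx (by linarith)
      have hd := hdec x hxs
      have hek : 0 < 2 * exp K * exp (-(x / 6)) := by positivity
      rcases le_or_gt (3 * u z) x with hc | hc
      · refine (big z hz le_rfl hc).trans ?_
        refine mul_le_mul_of_nonneg_left (mul_le_mul_of_nonneg_left ?_ hA'.le) hex.le
        have := fl_lower hx1 huz1
        linarith
      · obtain ⟨w, w1, w2, w3, w4⟩ := exists_crossing hz (by linarith) hc
        have hSw : (sieveS a T (exp x) z : ℝ) ≤ sieveS a T (exp x) w := by exact_mod_cast sieveS_anti a T _ w2.le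
        refine hSw.trans ((big w w1 w2.le w3).trans ?_)
        refine mul_le_mul_of_nonneg_left (mul_le_mul_of_nonneg_left ?_ hA'.le) hex.le
        have huw := hup w
        have hwz := hs.mono w2.le
        have hw0 := hs.mono w1
        have f1 := fl_lower hx1 (by linarith : 1 ≤ u w)
        have cb := cross_bound hs (hz0.trans w1) hx1 w3 w4
        have r1 : crp x (u w) ≤ crp x (u z) := by
          unfold crp
          have := Rp_anti (show x / u z ≤ x / u w by gcongr)
          gcongr
        have r2 : fl x (u w) ≤ fl x (u z) := by unfold fl; gcongr
        have r3 : Kf * (cc x * crp x (u w) + fl x (u w)) ≤ Kf * (cc x * crp x (u z) + fl x (u z)) := by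
          have := cc_nonneg hx1
          gcongr
        have r4 : sP (x / u z) = 1 := sP_one _ (by rw [div_le_iff₀ hupz]; linarith)
        unfold TP
        rw [r4]
        linarith
  · intro hx
    have hx1 : 1 ≤ x := by linarith
    have hx0 : 0 < x := by linarith
    have hS0 : (0:ℝ) ≤ sieveS a T (exp x) z := Nat.cast_nonneg _
    have hcr : 0 ≤ Kf * (cc x * crm x (u z)) := by
      have := cc_nonneg hx1
      have := (crm_pos hupz (by linarith : u z < x)).le
      positivity
    have nonpos : TM Kf x (u z) ≤ 0 → exp x * (A' * TM Kf x (u z)) ≤ (sieveS a T (exp x) z : ℝ) := by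
      intro h
      exact le_trans (mul_nonpos_of_nonneg_of_nonpos hex.le (mul_nonpos_of_nonneg_of_nonpos hA'.le h)) hS0
    rcases le_total x X1 with hxs | hxs
    · apply nonpos
      rw [TM_eq hx0 hupz, mul_add]
      have := small x (u z) hx1 hxs huz1
      have h4 := cam_nonneg hupz (by linarith : u z < x)
      have h5 : sL / u z ≤ sL := div_le_self hsL.le huz1
      have : 0 < 2 / A' := by positivity
      linarith
    · rcases lt_or_ge x (2 * u z) with hc | hc
      · apply nonpos
        unfold TM
        have hs2 : x / u z < 2 := by rw [div_lt_iff₀ hupz]; linarith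
        have hs3 : 1 < x / u z := by rw [lt_div_iff₀ hupz]; linarith
        rw [sp_log _ (by linarith), mul_add]
        have h1 : log (x / u z - 1) ≤ 0 := Real.log_nonpos (by linarith) (by linarith)
        have h2 : log (x / u z - 1) / x ≤ 0 := div_nonpos_of_nonpos_of_nonneg h1 hx0.le
        have := mul_pos (by linarith : 0 < Kf) (fl_pos hx0 hupz)
        linarith
      · have h := low_step (Kf := Kf) hs hA' hV hz0 hz (by linarith) hc (fun p p1 p2 a T y hy => (ih p p2 p1 a T y).1 hy)
          (hm u hs z0 z hz0 hz x Kf (by linarith) (by linarith) (by linarith) hc) a T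
        refine le_trans ?_ h
        have := fl_lower hx1 huz1
        have hd := hdec x hxs
        have hek : 0 < 2 * exp K * exp (-(x / 6)) := by positivity
        have : exp x * (A' * (TM Kf x (u z) + 2 ^ z0 / (exp x * A'))) ≤ exp x * (A' * (TM Kf x (u z) + fl x (u z))) := by
          refine mul_le_mul_of_nonneg_left (mul_le_mul_of_nonneg_left ?_ hA'.le) hex.le
          linarith
        rw [cancel] at this
        linarith
end

section
open Real Set

lemma fl_le_inv {x u : ℝ} (hx : 1 ≤ x) (hu : 0 ≤ u) (hux : u ≤ x) : fl x u ≤ 1 / x ^ 2 := by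
  unfold fl
  have hs : 1 ≤ √x := Real.one_le_sqrt.2 hx
  rw [div_le_div_iff₀ (by positivity) (by positivity), one_mul]
  have h3 : u ^ 3 ≤ x ^ 3 := by gcongr
  calc u ^ 3 * x ^ 2 ≤ x ^ 3 * x ^ 2 := by gcongr
    _ = x ^ 5 * 1 := by ring
    _ ≤ x ^ 5 * √x := by gcongr

lemma TM_low {K Kf M L u : ℝ} (hK : 0 ≤ K) (hKf : 1 ≤ Kf) (hM : M = 2 * K + 5 * Kf + 19)
    (hL : 10 * (K + Kf + M) ≤ L) (hu : |L - u| ≤ K) : 19 / (9 * L ^ 2) ≤ TM Kf (2 * L + M) u := by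
  obtain ⟨h1, h2⟩ := abs_le.1 hu
  have hu0 : 0 < u := by linarith
  obtain ⟨x, hx⟩ : ∃ x, x = 2 * L + M := ⟨_, rfl⟩
  rw [← hx]
  have hx1 : 1 ≤ x := by linarith
  have hx0 : 0 < x := by linarith
  have hL0 : 0 < L := by linarith
  obtain ⟨t, ht⟩ : ∃ t, t = (x - 2 * u) / u := ⟨_, rfl⟩
  have hs : x / u = 2 + t := by rw [ht]; field_simp; ring
  have ht0 : (M - 2 * K) / u ≤ t := by
    rw [ht]; exact div_le_div_of_nonneg_right (by linarith) hu0.le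
  have hD : 0 < (M - 2 * K) / u := div_pos (by linarith) hu0
  have ht1 : t ≤ 1 := by rw [ht, div_le_one hu0]; linarith
  have hlog : t / 2 ≤ log (1 + t) := by
    have := Real.one_sub_inv_le_log_of_pos (show 0 < 1 + t by linarith)
    refine le_trans ?_ this
    have e : 1 - (1 + t)⁻¹ = t / (1 + t) := by
      have : 1 + t ≠ 0 := by linarith
      field_simp; ring
    rw [e]
    apply div_le_div_of_nonneg_left <;> linarith
  unfold TM crm
  rw [hs, sp_log _ (by linarith), Rm_small _ (by linarith)]
  have e1 : 2 + t - 1 = 1 + t := by ring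
  rw [e1]
  have hR : (2 + t) / (1 + t) - log (1 + t) ≤ 2 := by
    have : (2 + t) / (1 + t) ≤ 2 := by rw [div_le_iff₀] <;> linarith
    linarith
  have hf := fl_le_inv hx1 hu0.le (by linarith)
  have hc := cc_le (x := x)
  have hc1 := cc_nonneg hx1
  have hx2 : 0 < 1 / x ^ 2 := by positivity
  have a1 : cc x * (((2 + t) / (1 + t) - log (1 + t)) / x ^ 2) ≤ 4 * (1 / x ^ 2) := by
    have : cc x * ((2 + t) / (1 + t) - log (1 + t)) ≤ 4 := by
      calc _ ≤ cc x * 2 := by gcongr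
        _ ≤ 4 := by linarith
    calc _ = cc x * ((2 + t) / (1 + t) - log (1 + t)) * (1 / x ^ 2) := by ring
      _ ≤ _ := by gcongr
  have a2 : Kf * (cc x * (((2 + t) / (1 + t) - log (1 + t)) / x ^ 2) + fl x u) ≤ Kf * (5 * (1 / x ^ 2)) :=
    mul_le_mul_of_nonneg_left (by linarith) (by linarith)
  have a3 : (M - 2 * K) * (1 / x ^ 2) ≤ log (1 + t) / x := by
    have b1 : (M - 2 * K) / x ≤ t / 2 := by
      calc (M - 2 * K) / x ≤ (M - 2 * K) / (2 * u) := by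
            apply div_le_div_of_nonneg_left <;> linarith
        _ = (M - 2 * K) / u / 2 := by field_simp
        _ ≤ _ := by linarith
    calc (M - 2 * K) * (1 / x ^ 2) = (M - 2 * K) / x / x := by field_simp
      _ ≤ _ := by gcongr; linarith
  have a4 : 19 / (9 * L ^ 2) ≤ 19 * (1 / x ^ 2) := by
    rw [mul_one_div]
    apply div_le_div_of_nonneg_left (by norm_num) (by positivity)
    have : x ≤ 3 * L := by linarith
    calc x ^ 2 ≤ (3 * L) ^ 2 := by gcongr
      _ = _ := by ring
  have a5 : (M - 2 * K) * (1 / x ^ 2) = Kf * (5 * (1 / x ^ 2)) + 19 * (1 / x ^ 2) := by rw [hM]; ring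
  linarith

lemma TP_up {K Kf M L u : ℝ} (hK : 0 ≤ K) (hKf : 1 ≤ Kf) (hM : M = 2 * K + 5 * Kf + 19)
    (hL : 10 * (K + Kf + M) ≤ L) (hu : |L - u| ≤ K) : TP Kf (L + M) u ≤ 2 / L := by
  obtain ⟨h1, h2⟩ := abs_le.1 hu
  have hu0 : 0 < u := by linarith
  obtain ⟨x, hx⟩ : ∃ x, x = L + M := ⟨_, rfl⟩
  rw [← hx]
  have hx1 : 1 ≤ x := by linarith
  have hx0 : 0 < x := by linarith
  have hL0 : 0 < L := by linarith
  have hs : x / u ≤ 3 := by rw [div_le_iff₀ hu0]; linarith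
  unfold TP crp
  rw [sP_one _ hs, Rp_one _ hs]
  have hf := fl_le_inv hx1 hu0.le (by linarith)
  have hc := cc_le (x := x)
  have hx2 : 0 < 1 / x ^ 2 := by positivity
  have a1 : Kf * (cc x * (1 / x ^ 2) + fl x u) ≤ Kf * (3 * (1 / x ^ 2)) := by
    apply mul_le_mul_of_nonneg_left _ (by linarith)
    have : cc x * (1 / x ^ 2) ≤ 2 * (1 / x ^ 2) := by gcongr
    linarith
  have a2 : Kf * (3 * (1 / x ^ 2)) ≤ 1 / x := by
    have e : Kf * (3 * (1 / x ^ 2)) = (3 * Kf / x) * (1 / x) := by field_simp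
    rw [e]
    have : 3 * Kf / x ≤ 1 := by rw [div_le_one hx0]; linarith
    calc _ ≤ 1 * (1 / x) := by gcongr
      _ = _ := one_mul _
  have a3 : 1 / x ≤ 1 / L := one_div_le_one_div_of_le hL0 (by linarith)
  have e : 2 / L = 1 / L + 1 / L := by ring
  rw [e]; linarith

lemma large_primes_card {h z : ℕ} (hh : 1 ≤ h) (hz : 1 ≤ z) :
    ((h.primeFactors.filter (fun p => z ≤ p)).card : ℝ) * log z ≤ log h := by
  have h1 : z ^ (h.primeFactors.filter (fun p => z ≤ p)).card ≤ h := by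
    calc z ^ (h.primeFactors.filter (fun p => z ≤ p)).card
        ≤ ∏ p ∈ h.primeFactors.filter (fun p => z ≤ p), p := by
          apply Finset.pow_card_le_prod
          intro p hp; exact (Finset.mem_filter.1 hp).2
      _ ≤ ∏ p ∈ h.primeFactors, p := by
          apply Finset.prod_le_prod_of_subset_of_one_le' (Finset.filter_subset _ _)
          intro p hp _; exact (Nat.prime_of_mem_primeFactors hp).one_le
      _ ≤ h := Nat.le_of_dvd hh (Nat.prod_primeFactors_dvd h)
  rw [← Real.log_pow]
  apply Real.log_le_log
  · have : (0:ℝ) < z := by exact_mod_cast hz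
    positivity
  · exact_mod_cast h1

lemma exists_survivor (a : ℕ → ℤ) (T X : ℝ) (z h : ℕ) (hh : 1 ≤ h) (B : ℝ) (hX : 0 ≤ X) (hz : 1 ≤ z)
    (hB : ∀ a' T', (sieveS a' T' (X / z) z : ℝ) ≤ B)
    (hlt : ((h.primeFactors.filter (fun p => z ≤ p)).card : ℝ) * B < sieveS a T X z) :
    ∃ k : ℤ, T < k ∧ (k : ℝ) ≤ T + X ∧ ∀ p : ℕ, p.Prime → p ∣ h → ¬ (p : ℤ) ∣ k - a p := by
  classical
  obtain ⟨a', T', hb⟩ := sieveS_buchstab a T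
  by_contra hcon
  push Not at hcon
  set S := (Finset.Ioc ⌊T⌋ ⌊T + X⌋).filter (fun k => ∀ p : ℕ, p.Prime → p < z → ¬ (p : ℤ) ∣ k - a p) with hS
  have hSc : sieveS a T X z = S.card := by
    rw [hS]; unfold sieveS; congr!
  set F := fun p : ℕ => (Finset.Ioc ⌊T⌋ ⌊T + X⌋).filter (fun k => (∀ q : ℕ, q.Prime → q < z → ¬ (q : ℤ) ∣ k - a q) ∧
        (p : ℤ) ∣ k - a p) with hF
  have hsub : S ⊆ (h.primeFactors.filter (fun p => z ≤ p)).biUnion F := by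
    intro k hk
    rw [hS, Finset.mem_filter, Finset.mem_Ioc] at hk
    obtain ⟨⟨k1, k2⟩, k3⟩ := hk
    obtain ⟨p, pp, ph, pd⟩ := hcon k (Int.floor_lt.1 k1) (Int.le_floor.1 k2)
    rw [Finset.mem_biUnion]
    refine ⟨p, ?_, ?_⟩
    · rw [Finset.mem_filter]
      refine ⟨Nat.mem_primeFactors.2 ⟨pp, ph, by omega⟩, ?_⟩
      by_contra hp
      exact k3 p pp (by omega) pd
    · rw [hF]
      simp only [Finset.mem_filter, Finset.mem_Ioc]
      exact ⟨⟨k1, k2⟩, k3, pd⟩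
  have hcard : (S.card : ℝ) ≤ ∑ p ∈ h.primeFactors.filter (fun p => z ≤ p), ((F p).card : ℝ) := by
    exact_mod_cast (Finset.card_le_card hsub).trans Finset.card_biUnion_le
  have hle : ∑ p ∈ h.primeFactors.filter (fun p => z ≤ p), ((F p).card : ℝ) ≤
      ∑ p ∈ h.primeFactors.filter (fun p => z ≤ p), B := by
    apply Finset.sum_le_sum
    intro p hp
    obtain ⟨hp1, hp2⟩ := Finset.mem_filter.1 hp
    have e := (hb p (Nat.prime_of_mem_primeFactors hp1)).1 X z hp2
    have e2 : (F p).card = sieveS (a' p) (T' p) (X / p) z := by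
      rw [← e, hF]
    rw [e2]
    refine le_trans ?_ (hB (a' p) (T' p))
    have : X / (p:ℝ) ≤ X / z := by
      have : (0:ℝ) < z := by exact_mod_cast hz
      gcongr
    exact_mod_cast sieveS_mono (a' p) (T' p) z this
  rw [Finset.sum_const, nsmul_eq_mul] at hle
  rw [hSc] at hlt
  linarith

lemma jac_large : ∃ C Y0 : ℝ, 0 < C ∧ 1 ≤ Y0 ∧ ∀ h : ℕ, 1 ≤ h → ∀ Y : ℝ, Real.log h ≤ Y → Y0 ≤ Y →
    ∀ a : ℕ → ℤ, ∀ T : ℝ, ∃ k : ℤ, T < k ∧ (k : ℝ) ≤ T + C * Y ^ 2 ∧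
    ∀ p : ℕ, p.Prime → p ∣ h → ¬ (p : ℤ) ∣ k - a p := by
  obtain ⟨u, K, A', Kf, z0, hs, hA, hKf, hz0, -, hmain⟩ := sieve_main
  have hK := hs.Knn
  obtain ⟨M, hM⟩ : ∃ M, M = 2 * K + 5 * Kf + 19 := ⟨_, rfl⟩
  refine ⟨4 * exp M, exp (10 * (K + Kf + M)) + z0 + 1, by positivity, ?_, ?_⟩
  · have : 0 < exp (10 * (K + Kf + M)) := exp_pos _
    have : (0:ℝ) ≤ z0 := by positivity
    linarith
  intro h hh Y hY hY0 a T
  have he := exp_pos (10 * (K + Kf + M))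
  have hz0' : (0:ℝ) ≤ z0 := by positivity
  obtain ⟨z, hz⟩ : ∃ z, z = ⌈Y⌉₊ := ⟨_, rfl⟩
  have hYz : Y ≤ z := hz ▸ Nat.le_ceil Y
  have hzY : (z:ℝ) ≤ 2 * Y := by
    have := Nat.ceil_lt_add_one (show 0 ≤ Y by linarith)
    rw [← hz] at this
    linarith
  have hzz : z0 ≤ z := by
    have : (z0:ℝ) ≤ z := by linarith
    exact_mod_cast this
  have hz1 : 1 ≤ z := hz0.trans hzz
  have hzp : (0:ℝ) < z := by exact_mod_cast hz1
  obtain ⟨L, hL⟩ : ∃ L, L = log z := ⟨_, rfl⟩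
  have hLb : 10 * (K + Kf + M) ≤ L := by
    rw [hL, Real.le_log_iff_exp_le hzp]; linarith
  have hL0 : 0 < L := by linarith
  have hu := hs.logd z hz1
  rw [← hL] at hu
  obtain ⟨u1, u2⟩ := abs_le.1 hu
  have hexpL : exp L = z := by rw [hL, Real.exp_log hzp]
  have hx : exp (2 * L + M) = exp M * z ^ 2 := by
    rw [Real.exp_add, two_mul, Real.exp_add, hexpL]; ring
  have hx' : exp (L + M) = exp (2 * L + M) / z := by
    rw [hx, Real.exp_add, hexpL]; field_simp
  have hlow := (hmain z hzz a T (2 * L + M)).2 (by linarith)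
  have htm := TM_low hK hKf hM hLb hu
  have htp := TP_up hK hKf hM hLb hu
  obtain ⟨X, hX⟩ : ∃ X, X = exp (2 * L + M) := ⟨_, rfl⟩
  have hXp : 0 < X := hX ▸ exp_pos _
  rw [← hX] at hlow hx hx'
  obtain ⟨k, k1, k2, k3⟩ := exists_survivor a T X z h hh (X / z * (A' * (2 / L))) hXp.le hz1 (by
    intro a' T'
    have := (hmain z hzz a' T' (L + M)).1 (by linarith)
    rw [hx'] at this
    refine this.trans ?_
    gcongr) (by
    refine lt_of_lt_of_le ?_ hlow
    have hc := large_primes_card hh hz1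
    rw [← hL] at hc
    obtain ⟨n, hn⟩ : ∃ n : ℝ, n = ((h.primeFactors.filter (fun p => z ≤ p)).card : ℝ) := ⟨_, rfl⟩
    rw [← hn] at hc ⊢
    have hn2 : n ≤ z / L := by rw [le_div_iff₀ hL0]; linarith
    calc n * (X / z * (A' * (2 / L))) ≤ z / L * (X / z * (A' * (2 / L))) := by gcongr
      _ = X * (A' * (18 / (9 * L ^ 2))) := by field_simp; norm_num
      _ < X * (A' * (19 / (9 * L ^ 2))) := by gcongr; norm_num
      _ ≤ _ := by gcongr)
  refine ⟨k, k1, k2.trans ?_, k3⟩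
  have : X ≤ 4 * exp M * Y ^ 2 := by
    rw [hx]
    calc exp M * (z:ℝ) ^ 2 ≤ exp M * (2 * Y) ^ 2 := by gcongr
      _ = _ := by ring
  linarith

theorem jac_prop : JacProp := by
  obtain ⟨C, Y0, hC, hY0, H⟩ := jac_large
  have hl : 0 < log 2 := Real.log_pos (by norm_num)
  have hl1 : log 2 < 1 := by linarith [Real.log_two_lt_d9]
  refine ⟨C * (Y0 / log 2) ^ 2, by positivity, ?_⟩
  intro h hh Y hY hY2 a T
  obtain ⟨k, k1, k2, k3⟩ := H h hh (max Y Y0) (hY.trans (le_max_left _ _)) (le_max_right _ _) a T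
  refine ⟨k, k1, k2.trans ?_, k3⟩
  have : max Y Y0 ≤ Y0 / log 2 * Y := by
    apply max_le
    · have : 1 ≤ Y0 / log 2 := by rw [one_le_div hl]; linarith
      nlinarith
    · rw [div_mul_eq_mul_div, le_div_iff₀ hl]
      exact mul_le_mul_of_nonneg_left hY2 (by linarith)
  have h2 : (max Y Y0) ^ 2 ≤ (Y0 / log 2 * Y) ^ 2 := by
    have : 0 ≤ max Y Y0 := le_max_of_le_right (by linarith)
    gcongr
  calc T + C * (max Y Y0) ^ 2 ≤ T + C * (Y0 / log 2 * Y) ^ 2 := by gcongr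
    _ = _ := by ring
end

/-- There is an absolute constant `C'` such that every point of `ℙ¹(ℤ/Nℤ)`,
`N` square-free, has a coprime representative `(c, d)` with
`max(|c|,|d|) ≤ N/‖v_P‖ + C'·(log N)²·‖v_P‖`. -/
theorem small_coprime_representative :
    ∃ C' : ℝ, 0 < C' ∧ ∀ N : ℕ, 2 ≤ N → Squarefree N →
    ∀ u v : ℤ, Int.gcd u (Int.gcd v (N : ℤ)) = 1 →
    ∀ vP ∈ repLattice N u v, vP ≠ (0, 0) →
      (∀ w ∈ repLattice N u v, w ≠ (0, 0) →
        vP.1 ^ 2 + vP.2 ^ 2 ≤ w.1 ^ 2 + w.2 ^ 2) →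
    ∃ c d : ℤ, IsCoprime c d ∧ (c, d) ∈ repLattice N u v ∧
      ((max |c| |d| : ℤ) : ℝ) ≤
        (N : ℝ) / Real.sqrt ((vP.1 : ℝ) ^ 2 + (vP.2 : ℝ) ^ 2) +
          C' * Real.log N ^ 2 * Real.sqrt ((vP.1 : ℝ) ^ 2 + (vP.2 : ℝ) ^ 2) := final_of_jac jac_prop
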